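/- arXiv:1206.3176 — 2 statements merged into one kernel-verified Lean document; each statement's English description precedes it below -/
import Mathlib

section
/- Let Ω ⊆ ℝ^{n+1} be a nonempty proper open convex cone with open dual cone Ω*, let F_Ω and F_{Ω*} be canonical potentials of Ω and Ω*, and set u_Ω(x) = −((n+1)/2)·e^{−2F_Ω(x)/(n+1)} on Ω and u_{Ω*}(y) = −((n+1)/2)·e^{−2F_{Ω*}(y)/(n+1)} on Ω*. Then for every x ∈ Ω the point y = −∇u_Ω(x) lies in Ω* and −∇u_{Ω*}(y) = x; that is, the graph of −du_Ω over Ω and the graph of −du_{Ω*} over Ω* coincide as subsets of ℝ^{n+1} × ℝ^{n+1}. -/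
open scoped RealInnerProductSpace

noncomputable section

abbrev Euc (m : ℕ) : Type := EuclideanSpace ℝ (Fin m)

/-- The Hessian matrix of `F` at `x` in the standard coordinates. -/
def hessMatrix {m : ℕ} (F : Euc m → ℝ) (x : Euc m) : Matrix (Fin m) (Fin m) ℝ :=
  fun i j => iteratedFDeriv ℝ 2 F x ![EuclideanSpace.single i 1, EuclideanSpace.single j 1]

/-- A nonempty proper open convex cone in `ℝ^m`. -/
def IsOpenProperConvexCone {m : ℕ} (Ω : Set (Euc m)) : Prop :=
  Ω.Nonempty ∧ IsOpen Ω ∧ Convex ℝ Ω ∧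
    (∀ x ∈ Ω, ∀ t : ℝ, Real.exp t • x ∈ Ω) ∧
    ¬ ∃ p v : Euc m, v ≠ 0 ∧ ∀ t : ℝ, p + t • v ∈ closure Ω

/-- `F` tends to `+∞` along every sequence in `Ω` converging to a boundary point of `Ω`. -/
def BlowsUpOnBoundary {m : ℕ} (Ω : Set (Euc m)) (F : Euc m → ℝ) : Prop :=
  ∀ z ∈ frontier Ω, ∀ x : ℕ → Euc m, (∀ k, x k ∈ Ω) →
    Filter.Tendsto x Filter.atTop (nhds z) →
    Filter.Tendsto (fun k => F (x k)) Filter.atTop Filter.atTop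

/-- The canonical potential of a proper open convex cone `Ω ⊆ ℝ^{n+1}`. -/
def IsCanonicalPotential (n : ℕ) (Ω : Set (Euc (n+1))) (F : Euc (n+1) → ℝ) : Prop :=
  ContDiffOn ℝ (⊤ : ℕ∞) F Ω ∧
  (∀ x ∈ Ω, (hessMatrix F x).PosDef) ∧
  (∀ x ∈ Ω, (hessMatrix F x).det = Real.exp (2 * F x)) ∧
  (∀ x ∈ Ω, ∀ t : ℝ, F (Real.exp t • x) = F x - (n + 1) * t) ∧
  BlowsUpOnBoundary Ω F

/-- The open dual cone of `Ω`. -/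
def openDualCone {m : ℕ} (Ω : Set (Euc m)) : Set (Euc m) :=
  {y | ∀ x ∈ closure Ω, x ≠ 0 → 0 < ⟪x, y⟫}


section LinAlg

lemma det_one_le_aux {m : ℕ} (T : Matrix (Fin m) (Fin m) ℝ) (hT : T.IsHermitian)
    (h : (T - 1).PosSemidef) : 1 ≤ T.det := by
  rw [hT.det_eq_prod_eigenvalues]
  have : ∀ i, 1 ≤ hT.eigenvalues i := by
    intro i
    have h1 := hT.eigenvalues_eq i
    have h2 := h.dotProduct_mulVec_nonneg (hT.eigenvectorBasis i)
    have h3 : (star (⇑(hT.eigenvectorBasis i) : Fin m → ℝ)) ⬝ᵥ (⇑(hT.eigenvectorBasis i)) = 1 := by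
      have := hT.eigenvectorBasis.orthonormal.1 i
      have h4 := EuclideanSpace.real_norm_sq_eq (hT.eigenvectorBasis i)
      rw [this] at h4
      simp only [dotProduct, star_trivial]
      rw [← one_pow 2, h4]
      exact Finset.sum_congr rfl (fun j _ => by ring)
    rw [Matrix.sub_mulVec, dotProduct_sub, Matrix.one_mulVec, h3] at h2
    simp only [RCLike.re_to_real] at h1
    rw [h1]
    linarith
  simp only [RCLike.ofReal_real_eq_id, id]
  exact Finset.one_le_prod (fun i _ => this i)

open scoped MatrixOrder ComplexOrder Matrix.Norms.L2Operator in
lemma exists_factor_aux {m : ℕ} (M : Matrix (Fin m) (Fin m) ℝ) (hM : M.PosSemidef) :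
    ∃ R : Matrix (Fin m) (Fin m) ℝ, M = R.conjTranspose * R :=
  CStarAlgebra.nonneg_iff_eq_star_mul_self.mp hM.nonneg

lemma det_mono_aux {m : ℕ} (M N : Matrix (Fin m) (Fin m) ℝ) (hM : M.PosDef)
    (h : (N - M).PosSemidef) : M.det ≤ N.det := by
  obtain ⟨R, hR⟩ := exists_factor_aux M hM.posSemidef
  have hd : M.det = R.det * R.det := by
    rw [hR, Matrix.det_mul, Matrix.det_conjTranspose]; simp
  have hR0 : IsUnit R.det := by
    have := hM.det_pos
    rw [hd] at this
    exact isUnit_iff_ne_zero.mpr (fun h0 => by simp [h0] at this)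
  have hNh : N.IsHermitian := by
    have := h.1.add hM.1
    simpa using this
  set T : Matrix (Fin m) (Fin m) ℝ := (R⁻¹).conjTranspose * N * R⁻¹ with hT
  have hTh : T.IsHermitian := Matrix.isHermitian_conjTranspose_mul_mul _ hNh
  have hT1 : (T - 1).PosSemidef := by
    have := h.conjTranspose_mul_mul_same R⁻¹
    have e : (R⁻¹).conjTranspose * (N - M) * R⁻¹ = T - 1 := by
      rw [mul_sub, sub_mul, hT]
      congr 1
      have h2 : (R⁻¹).conjTranspose * R.conjTranspose = 1 := by
        rw [← Matrix.conjTranspose_mul, Matrix.mul_nonsing_inv _ hR0, Matrix.conjTranspose_one]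
      rw [hR, ← mul_assoc, h2, one_mul, Matrix.mul_nonsing_inv _ hR0]
    rwa [e] at this
  have h1 := det_one_le_aux T hTh hT1
  have hTd : T.det = (R.det)⁻¹ * N.det * (R.det)⁻¹ := by
    rw [hT, Matrix.det_mul, Matrix.det_mul, Matrix.det_conjTranspose, Matrix.det_nonsing_inv]
    simp
  have hne := hR0.ne_zero
  have : N.det = T.det * M.det := by
    rw [hTd, hd]; field_simp
  rw [this]
  nlinarith [hM.det_pos]

lemma toMatrix_quad {m : ℕ} (A : Euc m →ₗ[ℝ] Euc m) (v w : Euc m) :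
    ⟪A v, w⟫ = w.ofLp ⬝ᵥ (LinearMap.toMatrix (EuclideanSpace.basisFun (Fin m) ℝ).toBasis
      (EuclideanSpace.basisFun (Fin m) ℝ).toBasis A).mulVec v.ofLp := by
  have h := LinearMap.toMatrix_mulVec_repr (EuclideanSpace.basisFun (Fin m) ℝ).toBasis
      (EuclideanSpace.basisFun (Fin m) ℝ).toBasis A v
  have e : ∀ u : Euc m, (⇑((EuclideanSpace.basisFun (Fin m) ℝ).toBasis.repr u) : Fin m → ℝ) = u.ofLp := by
    intro u; ext i; simp
  rw [e, e] at h
  rw [h, EuclideanSpace.inner_eq_star_dotProduct]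
  simp

lemma detlem {m : ℕ} (A B h : Euc m →ₗ[ℝ] Euc m) (hA : ∀ v w, ⟪A v, w⟫ = ⟪v, A w⟫)
    (hB : ∀ v w, ⟪B v, w⟫ = ⟪v, B w⟫) (hBp : ∀ v, v ≠ 0 → 0 < ⟪B v, v⟫)
    (hh : LinearMap.det h ≠ 0) (hle : ∀ v, ⟪B (h v), h v⟫ ≤ ⟪A v, v⟫) :
    LinearMap.det B * (LinearMap.det h) ^ 2 ≤ LinearMap.det A := by
  set b := (EuclideanSpace.basisFun (Fin m) ℝ).toBasis with hb
  set MA := LinearMap.toMatrix b b A with hMA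
  set MB := LinearMap.toMatrix b b B with hMB
  set H := LinearMap.toMatrix b b h with hH
  have herm : ∀ (X : Euc m →ₗ[ℝ] Euc m), (∀ v w, ⟪X v, w⟫ = ⟪v, X w⟫) →
      (LinearMap.toMatrix b b X).IsHermitian := by
    intro X hX
    ext i j
    rw [Matrix.conjTranspose_apply, LinearMap.toMatrix_apply, LinearMap.toMatrix_apply]
    have := hX (EuclideanSpace.single i 1) (EuclideanSpace.single j 1)
    simp [EuclideanSpace.inner_single_left, EuclideanSpace.inner_single_right] at this
    simpa [hb] using this
  have hq : ∀ v : Fin m → ℝ, star v ⬝ᵥ (H.conjTranspose * MB * H).mulVec v =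
      ⟪B (h (WithLp.toLp 2 v)), h (WithLp.toLp 2 v)⟫ := by
    intro v
    rw [toMatrix_quad]
    have h2 := LinearMap.toMatrix_mulVec_repr b b h (WithLp.toLp 2 v)
    have e : ∀ u : Euc m, (⇑(b.repr u) : Fin m → ℝ) = u.ofLp := by
      intro u; ext i; simp [hb]
    rw [e, e] at h2
    rw [← h2, ← Matrix.mulVec_mulVec, ← Matrix.mulVec_mulVec, Matrix.dotProduct_mulVec,
      Matrix.vecMul_conjTranspose]
    simp [hH, hMB, hb]
  have hinj : Function.Injective h := by
    have : IsUnit (LinearMap.det h) := isUnit_iff_ne_zero.mpr hh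
    exact (Module.End.isUnit_iff h |>.mp ((LinearMap.isUnit_iff_isUnit_det h).mpr this)).1
  have h1 : (H.conjTranspose * MB * H).PosDef := by
    refine Matrix.PosDef.of_dotProduct_mulVec_pos
      (Matrix.isHermitian_conjTranspose_mul_mul _ (herm B hB)) ?_
    intro v hv
    rw [hq]
    apply hBp
    intro h0
    apply hv
    have := hinj (h0.trans (map_zero h).symm)
    simpa using congrArg WithLp.ofLp this
  have h2 : (MA - H.conjTranspose * MB * H).PosSemidef := by
    refine Matrix.PosSemidef.of_dotProduct_mulVec_nonneg
      ((herm A hA).sub (Matrix.isHermitian_conjTranspose_mul_mul _ (herm B hB))) ?_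
    intro v
    rw [Matrix.sub_mulVec, dotProduct_sub, hq]
    have := hle (WithLp.toLp 2 v)
    rw [toMatrix_quad A] at this
    simp only [star_trivial]
    linarith
  have h3 := det_mono_aux _ _ h1 h2
  rw [Matrix.det_mul, Matrix.det_mul, Matrix.det_conjTranspose, hMA, hMB, hH,
    LinearMap.det_toMatrix, LinearMap.det_toMatrix, LinearMap.det_toMatrix] at h3
  simp only [star_trivial] at h3
  linarith [h3]

/-- the rank one perturbation of the identity -/
def rk1 {m : ℕ} (a e : Euc m) : Euc m →L[ℝ] Euc m :=
  ContinuousLinearMap.id ℝ _ + (innerSL ℝ e).smulRight a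

lemma rk1_apply {m : ℕ} (a e x : Euc m) : rk1 a e x = x + ⟪e, x⟫ • a := by
  simp [rk1]

lemma rk1_det {m : ℕ} (a e : Euc m) : LinearMap.det (rk1 a e : Euc m →ₗ[ℝ] Euc m) = 1 + ⟪e, a⟫ := by
  rw [← LinearMap.det_toMatrix (EuclideanSpace.basisFun (Fin m) ℝ).toBasis]
  have : LinearMap.toMatrix (EuclideanSpace.basisFun (Fin m) ℝ).toBasis
      (EuclideanSpace.basisFun (Fin m) ℝ).toBasis (rk1 a e : Euc m →ₗ[ℝ] Euc m) =
      1 + Matrix.replicateCol Unit a.ofLp * Matrix.replicateRow Unit e.ofLp := by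
    ext i j
    rw [LinearMap.toMatrix_apply]
    simp [rk1_apply, Matrix.one_apply, Matrix.mul_apply, EuclideanSpace.inner_single_right, mul_comm]
  rw [this, Matrix.det_one_add_replicateCol_mul_replicateRow, EuclideanSpace.inner_eq_star_dotProduct]
  simp [dotProduct_comm]

end LinAlg

section Cones

/-- A pair of mutually dual open convex cones. -/
structure DualPair {m : ℕ} (C D : Set (Euc m)) : Prop where
  neC : C.Nonempty
  neD : D.Nonempty
  openC : IsOpen C
  openD : IsOpen D
  convC : Convex ℝ C
  convD : Convex ℝ D
  memD : ∀ y, y ∈ D ↔ ∀ x ∈ closure C, x ≠ 0 → 0 < ⟪x, y⟫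
  memC : ∀ x, x ∈ C ↔ ∀ y ∈ closure D, y ≠ 0 → 0 < ⟪y, x⟫

variable {m : ℕ} {C D : Set (Euc m)}

lemma DualPair.symm (h : DualPair C D) : DualPair D C :=
  ⟨h.neD, h.neC, h.openD, h.openC, h.convD, h.convC, h.memC, h.memD⟩

lemma DualPair.smul_mem (h : DualPair C D) {x : Euc m} (hx : x ∈ C) {c : ℝ} (hc : 0 < c) :
    c • x ∈ C := by
  rw [h.memC] at hx ⊢
  intro y hy hy0
  rw [inner_smul_right]
  exact mul_pos hc (hx y hy hy0)

lemma DualPair.closure_nonneg (h : DualPair C D) {x y : Euc m} (hx : x ∈ closure C)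
    (hy : y ∈ closure D) : 0 ≤ ⟪x, y⟫ := by
  have h1 : ∀ y ∈ D, 0 ≤ ⟪x, y⟫ := by
    intro y hy
    by_cases hx0 : x = 0
    · simp [hx0]
    · exact ((h.memD y).1 hy x hx hx0).le
  have h2 : closure D ⊆ {y | 0 ≤ ⟪x, y⟫} :=
    closure_minimal h1 (isClosed_le continuous_const (by fun_prop))
  exact h2 hy

lemma DualPair.add_closure_mem (h : DualPair C D) {x v : Euc m} (hx : x ∈ C)
    (hv : v ∈ closure C) : x + v ∈ C := by
  rw [h.memC] at hx ⊢
  intro y hy hy0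
  rw [inner_add_right]
  have := h.closure_nonneg hv hy
  rw [real_inner_comm] at this
  linarith [hx y hy hy0]

lemma DualPair.smul_closure_mem (h : DualPair C D) {x : Euc m} (hx : x ∈ closure C) {c : ℝ}
    (hc : 0 < c) : c • x ∈ closure C := by
  have h1 : Set.MapsTo (fun x : Euc m => c • x) C C := fun x hx => h.smul_mem hx hc
  exact h1.closure (by fun_prop) hx

lemma DualPair.inner_pos (h : DualPair C D) {x y : Euc m} (hx : x ∈ closure C) (hx0 : x ≠ 0)
    (hy : y ∈ D) : 0 < ⟪x, y⟫ := (h.memD y).1 hy x hx hx0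

lemma DualPair.inner_pos' (h : DualPair C D) {x y : Euc m} (hx : x ∈ C)
    (hy : y ∈ closure D) (hy0 : y ≠ 0) : 0 < ⟪x, y⟫ := by
  rw [real_inner_comm]; exact (h.memC x).1 hx y hy hy0

lemma sphere_open_aux {K : Set (Euc m)} (hK : IsCompact K) :
    IsOpen {y : Euc m | ∀ x ∈ K, 0 < ⟪x, y⟫} := by
  rw [isOpen_iff_mem_nhds]
  intro y hy
  have := hK.eventually_forall_of_forall_eventually (x₀ := y)
    (P := fun y x => 0 < ⟪x, y⟫) (fun x hx => by
      have hc : Continuous (fun z : Euc m × Euc m => ⟪z.2, z.1⟫) := by fun_prop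
      exact hc.continuousAt.eventually (lt_mem_nhds (hy x hx)))
  exact this

lemma exp_cone_smul {Ω : Set (Euc m)} (h4 : ∀ x ∈ Ω, ∀ t : ℝ, Real.exp t • x ∈ Ω) {x : Euc m}
    (hx : x ∈ Ω) {c : ℝ} (hc : 0 < c) : c • x ∈ Ω := by
  have := h4 x hx (Real.log c)
  rwa [Real.exp_log hc] at this

lemma dualPair_of_cone {n : ℕ} {Ω : Set (Euc (n+1))} (hΩ : IsOpenProperConvexCone Ω) :
    DualPair Ω (openDualCone Ω) := by
  obtain ⟨hne, hop, hcv, hcone, hline⟩ := hΩ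
  have hsm : ∀ {x : Euc (n+1)}, x ∈ Ω → ∀ {c : ℝ}, 0 < c → c • x ∈ Ω :=
    fun hx _ hc => exp_cone_smul hcone hx hc
  have hsmc : ∀ {x : Euc (n+1)}, x ∈ closure Ω → ∀ {c : ℝ}, 0 < c → c • x ∈ closure Ω := by
    intro x hx c hc
    have h1 : Set.MapsTo (fun x : Euc (n+1) => c • x) Ω Ω := fun x hx => hsm hx hc
    exact h1.closure (by fun_prop) hx
  have haddc : ∀ {x y : Euc (n+1)}, x ∈ closure Ω → y ∈ closure Ω → x + y ∈ closure Ω := by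
    intro x y hx hy
    have := hcv.closure hx hy (a := 1/2) (b := 1/2) (by norm_num) (by norm_num) (by norm_num)
    have := hsmc this (c := 2) (by norm_num)
    simpa [smul_add, smul_smul] using this
  have h0c : (0 : Euc (n+1)) ∈ closure Ω := by
    obtain ⟨x, hx⟩ := hne
    have h1 : Filter.Tendsto (fun c : ℝ => c • x) (nhdsWithin 0 (Set.Ioi 0)) (nhds ((0:ℝ) • x)) :=
      ((continuous_id.smul continuous_const).tendsto 0).mono_left nhdsWithin_le_nhds
    rw [zero_smul] at h1
    refine mem_closure_of_tendsto h1 ?_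
    filter_upwards [self_mem_nhdsWithin] with c hc
    exact hsm hx hc
  -- the closed dual cone
  have hsep : ∀ x : Euc (n+1), x ∉ Ω → ∃ y : Euc (n+1), y ≠ 0 ∧ ⟪y, x⟫ ≤ 0 ∧
      ∀ a ∈ closure Ω, 0 ≤ ⟪a, y⟫ := by
    intro x hx
    obtain ⟨f, hf⟩ := geometric_hahn_banach_open_point hcv hop hx
    have hf0 : ∀ a ∈ Ω, f a ≤ 0 := by
      intro a ha
      by_contra hcon
      push Not at hcon
      obtain ⟨k, hk⟩ := exists_nat_gt (|f x| / f a)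
      have hk' : |f x| < k * f a := by rwa [div_lt_iff₀ hcon] at hk
      have h1 := hf ((k+1 : ℝ) • a) (hsm ha (by positivity))
      rw [map_smul, smul_eq_mul] at h1
      have := le_abs_self (f x)
      nlinarith
    have hfx : 0 ≤ f x := by
      have h1 : closure Ω ⊆ {a | f a ≤ f x} :=
        closure_minimal (fun a ha => (hf a ha).le) (isClosed_le f.continuous continuous_const)
      simpa using h1 h0c
    have hr : ∀ a, ⟪(InnerProductSpace.toDual ℝ (Euc (n+1))).symm f, a⟫ = f a := by
      intro a; simp
    refine ⟨-(InnerProductSpace.toDual ℝ (Euc (n+1))).symm f, ?_, ?_, ?_⟩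
    · intro h0
      have h1 := neg_eq_zero.1 h0
      obtain ⟨a, ha⟩ := hne
      have := hf a ha
      rw [← hr, ← hr, h1] at this
      simp at this
    · rw [inner_neg_left, hr]; linarith
    · have h1 : closure Ω ⊆ {a | f a ≤ 0} :=
        closure_minimal hf0 (isClosed_le f.continuous continuous_const)
      intro a ha
      rw [inner_neg_right, real_inner_comm, hr]
      have : f a ≤ 0 := h1 ha
      linarith
  set K := closure Ω ∩ Metric.sphere (0 : Euc (n+1)) 1 with hK
  have hKc : IsCompact K := (isCompact_sphere _ _).inter_left isClosed_closure
  have hDK : openDualCone Ω = {y : Euc (n+1) | ∀ x ∈ K, 0 < ⟪x, y⟫} := by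
    ext y
    constructor
    · intro hy x hx
      exact hy x hx.1 (by rintro rfl; simpa using hx.2)
    · intro hy x hx hx0
      have hn : 0 < ‖x‖ := norm_pos_iff.2 hx0
      have := hy (‖x‖⁻¹ • x) ⟨hsmc hx (by positivity), by simp [norm_smul, hn.ne']⟩
      rw [inner_smul_left] at this
      simp only [conj_trivial] at this
      exact pos_of_mul_pos_right this (by positivity)
  have hDne : (openDualCone Ω).Nonempty := by
    -- for each x in K find y in closed dual with positive pairing
    have hpt : ∀ x ∈ K, ∃ y : Euc (n+1), (∀ a ∈ closure Ω, 0 ≤ ⟪a, y⟫) ∧ 0 < ⟪x, y⟫ := by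
      intro x hx
      have hx0 : x ≠ 0 := by rintro rfl; simpa using hx.2
      by_contra hcon
      push Not at hcon
      -- then - x in closure
      have hneg : -x ∈ closure Ω := by
        by_contra hnc
        obtain ⟨f, u, hf1, hf2⟩ := geometric_hahn_banach_closed_point hcv.closure isClosed_closure hnc
        have hr : ∀ a, ⟪(InnerProductSpace.toDual ℝ (Euc (n+1))).symm f, a⟫ = f a := by
          intro a; simp
        have hu : 0 < u := by simpa using hf1 0 h0c
        have hf0 : ∀ a ∈ closure Ω, f a ≤ 0 := by
          intro a ha
          by_contra hc
          push Not at hc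
          have h1 := hf1 ((u / f a) • a) (hsmc ha (by positivity))
          rw [map_smul, smul_eq_mul, div_mul_cancel₀ _ hc.ne'] at h1
          exact lt_irrefl _ h1
        have h3 := hcon (-(InnerProductSpace.toDual ℝ (Euc (n+1))).symm f) (by
          intro a ha
          rw [inner_neg_right, real_inner_comm, hr]
          linarith [hf0 a ha])
        rw [inner_neg_right, real_inner_comm, hr] at h3
        rw [map_neg] at hf2
        linarith
      apply hline
      refine ⟨0, x, hx0, fun t => ?_⟩
      rw [zero_add]
      rcases lt_trichotomy t 0 with ht | ht | ht
      · have := hsmc hneg (c := -t) (by linarith)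
        simpa using this
      · rw [ht, zero_smul]; exact h0c
      · exact hsmc hx.1 ht
    choose! Y hY1 hY2 using hpt
    obtain ⟨s, hs⟩ := hKc.elim_nhds_subcover' (fun x _ => {z | 0 < ⟪z, Y x⟫}) (fun x hx => by
      have hc : Continuous (fun z : Euc (n+1) => ⟪z, Y x⟫) := by fun_prop
      exact hc.continuousAt.eventually (lt_mem_nhds (hY2 x hx)))
    refine ⟨∑ x ∈ s, Y x, ?_⟩
    rw [hDK]
    intro z hz
    rw [inner_sum]
    obtain ⟨x, hx, hzx⟩ := Set.mem_iUnion₂.1 (hs hz)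
    exact Finset.sum_pos' (fun x hx => hY1 x x.2 z hz.1) ⟨x, hx, hzx⟩
  have hDop : IsOpen (openDualCone Ω) := by rw [hDK]; exact sphere_open_aux hKc
  refine ⟨hne, hDne, hop, hDop, hcv, ?_, fun y => Iff.rfl, ?_⟩
  · intro y hy z hz a b ha hb hab x hx hx0
    rw [inner_add_right, inner_smul_right, inner_smul_right]
    have h1 := hy x hx hx0
    have h2 := hz x hx hx0
    rcases eq_or_lt_of_le ha with h | h
    · have : b = 1 := by linarith
      rw [← h, this]; simpa using h2
    · nlinarith [mul_pos h h1, mul_nonneg hb h2.le]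
  · intro x
    constructor
    · intro hx y hy hy0
      have hnn : ∀ a ∈ Ω, 0 ≤ ⟪a, y⟫ := by
        intro a ha
        have h2 : closure (openDualCone Ω) ⊆ {y | 0 ≤ ⟪a, y⟫} := by
          refine closure_minimal (fun z hz => ?_) (isClosed_le continuous_const (by fun_prop))
          by_cases ha0 : a = 0
          · simp [ha0]
          · exact (hz a (subset_closure ha) ha0).le
        exact h2 hy
      have hc : Continuous (fun t : ℝ => x - t • y) := by fun_prop
      have h1 : ∀ᶠ t in nhds (0:ℝ), x - t • y ∈ Ω :=
        hc.continuousAt.eventually (by simpa using hop.mem_nhds hx)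
      have h2 : ∀ᶠ t in nhdsWithin (0:ℝ) (Set.Ioi 0), x - t • y ∈ Ω ∧ 0 < t :=
        (h1.filter_mono nhdsWithin_le_nhds).and self_mem_nhdsWithin
      obtain ⟨t, ht, ht0⟩ := h2.exists
      have h3 := hnn _ ht
      rw [inner_sub_left, inner_smul_left] at h3
      simp only [conj_trivial] at h3
      rw [real_inner_comm]
      have : 0 < ⟪y, y⟫ := real_inner_self_pos.2 hy0
      nlinarith [mul_pos ht0 this]
    · intro hx
      by_contra hxn
      obtain ⟨y, hy0, hyx, hya⟩ := hsep x hxn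
      have hyc : y ∈ closure (openDualCone Ω) := by
        obtain ⟨e, he⟩ := hDne
        have hc : Continuous (fun t : ℝ => y + t • e) := by fun_prop
        have h1 : Filter.Tendsto (fun t : ℝ => y + t • e) (nhdsWithin 0 (Set.Ioi 0)) (nhds y) := by
          have := (hc.tendsto 0).mono_left (nhdsWithin_le_nhds (s := Set.Ioi 0))
          simpa using this
        refine mem_closure_of_tendsto h1 ?_
        filter_upwards [self_mem_nhdsWithin] with t ht
        intro a ha ha0
        rw [inner_add_right, inner_smul_right]
        have := mul_pos ht (he a ha ha0)
        linarith [hya a ha]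
      linarith [hx y hyc hy0]

end Cones

section Pots

open Filter Topology

/-- A canonical potential with its gradient and Hessian as explicit data. -/
structure Pot (n : ℕ) (C : Set (Euc (n+1))) (F : Euc (n+1) → ℝ) (g : Euc (n+1) → Euc (n+1))
    (H : Euc (n+1) → Euc (n+1) →L[ℝ] Euc (n+1)) : Prop where
  grad : ∀ x ∈ C, HasFDerivAt F (innerSL ℝ (g x)) x
  hess : ∀ x ∈ C, HasFDerivAt g (H x) x
  dH : ∀ x ∈ C, DifferentiableAt ℝ H x
  symm : ∀ x ∈ C, ∀ v w, ⟪H x v, w⟫ = ⟪v, H x w⟫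
  pos : ∀ x ∈ C, ∀ v, v ≠ 0 → 0 < ⟪H x v, v⟫
  det : ∀ x ∈ C, LinearMap.det (H x : Euc (n+1) →ₗ[ℝ] Euc (n+1)) = Real.exp (2 * F x)
  hom : ∀ x ∈ C, ∀ c : ℝ, 0 < c → F (c • x) = F x - (n+1) * Real.log c
  blow : ∀ z ∈ closure C, z ∉ C → ∀ M : ℝ, ∀ᶠ x in 𝓝[C] z, M < F x

lemma pot_of_canonical {n : ℕ} {C : Set (Euc (n+1))} (hC : IsOpen C) {F : Euc (n+1) → ℝ}
    (hF : IsCanonicalPotential n C F) : Pot n C F (gradient F) (fderiv ℝ (gradient F)) := by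
  obtain ⟨hsm, hpd, hdet, hhom, hbl⟩ := hF
  have hat : ∀ x ∈ C, ContDiffAt ℝ (⊤ : ℕ∞) F x := fun x hx => hsm.contDiffAt (hC.mem_nhds hx)
  have hfd : ∀ x ∈ C, ContDiffAt ℝ 2 (fderiv ℝ F) x := fun x hx =>
    (hat x hx).fderiv_right (by norm_cast)
  have hgr : ∀ x ∈ C, ContDiffAt ℝ 2 (gradient F) x := fun x hx =>
    (InnerProductSpace.toDual ℝ (Euc (n+1))).symm.contDiff.contDiffAt.comp x (hfd x hx)
  have hgd : ∀ x ∈ C, HasFDerivAt (gradient F) (fderiv ℝ (gradient F) x) x := fun x hx =>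
    ((hgr x hx).differentiableAt (by norm_num)).hasFDerivAt
  have hin : ∀ y : Euc (n+1), ∀ w, ⟪gradient F y, w⟫ = fderiv ℝ F y w := by
    intro y w; simp [gradient]
  have hHin : ∀ x ∈ C, ∀ v w, ⟪fderiv ℝ (gradient F) x v, w⟫ = fderiv ℝ (fderiv ℝ F) x v w := by
    intro x hx v w
    have h1 : HasFDerivAt (fun y => ⟪gradient F y, w⟫)
        ((innerSL ℝ w).comp (fderiv ℝ (gradient F) x)) x := by
      have := (innerSL ℝ w).hasFDerivAt.comp x (hgd x hx)
      refine this.congr_of_eventuallyEq (Eventually.of_forall fun y => ?_)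
      simp [real_inner_comm]
    have h2 : HasFDerivAt (fun y => fderiv ℝ F y w)
        ((ContinuousLinearMap.apply ℝ ℝ w).comp (fderiv ℝ (fderiv ℝ F) x)) x :=
      (ContinuousLinearMap.apply ℝ ℝ w).hasFDerivAt.comp x
        ((hfd x hx).differentiableAt (by norm_num)).hasFDerivAt
    have h3 : (fun y => ⟪gradient F y, w⟫) = (fun y => fderiv ℝ F y w) := funext fun y => hin y w
    rw [h3] at h1
    have := congrArg (fun L => L v) (h1.unique h2)
    simpa [real_inner_comm] using this
  have hsym : ∀ x ∈ C, ∀ v w, ⟪fderiv ℝ (gradient F) x v, w⟫ = ⟪v, fderiv ℝ (gradient F) x w⟫ := by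
    intro x hx v w
    rw [real_inner_comm _ v, hHin x hx, hHin x hx]
    exact ((hat x hx).isSymmSndFDerivAt (by simp only [minSmoothness_of_isRCLikeNormedField]; exact WithTop.coe_le_coe.2 (le_top (a := (2 : ℕ∞))))) v w
  have hmat : ∀ x ∈ C, LinearMap.toMatrix (EuclideanSpace.basisFun (Fin (n+1)) ℝ).toBasis
      (EuclideanSpace.basisFun (Fin (n+1)) ℝ).toBasis
      (fderiv ℝ (gradient F) x : Euc (n+1) →ₗ[ℝ] Euc (n+1)) = hessMatrix F x := by
    intro x hx
    ext i j
    rw [LinearMap.toMatrix_apply, hessMatrix, iteratedFDeriv_two_apply]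
    have h1 := hHin x hx (EuclideanSpace.single i 1) (EuclideanSpace.single j 1)
    rw [hsym x hx, EuclideanSpace.inner_single_left] at h1
    simpa using h1
  refine ⟨?_, hgd, ?_, hsym, ?_, ?_, ?_, ?_⟩
  · intro x hx
    have h1 := ((hat x hx).differentiableAt (by simp)).hasFDerivAt
    have e : innerSL ℝ (gradient F x) = fderiv ℝ F x := by
      ext w
      exact hin x w
    rw [e]
    exact h1
  · intro x hx
    exact ((hgr x hx).fderiv_right (m := 1) (by norm_num)).differentiableAt (by norm_num)
  · intro x hx v hv
    have h1 := toMatrix_quad (fderiv ℝ (gradient F) x : Euc (n+1) →ₗ[ℝ] Euc (n+1)) v v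
    rw [hmat x hx] at h1
    have h2 := (hpd x hx).dotProduct_mulVec_pos (x := v.ofLp) (by simpa using hv)
    simp only [star_trivial] at h2
    rw [← h1] at h2
    exact h2
  · intro x hx
    rw [← LinearMap.det_toMatrix (EuclideanSpace.basisFun (Fin (n+1)) ℝ).toBasis, hmat x hx,
      hdet x hx]
  · intro x hx c hc
    have := hhom x hx (Real.log c)
    rwa [Real.exp_log hc] at this
  · intro z hz hzC M
    by_contra hcon
    rw [not_eventually] at hcon
    have hcon2 : ∃ᶠ x in 𝓝[C] z, x ∈ C ∧ ¬ M < F x :=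
      (hcon.and_eventually self_mem_nhdsWithin).mono fun x hx => ⟨hx.2, hx.1⟩
    obtain ⟨u, hu1, hu2⟩ := exists_seq_forall_of_frequently hcon2
    have h1 := hbl z (by rw [hC.frontier_eq]; exact ⟨hz, hzC⟩) u (fun k => (hu2 k).1)
      (hu1.mono_right nhdsWithin_le_nhds)
    obtain ⟨k, hk⟩ := (h1.eventually_gt_atTop M).exists
    exact (hu2 k).2 hk

variable {n : ℕ} {C D : Set (Euc (n+1))} {F : Euc (n+1) → ℝ} {g : Euc (n+1) → Euc (n+1)}
  {H : Euc (n+1) → Euc (n+1) →L[ℝ] Euc (n+1)}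

/-- derivative of `F` along a line composed with a linear map -/
lemma Pot.deriv_line (P : Pot n C F g H) (p v : Euc (n+1)) (t : ℝ) (hx : p + t • v ∈ C) :
    HasDerivAt (fun s : ℝ => F (p + s • v)) ⟪g (p + t • v), v⟫ t := by
  have h1 : HasDerivAt (fun s : ℝ => p + s • v) v t := by
    simpa using ((hasDerivAt_id t).smul_const v).const_add p
  exact (P.grad _ hx).comp_hasDerivAt t h1

lemma Pot.deriv_grad_line (P : Pot n C F g H) (p v : Euc (n+1)) (t : ℝ) (hx : p + t • v ∈ C) :
    HasDerivAt (fun s : ℝ => g (p + s • v)) (H (p + t • v) v) t := by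
  have h1 : HasDerivAt (fun s : ℝ => p + s • v) v t := by
    simpa using ((hasDerivAt_id t).smul_const v).const_add p
  exact (P.hess _ hx).comp_hasDerivAt t h1

lemma Pot.deriv2_line (P : Pot n C F g H) (p v w : Euc (n+1)) (t : ℝ) (hx : p + t • v ∈ C) :
    HasDerivAt (fun s : ℝ => ⟪g (p + s • v), w⟫) ⟪H (p + t • v) v, w⟫ t := by
  have := (P.deriv_grad_line p v t hx).inner ℝ (hasDerivAt_const t w)
  simpa using this

lemma Pot.cont (P : Pot n C F g H) {x : Euc (n+1)} (hx : x ∈ C) : ContinuousAt F x :=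
  (P.grad x hx).continuousAt

lemma seg_mem (hC : Convex ℝ C) {x v : Euc (n+1)} (hx : x ∈ C) (hv : x + v ∈ C) {t : ℝ}
    (ht : t ∈ Set.Icc (0:ℝ) 1) : x + t • v ∈ C :=
  hC.add_smul_mem hx hv ht

lemma Pot.grad_mono (P : Pot n C F g H) (hC : Convex ℝ C) {x v : Euc (n+1)} (hx : x ∈ C)
    (hxv : x + v ∈ C) (hv : v ≠ 0) :
    StrictMonoOn (fun t : ℝ => ⟪g (x + t • v), v⟫) (Set.Icc 0 1) := by
  apply strictMonoOn_of_deriv_pos (convex_Icc 0 1)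
  · intro t ht
    exact (P.deriv2_line x v v t (seg_mem hC hx hxv ht)).continuousAt.continuousWithinAt
  · intro t ht
    rw [interior_Icc] at ht
    have hm := seg_mem hC hx hxv (Set.Ioo_subset_Icc_self ht)
    rw [(P.deriv2_line x v v t hm).deriv]
    exact P.pos _ hm v hv

lemma Pot.conv_ineq (P : Pot n C F g H) (hC : Convex ℝ C) {x x' : Euc (n+1)} (hx : x ∈ C)
    (hx' : x' ∈ C) : F x + ⟪g x, x' - x⟫ ≤ F x' := by
  by_cases hv : x' - x = 0
  · have : x' = x := sub_eq_zero.1 hv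
    simp [this]
  set v := x' - x with hvd
  have hxv : x + v ∈ C := by simpa [hvd] using hx'
  obtain ⟨c, hc, hc2⟩ := exists_hasDerivAt_eq_slope (fun s : ℝ => F (x + s • v))
    (fun t => ⟪g (x + t • v), v⟫) (a := 0) (b := 1) zero_lt_one
    (fun t ht => (P.deriv_line x v t (seg_mem hC hx hxv ht)).continuousAt.continuousWithinAt)
    (fun t ht => P.deriv_line x v t (seg_mem hC hx hxv (Set.Ioo_subset_Icc_self ht)))
  have h1 := P.grad_mono hC hx hxv hv (Set.left_mem_Icc.2 zero_le_one) (Set.Ioo_subset_Icc_self hc) hc.1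
  simp only [zero_smul, add_zero, one_smul, sub_zero, div_one] at h1 hc2
  have h2 : x + v = x' := by simp [hvd]
  rw [h2] at hc2
  linarith

lemma Pot.euler (P : Pot n C F g H) {x : Euc (n+1)} (hx : x ∈ C) :
    ⟪g x, x⟫ = -(n+1) := by
  have h1 := P.deriv_line x x 0 (by simpa using hx)
  have h2 : HasDerivAt (fun s : ℝ => F x - (n+1) * Real.log (1 + s)) (-(n+1)) 0 := by
    have h3 : HasDerivAt (fun s : ℝ => Real.log (1 + s)) (1 / (1 + 0)) 0 :=
      ((hasDerivAt_id (0:ℝ)).const_add 1).log (by norm_num)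
    have := (h3.const_mul ((n:ℝ)+1)).const_sub (F x)
    simpa using this
  have h3 : (fun s : ℝ => F (x + s • x)) =ᶠ[𝓝 0] (fun s : ℝ => F x - (n+1) * Real.log (1 + s)) := by
    filter_upwards [lt_mem_nhds (show (-1:ℝ) < 0 by norm_num)] with s hs
    rw [← P.hom x hx (1+s) (by linarith), add_smul, one_smul]
  have := (h1.congr_of_eventuallyEq h3.symm).unique h2
  simpa using this

lemma Pot.euler2 (P : Pot n C F g H) (hC : IsOpen C) {x : Euc (n+1)} (hx : x ∈ C) :
    H x x = - g x := by
  apply ext_inner_right ℝ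
  intro w
  have hm : ∀ᶠ t in 𝓝 (0:ℝ), x + t • w ∈ C := by
    have hc : Continuous (fun t : ℝ => x + t • w) := by fun_prop
    exact hc.continuousAt.eventually (by simpa using hC.mem_nhds hx)
  have h1 : HasDerivAt (fun s : ℝ => x + s • w) w 0 := by
    simpa using ((hasDerivAt_id (0:ℝ)).smul_const w).const_add x
  have h2 := (P.deriv_grad_line x w 0 (by simpa using hx)).inner ℝ h1
  have h3 : (fun s : ℝ => ⟪g (x + s • w), x + s • w⟫) =ᶠ[𝓝 0] (fun s : ℝ => -((n:ℝ)+1)) := by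
    filter_upwards [hm] with t ht
    exact P.euler ht
  have h4 := (h2.congr_of_eventuallyEq h3.symm).unique (hasDerivAt_const _ _)
  simp only [zero_smul, add_zero] at h4
  rw [P.symm x hx, real_inner_comm _ x, inner_neg_left]
  linarith

lemma Pot.grad_hom (P : Pot n C F g H) {x : Euc (n+1)} (hx : x ∈ C) {c : ℝ} (hc : 0 < c)
    (hC : IsOpen C) (hcx : c • x ∈ C) : g (c • x) = c⁻¹ • g x := by
  have h1 : HasFDerivAt (fun y : Euc (n+1) => F (c • y)) ((innerSL ℝ (g (c • x))).comp
      (c • ContinuousLinearMap.id ℝ (Euc (n+1)))) x :=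
    (P.grad _ hcx).comp x ((hasFDerivAt_id x).const_smul c)
  have h2 := (P.grad x hx).sub_const ((n+1) * Real.log c)
  have h3 : (fun y : Euc (n+1) => F (c • y)) =ᶠ[𝓝 x] (fun y => F y - (n+1) * Real.log c) := by
    filter_upwards [hC.mem_nhds hx] with y hy
    exact P.hom y hy c hc
  have h4 := (h1.congr_of_eventuallyEq h3.symm).unique h2
  apply ext_inner_right ℝ
  intro w
  have := congrArg (fun L => L w) h4
  simp only [ContinuousLinearMap.comp_apply, smul_apply,
    ContinuousLinearMap.id_apply, innerSL_apply_apply, inner_smul_right] at this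
  rw [inner_smul_left]
  simp only [conj_trivial]
  rw [← this]
  field_simp

lemma second_order_min {f f' : ℝ → ℝ} {c : ℝ} (h1 : ∀ᶠ t in 𝓝 (0:ℝ), HasDerivAt f (f' t) t)
    (h2 : HasDerivAt f' c 0) (hmin : IsLocalMin f 0) : 0 ≤ c := by
  by_contra hc
  push Not at hc
  have e1 : deriv f =ᶠ[𝓝 0] f' := h1.mono fun t ht => ht.deriv
  have e2 : deriv (deriv f) 0 = c := by rw [e1.deriv_eq, h2.deriv]
  have h3 := isLocalMax_of_deriv_deriv_neg (f := f) (x₀ := 0) (by rw [e2]; exact hc)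
    hmin.deriv_eq_zero h1.self_of_nhds.continuousAt
  have h4 : f =ᶠ[𝓝 0] fun _ => f 0 := by
    filter_upwards [hmin, h3] with t ht1 ht2
    exact le_antisymm ht2 ht1
  have h5 : deriv f =ᶠ[𝓝 0] fun _ => 0 := by
    have := h4.deriv
    simpa using this
  rw [h5.deriv_eq] at e2
  simp at e2
  linarith

/-- the gradient map sends the cone to the dual cone -/
lemma Pot.neg_grad_mem (P : Pot n C F g H) (h : DualPair C D) {x : Euc (n+1)} (hx : x ∈ C) :
    -g x ∈ D := by
  have key : ∀ x ∈ C, ∀ v ∈ closure C, ⟪g x, v⟫ ≤ 0 := by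
    intro x hx
    have h1 : ∀ v ∈ C, ⟪g x, v⟫ ≤ 0 := by
      intro v hv
      by_contra hk
      push Not at hk
      set k := ⟪g x, v⟫ with hkd
      set s : ℝ := 1 + |F v - F x| / k with hs
      have hs1 : 1 ≤ s := by
        have : 0 ≤ |F v - F x| / k := by positivity
        linarith
      have h2 := P.conv_ineq h.convC hx (h.smul_mem hv (c := s) (by linarith))
      rw [P.hom v hv s (by linarith), inner_sub_right, P.euler hx, inner_smul_right, ← hkd] at h2
      have h3 : s * k = k + |F v - F x| := by rw [hs]; field_simp
      have h4 : 0 ≤ Real.log s := Real.log_nonneg hs1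
      have h5 := le_abs_self (F v - F x)
      have h6 : (0:ℝ) ≤ n := Nat.cast_nonneg n
      nlinarith
    have h2 : closure C ⊆ {v | ⟪g x, v⟫ ≤ 0} :=
      closure_minimal h1 (isClosed_le (by fun_prop) continuous_const)
    exact h2
  rw [h.memD]
  intro v hv hv0
  have hxv := h.add_closure_mem hx hv
  have h1 := P.grad_mono h.convC hx hxv hv0 (Set.left_mem_Icc.2 zero_le_one)
    (Set.right_mem_Icc.2 zero_le_one) zero_lt_one
  simp only [zero_smul, add_zero, one_smul] at h1
  have h2 := key _ hxv v hv
  rw [inner_neg_right, real_inner_comm]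
  linarith

end Pots

section Compare

open Filter Topology

lemma exists_min_aux {X : Type*} [TopologicalSpace X] [T2Space X] {K S : Set X} (hK : IsCompact K)
    (hSK : S ⊆ K) (hS : S.Nonempty) (f : X → ℝ)
    (hf : ∀ z ∈ K, ∀ M : ℝ, (z ∈ S → M < f z) → ∀ᶠ x in 𝓝[S] z, M < f x) :
    ∃ p ∈ S, ∀ x ∈ S, f p ≤ f x := by
  obtain ⟨s0, hs0⟩ := hS
  set L : Set X := {x | x ∈ S ∧ f x ≤ f s0} with hL
  have hLK : L ⊆ K := fun x hx => hSK hx.1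
  have hLc : IsClosed L := by
    apply isClosed_of_closure_subset
    intro z hz
    have hzK : z ∈ K := hK.isClosed.closure_subset_iff.2 hLK hz
    by_contra hzL
    have h1 := hf z hzK (f s0) (fun hzS => by
      by_contra hc
      exact hzL ⟨hzS, not_lt.1 hc⟩)
    rw [eventually_nhdsWithin_iff] at h1
    rw [mem_closure_iff_frequently] at hz
    obtain ⟨x, hx1, hx2⟩ := (hz.and_eventually h1).exists
    exact absurd (hx2 hx1.1) (not_lt.2 hx1.2)
  have hLcomp : IsCompact L := hK.of_isClosed_subset hLc hLK
  obtain ⟨p, hp, hmin⟩ := LowerSemicontinuousOn.exists_isMinOn (f := f) (s := L)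
    ⟨s0, hs0, le_refl _⟩ hLcomp (by
      intro z hz M hM
      exact (hf z (hLK hz) M (fun _ => hM)).filter_mono (nhdsWithin_mono z fun x hx => hx.1))
  refine ⟨p, hp.1, fun x hx => ?_⟩
  by_cases hxs : f x ≤ f s0
  · exact hmin ⟨hx, hxs⟩
  · exact hp.2.trans (not_le.1 hxs).le

variable {n : ℕ} {C D : Set (Euc (n+1))} {F : Euc (n+1) → ℝ} {g : Euc (n+1) → Euc (n+1)}
  {H : Euc (n+1) → Euc (n+1) →L[ℝ] Euc (n+1)}

lemma DualPair.exists_ne_zero (h : DualPair C D) : ∃ x ∈ C, x ≠ 0 := by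
  by_contra hcon
  push Not at hcon
  obtain ⟨x, hx⟩ := h.neC
  have : C = {0} := by
    apply Set.eq_singleton_iff_unique_mem.2
    exact ⟨hcon x hx ▸ hx, hcon⟩
  have h2 := h.openC
  rw [this] at h2
  exact not_isOpen_singleton (0 : Euc (n+1)) h2

lemma DualPair.ne_zero (h : DualPair C D) {x : Euc (n+1)} (hx : x ∈ C) : x ≠ 0 := by
  rintro rfl
  obtain ⟨y, hy, hy0⟩ := h.symm.exists_ne_zero
  have := h.inner_pos' hx (subset_closure hy) hy0
  simp at this

lemma DualPair.normalize_mem (h : DualPair C D) {x : Euc (n+1)} (hx : x ∈ C) :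
    ‖x‖⁻¹ • x ∈ C ∧ ‖‖x‖⁻¹ • x‖ = 1 := by
  have h0 : 0 < ‖x‖ := norm_pos_iff.2 (h.ne_zero hx)
  exact ⟨h.smul_mem hx (by positivity), by simp [norm_smul, h0.ne']⟩

lemma DualPair.sphere_min (h : DualPair C D) (f : Euc (n+1) → ℝ)
    (hf : ∀ z ∈ closure C, z ≠ 0 → ∀ M : ℝ, (z ∈ C → M < f z) → ∀ᶠ x in 𝓝[C] z, M < f x)  :
    ∃ p ∈ C, ∀ x ∈ C, ‖x‖ = 1 → f p ≤ f x := by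
  obtain ⟨x, hx⟩ := h.neC
  obtain ⟨p, hp, hmin⟩ := exists_min_aux (K := closure C ∩ Metric.sphere 0 1)
    (S := C ∩ Metric.sphere 0 1) ((isCompact_sphere _ _).inter_left isClosed_closure)
    (Set.inter_subset_inter_left _ subset_closure)
    ⟨_, (h.normalize_mem hx).1, by simpa using (h.normalize_mem hx).2⟩ f (by
      intro z hz M hM
      have hz0 : z ≠ 0 := by rintro rfl; simpa using hz.2
      exact (hf z hz.1 hz0 M (fun hzC => hM ⟨hzC, hz.2⟩)).filter_mono
        (nhdsWithin_mono z Set.inter_subset_left))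
  exact ⟨p, hp.1, fun x hx hx1 => hmin x ⟨hx, by simpa using hx1⟩⟩

/-- minimisation of a degree zero function -/
lemma DualPair.global_min (h : DualPair C D) (f : Euc (n+1) → ℝ)
    (hf : ∀ z ∈ closure C, z ≠ 0 → ∀ M : ℝ, (z ∈ C → M < f z) → ∀ᶠ x in 𝓝[C] z, M < f x)
    (hom : ∀ x ∈ C, ∀ c : ℝ, 0 < c → f (c • x) = f x) :
    ∃ p ∈ C, ∀ x ∈ C, f p ≤ f x := by
  obtain ⟨p, hp, hmin⟩ := h.sphere_min f hf
  refine ⟨p, hp, fun x hx => ?_⟩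
  have h0 : 0 < ‖x‖ := norm_pos_iff.2 (h.ne_zero hx)
  rw [← hom x hx (‖x‖⁻¹) (by positivity)]
  exact hmin _ (h.normalize_mem hx).1 (h.normalize_mem hx).2

lemma Pot.lsc (P : Pot n C F g H) : ∀ z ∈ closure C, ∀ M : ℝ, (z ∈ C → M < F z) →
    ∀ᶠ x in 𝓝[C] z, M < F x := by
  intro z hz M hM
  by_cases hzC : z ∈ C
  · exact ((P.cont hzC).eventually (lt_mem_nhds (hM hzC))).filter_mono nhdsWithin_le_nhds
  · exact P.blow z hz hzC M

lemma lsc_add_aux {F k : Euc (n+1) → ℝ} {z : Euc (n+1)}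
    (hF : ∀ M : ℝ, (z ∈ C → M < F z) → ∀ᶠ x in 𝓝[C] z, M < F x) (hk : ContinuousAt k z) :
    ∀ M : ℝ, (z ∈ C → M < F z + k z) → ∀ᶠ x in 𝓝[C] z, M < F x + k x := by
  intro M hM
  obtain ⟨M', hM1, hM2⟩ : ∃ M', M - k z < M' ∧ (z ∈ C → M' < F z) := by
    by_cases hz : z ∈ C
    · obtain ⟨M', h1, h2⟩ := exists_between (show M - k z < F z by linarith [hM hz])
      exact ⟨M', h1, fun _ => h2⟩
    · exact ⟨M - k z + 1, by linarith, fun h => absurd h hz⟩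
  have h2 : ∀ᶠ x in 𝓝[C] z, M - M' < k x :=
    (hk.eventually (lt_mem_nhds (show M - M' < k z by linarith))).filter_mono nhdsWithin_le_nhds
  filter_upwards [hF M' hM2, h2] with x h3 h4
  linarith

lemma exp_log_aux {α β d : ℝ} (hd : 0 < d) (h : Real.exp (2 * α) * d ^ 2 ≤ Real.exp (2 * β)) :
    α + Real.log d ≤ β := by
  have h1 : Real.exp (2 * (α + Real.log d)) = Real.exp (2 * α) * d ^ 2 := by
    rw [mul_add, Real.exp_add, two_mul (Real.log d), Real.exp_add, Real.exp_log hd]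
    ring
  rw [← h1, Real.exp_le_exp] at h
  linarith

lemma line_mem_aux (hC : IsOpen C) {x : Euc (n+1)} (hx : x ∈ C) (w : Euc (n+1)) :
    ∀ᶠ t in 𝓝 (0:ℝ), x + t • w ∈ C := by
  have hc : Continuous (fun t : ℝ => x + t • w) := by fun_prop
  exact hc.continuousAt.eventually (by simpa using hC.mem_nhds hx)

/-- Self comparison. -/
lemma Pot.self_compare (P : Pot n C F g H) (h : DualPair C D) {a e : Euc (n+1)} (ha : a ∈ C)
    (he : e ∈ D) {x : Euc (n+1)} (hx : x ∈ C) :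
    F (x + ⟪e, x⟫ • a) + Real.log (1 + ⟪e, a⟫) ≤ F x := by
  set T := rk1 a e with hT
  have hTm : ∀ z ∈ closure C, z ≠ 0 → T z ∈ C := by
    intro z hz hz0
    rw [hT, rk1_apply, add_comm z]
    refine h.add_closure_mem (h.smul_mem ha ?_) hz
    rw [real_inner_comm]
    exact h.inner_pos hz hz0 he
  have hTm' : ∀ z ∈ C, T z ∈ C := fun z hz => hTm z (subset_closure hz) (h.ne_zero hz)
  have hdet : LinearMap.det (T : Euc (n+1) →ₗ[ℝ] Euc (n+1)) = 1 + ⟪e, a⟫ := rk1_det a e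
  have hpos : 0 < ⟪e, a⟫ := by
    rw [real_inner_comm]
    exact h.inner_pos' ha (subset_closure he) (h.symm.ne_zero he)
  obtain ⟨p, hp, hmin⟩ := h.global_min (fun x => F x + (-F (T x))) (by
    intro z hz hz0
    refine lsc_add_aux (k := fun x => -F (T x)) (P.lsc z hz) ?_
    exact ((P.cont (hTm z hz hz0)).comp T.continuous.continuousAt).neg) (by
    intro x hx c hc
    simp only [map_smul]
    rw [P.hom x hx c hc, P.hom _ (hTm' x hx) c hc]
    ring)
  have hsec : ∀ v, ⟪H (T p) (T v), T v⟫ ≤ ⟪H p v, v⟫ := by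
    intro v
    have e1 : ∀ t : ℝ, T (p + t • v) = T p + t • T v := by intro t; simp
    have hl := line_mem_aux h.openC hp v
    have := second_order_min (f := fun t => F (p + t • v) - F (T p + t • T v))
      (f' := fun t => ⟪g (p + t • v), v⟫ - ⟪g (T p + t • T v), T v⟫)
      (c := ⟪H (p + (0:ℝ) • v) v, v⟫ - ⟪H (T p + (0:ℝ) • T v) (T v), T v⟫)
      (by
        filter_upwards [hl] with t ht
        exact (P.deriv_line p v t ht).sub (P.deriv_line (T p) (T v) t (e1 t ▸ hTm' _ ht)))
      ((P.deriv2_line p v v 0 (by simpa using hp)).sub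
        (P.deriv2_line (T p) (T v) (T v) 0 (by simpa using hTm' p hp)))
      (by
        filter_upwards [hl] with t ht
        have := hmin _ ht
        rw [e1] at this
        simp only [zero_smul, add_zero]
        linarith)
    simp only [zero_smul, add_zero] at this
    linarith
  have h1 := detlem (H p : Euc (n+1) →ₗ[ℝ] Euc (n+1)) (H (T p) : Euc (n+1) →ₗ[ℝ] Euc (n+1))
    (T : Euc (n+1) →ₗ[ℝ] Euc (n+1)) (P.symm p hp) (P.symm _ (hTm' p hp)) (P.pos _ (hTm' p hp))
    (by rw [hdet]; linarith) hsec
  rw [P.det p hp, P.det _ (hTm' p hp), hdet] at h1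
  have h2 := exp_log_aux (by linarith) h1
  have h3 := hmin x hx
  simp only [hT, rk1_apply] at h2 h3
  linarith

lemma Pot.self_compare' (P : Pot n C F g H) (h : DualPair C D) {a e : Euc (n+1)}
    (ha : a ∈ closure C) (he : e ∈ D) {x : Euc (n+1)} (hx : x ∈ C) :
    F (x + ⟪e, x⟫ • a) + Real.log (1 + ⟪e, a⟫) ≤ F x := by
  obtain ⟨c0, hc0⟩ := h.neC
  have hex : 0 < ⟪e, x⟫ := by
    rw [real_inner_comm]
    exact h.inner_pos (subset_closure hx) (h.ne_zero hx) he
  have hea : 0 ≤ ⟪e, a⟫ := by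
    rw [real_inner_comm]
    exact h.closure_nonneg ha (subset_closure he)
  have hm : x + ⟪e, x⟫ • a ∈ C := h.add_closure_mem hx (h.smul_closure_mem ha hex)
  have hcont : ContinuousAt (fun t : ℝ => F (x + ⟪e, x⟫ • (a + t • c0)) +
      Real.log (1 + ⟪e, a + t • c0⟫)) 0 := by
    refine ContinuousAt.add ?_ ?_
    · have hc : Continuous (fun t : ℝ => x + ⟪e, x⟫ • (a + t • c0)) := by fun_prop
      refine ContinuousAt.comp (f := fun t : ℝ => x + ⟪e, x⟫ • (a + t • c0)) (g := F) ?_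
        hc.continuousAt
      simpa using P.cont hm
    · have hc : Continuous (fun t : ℝ => 1 + ⟪e, a + t • c0⟫) := by fun_prop
      refine hc.continuousAt.log ?_
      simp only [zero_smul, add_zero]
      linarith
  have h1 := hcont.tendsto.mono_left (nhdsWithin_le_nhds (s := Set.Ioi 0))
  simp only [zero_smul, add_zero] at h1
  refine le_of_tendsto h1 ?_
  filter_upwards [self_mem_nhdsWithin] with t ht
  refine P.self_compare h ?_ he hx
  rw [add_comm a]
  exact h.add_closure_mem (h.smul_mem hc0 ht) ha

/-- Surjectivity of the gradient map. -/
lemma Pot.exists_grad (P : Pot n C F g H) (h : DualPair C D) {y : Euc (n+1)} (hy : y ∈ D) :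
    ∃ x ∈ C, g x = -y := by
  have hn : (0:ℝ) < n + 1 := by positivity
  have hip : ∀ x ∈ C, 0 < ⟪x, y⟫ := fun x hx => h.inner_pos (subset_closure hx) (h.ne_zero hx) hy
  obtain ⟨p, hp, hmin⟩ := h.global_min (fun x => F x + (n+1) * Real.log ⟪x, y⟫) (by
    intro z hz hz0
    refine lsc_add_aux (k := fun x => (n+1) * Real.log ⟪x, y⟫) (P.lsc z hz) ?_
    refine continuousAt_const.mul (ContinuousAt.log (by fun_prop) ?_)
    exact (h.inner_pos hz hz0 hy).ne') (by
    intro x hx c hc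
    rw [P.hom x hx c hc, inner_smul_left]
    simp only [conj_trivial]
    rw [Real.log_mul hc.ne' (hip x hx).ne']
    ring)
  have hpy := hip p hp
  set c := (n+1) / ⟪p, y⟫ with hc
  have hcp : 0 < c := by positivity
  have hcm := h.smul_mem hp hcp
  refine ⟨c • p, hcm, ?_⟩
  rw [P.grad_hom hp hcp h.openC hcm]
  have hg : g p = - (c • y) := by
    apply ext_inner_right ℝ
    intro w
    have h1 := P.deriv_line p w 0 (by simpa using hp)
    have h2 : HasDerivAt (fun s : ℝ => ⟪p + s • w, y⟫) ⟪w, y⟫ 0 := by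
      have h1 : HasDerivAt (fun s : ℝ => p + s • w) w 0 := by
        simpa using ((hasDerivAt_id (0:ℝ)).smul_const w).const_add p
      have := h1.inner ℝ (hasDerivAt_const (0:ℝ) y)
      simpa using this
    have h3 := h1.add ((h2.log (by simpa using hpy.ne')).const_mul ((n:ℝ)+1))
    have h4 : IsLocalMin ((fun s : ℝ => F (p + s • w)) +
        fun s : ℝ => (n+1) * Real.log ⟪p + s • w, y⟫) 0 := by
      filter_upwards [line_mem_aux h.openC hp w] with t ht
      simpa using hmin _ ht
    have h5 := h4.hasDerivAt_eq_zero h3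
    simp only [zero_smul, add_zero] at h5
    rw [inner_neg_left, inner_smul_left, hc, real_inner_comm w y]
    simp only [conj_trivial]
    have : (↑n + 1) * (⟪w, y⟫ / ⟪p, y⟫) = (↑n + 1) / ⟪p, y⟫ * ⟪w, y⟫ := by ring
    linarith
  rw [hg, smul_neg, smul_smul, inv_mul_cancel₀ hcp.ne', one_smul]

end Compare

section Lower

open Filter Topology

variable {n : ℕ} {C D : Set (Euc (n+1))} {F G : Euc (n+1) → ℝ} {g gG : Euc (n+1) → Euc (n+1)}
  {H HG : Euc (n+1) → Euc (n+1) →L[ℝ] Euc (n+1)}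

lemma lsc_prod_aux {F G : Euc (n+1) → ℝ} {k : Euc (n+1) × Euc (n+1) → ℝ} {z w : Euc (n+1)}
    (hF : ∀ M : ℝ, (z ∈ C → M < F z) → ∀ᶠ x in 𝓝[C] z, M < F x)
    (hG : ∀ M : ℝ, (w ∈ D → M < G w) → ∀ᶠ x in 𝓝[D] w, M < G x)
    (hk : ContinuousAt k (z, w)) :
    ∀ M : ℝ, ((z, w) ∈ C ×ˢ D → M < F z + G w + k (z, w)) →
      ∀ᶠ x in 𝓝[C ×ˢ D] (z, w), M < F x.1 + G x.2 + k x := by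
  intro M hM
  obtain ⟨M1, M2, hM0, hM1, hM2⟩ : ∃ M1 M2, M - k (z, w) < M1 + M2 ∧ (z ∈ C → M1 < F z) ∧
      (w ∈ D → M2 < G w) := by
    by_cases hz : z ∈ C
    · by_cases hw : w ∈ D
      · have := hM ⟨hz, hw⟩
        set δ := F z + G w + k (z, w) - M with hδ
        exact ⟨F z - δ / 3, G w - δ / 3, by linarith, fun _ => by linarith, fun _ => by linarith⟩
      · exact ⟨F z - 1, M - k (z, w) - F z + 2, by linarith, fun _ => by linarith,
          fun h => absurd h hw⟩
    · exact ⟨M - k (z, w) - G w + 2, G w - 1, by linarith, fun h => absurd h hz,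
        fun _ => by linarith⟩
  have h2 : ∀ᶠ x in 𝓝[C ×ˢ D] (z, w), M - M1 - M2 < k x :=
    (hk.eventually (lt_mem_nhds (show M - M1 - M2 < k (z, w) by linarith))).filter_mono
      nhdsWithin_le_nhds
  rw [nhdsWithin_prod_eq] at h2 ⊢
  filter_upwards [(hF M1 hM1).prod_inl _, (hG M2 hM2).prod_inr _, h2] with x h3 h4 h5
  linarith

lemma Pot.lower_aux (P : Pot n C F g H) (Q : Pot n D G gG HG) (h : DualPair C D)
    {e e' : Euc (n+1)} (he : e ∈ C) (he' : e' ∈ D) {x y : Euc (n+1)} (hx : x ∈ C) (hy : y ∈ D) :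
    (n:ℝ) + 1 ≤ F x + G y + ⟪x, y + ⟪e, y⟫ • e'⟫ := by
  have hn : (0:ℝ) < n + 1 := by positivity
  set T := rk1 e' e with hT
  have hdet : LinearMap.det (T : Euc (n+1) →ₗ[ℝ] Euc (n+1)) = 1 + ⟪e, e'⟫ := rk1_det e' e
  have hTm : ∀ w ∈ closure D, w ≠ 0 → T w ∈ D := by
    intro w hw hw0
    rw [hT, rk1_apply, add_comm w]
    exact h.symm.add_closure_mem (h.symm.smul_mem he' (h.inner_pos' he hw hw0)) hw
  have hpos : 0 < ⟪e, e'⟫ := h.inner_pos (subset_closure he) (h.ne_zero he) he'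
  have hb : ∀ z ∈ closure C, z ≠ 0 → ∀ w ∈ closure D, w ≠ 0 → 0 < ⟪z, T w⟫ :=
    fun z hz hz0 w hw hw0 => h.inner_pos hz hz0 (hTm w hw hw0)
  have hb' : ∀ z ∈ C, ∀ w ∈ D, 0 < ⟪z, T w⟫ := fun z hz w hw =>
    hb z (subset_closure hz) (h.ne_zero hz) w (subset_closure hw) (h.symm.ne_zero hw)
  let f : Euc (n+1) × Euc (n+1) → ℝ := fun x => F x.1 + G x.2 + (n+1) * Real.log ⟪x.1, T x.2⟫
  obtain ⟨⟨p, q⟩, ⟨⟨hp, -⟩, ⟨hq, -⟩⟩, hmin⟩ := exists_min_aux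
    (K := (closure C ∩ Metric.sphere 0 1) ×ˢ (closure D ∩ Metric.sphere 0 1))
    (S := (C ∩ Metric.sphere 0 1) ×ˢ (D ∩ Metric.sphere 0 1))
    (((isCompact_sphere _ _).inter_left isClosed_closure).prod
      ((isCompact_sphere _ _).inter_left isClosed_closure))
    (Set.prod_mono (Set.inter_subset_inter_left _ subset_closure)
      (Set.inter_subset_inter_left _ subset_closure))
    ⟨(_, _), ⟨(h.normalize_mem hx).1, by simpa using (h.normalize_mem hx).2⟩,
      ⟨(h.symm.normalize_mem hy).1, by simpa using (h.symm.normalize_mem hy).2⟩⟩ f (by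
      rintro ⟨z, w⟩ ⟨⟨hz, hz1⟩, ⟨hw, hw1⟩⟩ M hM
      have hz0 : z ≠ 0 := by rintro rfl; simp at hz1
      have hw0 : w ≠ 0 := by rintro rfl; simp at hw1
      have hc : ContinuousAt (fun x : Euc (n+1) × Euc (n+1) => (n+1) * Real.log ⟪x.1, T x.2⟫)
          (z, w) := by
        refine continuousAt_const.mul (ContinuousAt.log (by fun_prop) ?_)
        exact (hb z hz hz0 w hw hw0).ne'
      exact (lsc_prod_aux (P.lsc z hz) (Q.lsc w hw) hc M
        (fun hzw => hM ⟨⟨hzw.1, hz1⟩, ⟨hzw.2, hw1⟩⟩)).filter_mono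
        (nhdsWithin_mono _ (Set.prod_mono Set.inter_subset_left Set.inter_subset_left)))
  have hom : ∀ x ∈ C, ∀ y ∈ D, ∀ c : ℝ, 0 < c → ∀ d : ℝ, 0 < d → f (c • x, d • y) = f (x, y) := by
    intro x hx y hy c hc d hd
    simp only [f, map_smul, inner_smul_left, inner_smul_right, conj_trivial]
    rw [P.hom x hx c hc, Q.hom y hy d hd, Real.log_mul hd.ne' (by have := hb' x hx y hy; positivity),
      Real.log_mul hc.ne' (hb' x hx y hy).ne']
    ring
  have hmin2 : ∀ x ∈ C, ∀ y ∈ D, f (p, q) ≤ f (x, y) := by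
    intro x hx y hy
    have hx0 : 0 < ‖x‖ := norm_pos_iff.2 (h.ne_zero hx)
    have hy0 : 0 < ‖y‖ := norm_pos_iff.2 (h.symm.ne_zero hy)
    rw [← hom x hx y hy (‖x‖⁻¹) (by positivity) (‖y‖⁻¹) (by positivity)]
    exact hmin (_, _) ⟨⟨(h.normalize_mem hx).1, by simpa using (h.normalize_mem hx).2⟩,
      ⟨(h.symm.normalize_mem hy).1, by simpa using (h.symm.normalize_mem hy).2⟩⟩
  -- rescale
  obtain ⟨r, hr, hpr, hminr⟩ : ∃ r ∈ D, ⟪p, T r⟫ = n + 1 ∧ ∀ x ∈ C, ∀ y ∈ D, f (p, r) ≤ f (x, y) := by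
    have hbpq := hb' p hp q hq
    refine ⟨((n+1) / ⟪p, T q⟫) • q, h.symm.smul_mem hq (by positivity), ?_, ?_⟩
    · rw [map_smul, inner_smul_right]
      field_simp
    · intro x hx y hy
      have := hom p hp q hq 1 one_pos ((n+1) / ⟪p, T q⟫) (by positivity)
      rw [one_smul] at this
      rw [this]
      exact hmin2 x hx y hy
  have hΨ : ∀ x ∈ C, ∀ y ∈ D, F p + G r + ⟪p, T r⟫ ≤ F x + G y + ⟪x, T y⟫ := by
    intro x hx y hy
    have h1 := hminr x hx y hy
    simp only [f] at h1
    have hbp := hb' x hx y hy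
    have h2 := Real.log_le_sub_one_of_pos (show 0 < ⟪x, T y⟫ / (n+1) by positivity)
    rw [Real.log_div hbp.ne' hn.ne'] at h2
    rw [hpr] at h1 ⊢
    have h3 : (n+1) * (Real.log ⟪x, T y⟫ - Real.log (n+1)) ≤ (n+1) * (⟪x, T y⟫ / (n+1) - 1) :=
      mul_le_mul_of_nonneg_left h2 hn.le
    have h4 : ((n:ℝ)+1) * (⟪x, T y⟫ / (n+1) - 1) = ⟪x, T y⟫ - (n+1) := by field_simp
    linarith
  have hsec : ∀ v w, 0 ≤ ⟪H p v, v⟫ + ⟪HG r w, w⟫ + 2 * ⟪v, T w⟫ := by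
    intro v w
    have hl := line_mem_aux h.openC hp v
    have hl2 := line_mem_aux h.openD hr w
    have d1 : ∀ t : ℝ, HasDerivAt (fun s : ℝ => p + s • v) v t := by
      intro t
      simpa using ((hasDerivAt_id t).smul_const v).const_add p
    have d2 : ∀ t : ℝ, HasDerivAt (fun s : ℝ => T r + s • T w) (T w) t := by
      intro t
      simpa using ((hasDerivAt_id t).smul_const (T w)).const_add (T r)
    have := second_order_min
      (f := fun t => F (p + t • v) + G (r + t • w) + ⟪p + t • v, T r + t • T w⟫)
      (f' := fun t => ⟪g (p + t • v), v⟫ + ⟪gG (r + t • w), w⟫ +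
        (⟪p + t • v, T w⟫ + ⟪v, T r + t • T w⟫))
      (c := ⟪H (p + (0:ℝ) • v) v, v⟫ + ⟪HG (r + (0:ℝ) • w) w, w⟫ +
        (⟪v, T w⟫ + ⟪v, T w⟫))
      (by
        filter_upwards [hl, hl2] with t ht ht2
        exact ((P.deriv_line p v t ht).add (Q.deriv_line r w t ht2)).add ((d1 t).inner ℝ (d2 t)))
      (((P.deriv2_line p v v 0 (by simpa using hp)).add
        (Q.deriv2_line r w w 0 (by simpa using hr))).add
        (by
          have h1 := (d1 0).inner ℝ (hasDerivAt_const (0:ℝ) (T w))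
          have h2 := (hasDerivAt_const (0:ℝ) v).inner ℝ (d2 0)
          have h3 := h1.add h2
          simp only [inner_zero_right, inner_zero_left, zero_add, add_zero] at h3
          exact h3))
      (by
        filter_upwards [hl, hl2] with t ht ht2
        have := hΨ _ ht _ ht2
        rw [map_add, map_smul] at this
        simpa only [zero_smul, add_zero] using this)
    simp only [zero_smul, add_zero] at this
    linarith
  have hinj : Function.Injective (H p : Euc (n+1) →ₗ[ℝ] Euc (n+1)) := by
    rw [injective_iff_map_eq_zero]
    intro v hv
    by_contra hv0
    have h1 := P.pos p hp v hv0
    rw [show H p v = 0 from hv] at h1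
    simp at h1
  let E := LinearEquiv.ofInjectiveEndo _ hinj
  let K : Euc (n+1) →ₗ[ℝ] Euc (n+1) := E.symm
  have hK : ∀ v, H p (K v) = v := fun v => E.apply_symm_apply v
  have hKdet : Real.exp (2 * F p) * LinearMap.det K = 1 := by
    rw [← P.det p hp, ← LinearMap.det_comp]
    have : (H p : Euc (n+1) →ₗ[ℝ] Euc (n+1)) ∘ₗ K = LinearMap.id := LinearMap.ext hK
    rw [this, LinearMap.det_id]
  have hK0 : LinearMap.det K ≠ 0 := right_ne_zero_of_mul_eq_one hKdet
  have h1 := detlem (HG r : Euc (n+1) →ₗ[ℝ] Euc (n+1)) (H p : Euc (n+1) →ₗ[ℝ] Euc (n+1))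
    (K ∘ₗ (T : Euc (n+1) →ₗ[ℝ] Euc (n+1))) (Q.symm r hr) (P.symm p hp) (P.pos p hp)
    (by
      rw [LinearMap.det_comp, hdet]
      exact mul_ne_zero hK0 (by linarith))
    (by
      intro w
      have h2 := hsec (-K (T w)) w
      simp only [map_neg, hK, inner_neg_left, inner_neg_right, neg_neg] at h2
      simp only [LinearMap.comp_apply, ContinuousLinearMap.coe_coe, hK]
      rw [real_inner_comm (T w) (K (T w))] at h2
      linarith [real_inner_comm (T w) (K (T w))])
  rw [P.det p hp, Q.det r hr, LinearMap.det_comp, hdet] at h1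
  have h2 : Real.exp (2 * (-F p)) * (1 + ⟪e, e'⟫) ^ 2 ≤ Real.exp (2 * G r) := by
    refine le_trans (le_of_eq ?_) h1
    have h3 : Real.exp (2 * (-F p)) = LinearMap.det K := by
      rw [mul_neg, Real.exp_neg]
      exact (eq_inv_of_mul_eq_one_right hKdet).symm
    rw [h3]
    linear_combination (-(1 + ⟪e, e'⟫) ^ 2 * LinearMap.det K) * hKdet
  have h3 := exp_log_aux (by linarith) h2
  have h4 : 0 ≤ Real.log (1 + ⟪e, e'⟫) := Real.log_nonneg (by linarith)
  have h5 := hΨ x hx y hy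
  rw [hpr] at h5
  rw [hT, rk1_apply] at h5
  linarith

lemma Pot.lower (P : Pot n C F g H) (Q : Pot n D G gG HG) (h : DualPair C D)
    {x y : Euc (n+1)} (hx : x ∈ C) (hy : y ∈ D) :
    (n:ℝ) + 1 ≤ F x + G y + ⟪x, y⟫ := by
  have hc : Continuous (fun t : ℝ => F x + G y + ⟪x, y + ⟪t • x, y⟫ • y⟫) := by fun_prop
  have h1 := (hc.tendsto 0).mono_left (nhdsWithin_le_nhds (s := Set.Ioi 0))
  simp only [zero_smul, inner_zero_left, add_zero] at h1
  refine ge_of_tendsto h1 ?_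
  filter_upwards [self_mem_nhdsWithin] with t ht
  exact P.lower_aux Q h (h.smul_mem hx ht) hy hx hy

end Lower

section Upper

open Filter Topology

variable {n : ℕ} {C D : Set (Euc (n+1))} {F G : Euc (n+1) → ℝ} {g gG : Euc (n+1) → Euc (n+1)}
  {H HG : Euc (n+1) → Euc (n+1) →L[ℝ] Euc (n+1)}

lemma Pot.hess_surj (P : Pot n C F g H) {p : Euc (n+1)} (hp : p ∈ C) (u : Euc (n+1)) :
    ∃ w, H p w = u := by
  have hinj : Function.Injective (H p : Euc (n+1) →ₗ[ℝ] Euc (n+1)) := by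
    rw [injective_iff_map_eq_zero]
    intro v hv
    by_contra hv0
    have h1 := P.pos p hp v hv0
    rw [show H p v = 0 from hv] at h1
    simp at h1
  exact LinearMap.injective_iff_surjective.1 hinj u

lemma Pot.third_order (Q : Pot n D G gG HG) (hD : IsOpen D) {q : Euc (n+1)} (hq : q ∈ D)
    (w : Euc (n+1)) : ∃ k : Euc (n+1), HasDerivAt (fun t : ℝ => HG (q + t • w) w) k 0 ∧
      ⟪k, q⟫ = -2 * ⟪HG q w, w⟫ := by
  have d1 : HasDerivAt (fun s : ℝ => q + s • w) w 0 := by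
    simpa using ((hasDerivAt_id (0:ℝ)).smul_const w).const_add q
  have d2 : HasDerivAt (fun t : ℝ => HG (q + t • w)) (fderiv ℝ HG q w) 0 := by
    have h1 : HasFDerivAt HG (fderiv ℝ HG q) (q + (0:ℝ) • w) := by
      simpa using (Q.dH q hq).hasFDerivAt
    exact h1.comp_hasDerivAt 0 d1
  have d3 : HasDerivAt (fun t : ℝ => HG (q + t • w) w) (fderiv ℝ HG q w w) 0 := by
    have := d2.clm_apply (hasDerivAt_const (0:ℝ) w)
    simpa using this
  refine ⟨_, d3, ?_⟩
  have d4 := d3.inner ℝ d1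
  have d5 := (Q.deriv2_line q w w 0 (by simpa using hq)).neg
  have he : (fun t : ℝ => ⟪HG (q + t • w) w, q + t • w⟫) =ᶠ[𝓝 0]
      (-fun s : ℝ => ⟪gG (q + s • w), w⟫) := by
    filter_upwards [line_mem_aux hD hq w] with t ht
    rw [Q.symm _ ht, Q.euler2 hD ht, inner_neg_right, real_inner_comm]
    rfl
  have := d4.unique (d5.congr_of_eventuallyEq he)
  simp only [zero_smul, add_zero] at this
  linarith

lemma Pot.upper_local (P : Pot n C F g H) (Q : Pot n D G gG HG) (hD : IsOpen D)
    (T : Euc (n+1) →L[ℝ] Euc (n+1)) {q : Euc (n+1)} (hq : q ∈ D)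
    (hT : ∀ y ∈ D, T (-gG y) ∈ C)
    (hmin : ∀ y ∈ D, -G q - F (T (-gG q)) ≤ -G y - F (T (-gG y))) (w : Euc (n+1)) :
    ⟪H (T (-gG q)) (T (HG q w)), T (HG q w)⟫ ≤ ⟪HG q w, w⟫ := by
  have dx : ∀ w : Euc (n+1), ∀ t : ℝ, q + t • w ∈ D →
      HasDerivAt (fun t : ℝ => T (-gG (q + t • w))) (-T (HG (q + t • w) w)) t := by
    intro w t ht
    have h1 := (Q.deriv_grad_line q w t ht).neg
    have h2 := T.hasFDerivAt.comp_hasDerivAt t h1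
    rw [map_neg] at h2
    exact h2
  have dθ : ∀ w : Euc (n+1), ∀ t : ℝ, q + t • w ∈ D →
      HasDerivAt (fun t : ℝ => -G (q + t • w) - F (T (-gG (q + t • w))))
        (-⟪gG (q + t • w), w⟫ + ⟪g (T (-gG (q + t • w))), T (HG (q + t • w) w)⟫) t := by
    intro w t ht
    have h1 := (P.grad _ (hT _ ht)).comp_hasDerivAt t (dx w t ht)
    have h2 := (Q.deriv_line q w t ht).neg.sub h1
    simp only [innerSL_apply_apply, inner_neg_right, sub_neg_eq_add] at h2
    exact h2
  have hlm : ∀ w : Euc (n+1),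
      IsLocalMin (fun t : ℝ => -G (q + t • w) - F (T (-gG (q + t • w)))) 0 := by
    intro w
    filter_upwards [line_mem_aux hD hq w] with t ht
    simpa using hmin _ ht
  have hfirst : ∀ u, ⟪g (T (-gG q)), T u⟫ = -⟪u, q⟫ := by
    intro u
    obtain ⟨w, rfl⟩ := Q.hess_surj hq u
    have h1 := (hlm w).hasDerivAt_eq_zero (dθ w 0 (by simpa using hq))
    simp only [zero_smul, add_zero] at h1
    rw [Q.symm q hq, Q.euler2 hD hq, inner_neg_right]
    linarith [real_inner_comm (gG q) w]
  obtain ⟨k, hk, hkq⟩ := Q.third_order hD hq w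
  have hq0 : q + (0:ℝ) • w ∈ D := by simpa using hq
  have d1 : HasDerivAt (fun t : ℝ => g (T (-gG (q + t • w))))
      (H (T (-gG (q + (0:ℝ) • w))) (-T (HG (q + (0:ℝ) • w) w))) 0 :=
    (P.hess _ (hT _ hq0)).comp_hasDerivAt 0 (dx w 0 hq0)
  have d2 : HasDerivAt (fun t : ℝ => T (HG (q + t • w) w)) (T k) 0 :=
    T.hasFDerivAt.comp_hasDerivAt 0 hk
  have d3 := (Q.deriv2_line q w w 0 hq0).neg.add (d1.inner ℝ d2)
  have := second_order_min ((line_mem_aux hD hq w).mono fun t ht => dθ w t ht) d3 (hlm w)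
  simp only [zero_smul, add_zero] at this
  rw [hfirst, hkq, (H (T (-gG q))).map_neg, inner_neg_left] at this
  linarith

lemma Pot.legendre_le (Q : Pot n D G gG HG) (hD : Convex ℝ D) {x y y' : Euc (n+1)} (hy : y ∈ D)
    (hy' : y' ∈ D) (hx : gG y = -x) : n + 1 - G y' - ⟪x, y'⟫ ≤ -G y := by
  have h1 := Q.conv_ineq hD hy hy'
  have h2 := Q.euler hy
  rw [inner_sub_right, h2, hx, inner_neg_left] at h1
  linarith

lemma Pot.upper_aux (P : Pot n C F g H) (Q : Pot n D G gG HG) (h : DualPair C D)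
    {a e' : Euc (n+1)} (ha : a ∈ C) (he' : e' ∈ D) {y : Euc (n+1)} (hy : y ∈ D) :
    F (-gG y + ⟪e', -gG y⟫ • a) + G y ≤ 0 := by
  set T := rk1 a e' with hT
  have hTm : ∀ z ∈ closure C, z ≠ 0 → T z ∈ C := by
    intro z hz hz0
    rw [hT, rk1_apply, add_comm z]
    refine h.add_closure_mem (h.smul_mem ha ?_) hz
    rw [real_inner_comm]
    exact h.inner_pos hz hz0 he'
  have hTm' : ∀ z ∈ C, T z ∈ C := fun z hz => hTm z (subset_closure hz) (h.ne_zero hz)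
  have hdet : LinearMap.det (T : Euc (n+1) →ₗ[ℝ] Euc (n+1)) = 1 + ⟪e', a⟫ := rk1_det a e'
  have hpos : 0 < ⟪e', a⟫ := by
    rw [real_inner_comm]
    exact h.inner_pos' ha (subset_closure he') (h.symm.ne_zero he')
  have hex : ∀ x ∈ C, ∃ y ∈ D, gG y = -x := fun x hx => Q.exists_grad h.symm hx
  choose! q hqD hqx using hex
  have hGs : ∀ x ∈ C, ∀ y' ∈ D, n + 1 - G y' - ⟪x, y'⟫ ≤ -G (q x) := fun x hx y' hy' =>
    Q.legendre_le h.convD (hqD x hx) hy' (hqx x hx)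
  have hGeq : ∀ x ∈ C, ∀ y ∈ D, gG y = -x → n + 1 - G y - ⟪x, y⟫ = -G y := by
    intro x hx y hy hxy
    have := Q.euler hy
    rw [hxy, inner_neg_left] at this
    linarith
  have hgm : ∀ y ∈ D, -gG y ∈ C := fun y hy => Q.neg_grad_mem h.symm hy
  have hGq : ∀ y ∈ D, -G (q (-gG y)) = -G y := by
    intro y hy
    have hx := hgm y hy
    apply le_antisymm
    · rw [← hGeq _ hx _ (hqD _ hx) (hqx _ hx)]
      exact Q.legendre_le h.convD hy (hqD _ hx) (by simp)
    · have := hGs _ hx y hy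
      rwa [hGeq _ hx y hy (by simp)] at this
  obtain ⟨p, hp, hmin⟩ := h.sphere_min (fun x => -G (q x) + (-F (T x))) (by
    intro z hz hz0
    refine lsc_add_aux (F := fun x => -G (q x)) (k := fun x => -F (T x)) ?_
      ((P.cont (hTm z hz hz0)).comp T.continuous.continuousAt).neg
    intro M hM
    obtain ⟨y', hy', hMy⟩ : ∃ y' ∈ D, M < n + 1 - G y' - ⟪z, y'⟫ := by
      by_cases hzC : z ∈ C
      · refine ⟨q z, hqD z hzC, ?_⟩
        rw [hGeq z hzC _ (hqD z hzC) (hqx z hzC)]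
        exact hM hzC
      · have hz1 := hzC
        rw [h.memC] at hz1
        push Not at hz1
        obtain ⟨y0, hy0, hy00, hyz⟩ := hz1
        obtain ⟨e, he⟩ := h.neC
        obtain ⟨s, hs⟩ := h.neD
        have hey0 : 0 < ⟪e, y0⟫ := h.inner_pos' he hy0 hy00
        have hes : 0 < ⟪e, s⟫ := h.inner_pos' he (subset_closure hs) (h.symm.ne_zero hs)
        have hz2 : ⟪z, y0⟫ ≤ 0 := by rwa [real_inner_comm]
        set R := M - (n + 1 - G s - ⟪z, s⟫) + 1 with hR
        set t := Real.exp R / ⟪e, y0⟫ with ht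
        have htp : 0 < t := by positivity
        have hty : t • y0 ∈ closure D := h.symm.smul_closure_mem hy0 htp
        have h1 := Q.self_compare' h.symm hty he hs
        have h2 : ⟪e, t • y0⟫ = Real.exp R := by
          rw [inner_smul_right, ht]
          field_simp
        have h3 : R ≤ Real.log (1 + ⟪e, t • y0⟫) := by
          rw [h2, Real.le_log_iff_exp_le (by positivity)]
          linarith
        refine ⟨_, h.symm.add_closure_mem hs (h.symm.smul_closure_mem hty hes), ?_⟩
        have h4 : ⟪z, s + ⟪e, s⟫ • t • y0⟫ ≤ ⟪z, s⟫ := by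
          rw [inner_add_right, inner_smul_right, inner_smul_right]
          have : ⟪e, s⟫ * (t * ⟪z, y0⟫) ≤ 0 :=
            mul_nonpos_of_nonneg_of_nonpos hes.le (mul_nonpos_of_nonneg_of_nonpos htp.le hz2)
          linarith
        linarith
    have hc : Continuous (fun x : Euc (n+1) => n + 1 - G y' - ⟪x, y'⟫) := by fun_prop
    have h1 : ∀ᶠ x in 𝓝[C] z, M < n + 1 - G y' - ⟪x, y'⟫ :=
      (hc.continuousAt.eventually (lt_mem_nhds hMy)).filter_mono nhdsWithin_le_nhds
    filter_upwards [h1, self_mem_nhdsWithin] with x hx1 hx2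
    exact hx1.trans_le (hGs x hx2 y' hy'))
  have hmin2 : ∀ x ∈ C, -G (q p) - F (T p) ≤ -G (q x) - F (T x) := by
    intro x hx
    have h0 : 0 < ‖x‖ := norm_pos_iff.2 (h.ne_zero hx)
    have h1 := hmin _ (h.normalize_mem hx).1 (h.normalize_mem hx).2
    set x' := ‖x‖⁻¹ • x with hx'
    have hx'C : x' ∈ C := (h.normalize_mem hx).1
    have hxx : x = ‖x‖ • x' := by rw [hx', smul_smul, mul_inv_cancel₀ h0.ne', one_smul]
    have h2 : F (T x) = F (T x') - (n+1) * Real.log ‖x‖ := by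
      rw [← P.hom _ (hTm' _ hx'C) _ h0, ← map_smul, ← hxx]
    have h3 := hGs x hx _ (h.symm.smul_mem (hqD x' hx'C) (inv_pos.2 h0))
    rw [Q.hom _ (hqD x' hx'C) _ (inv_pos.2 h0), Real.log_inv] at h3
    have h4 : ⟪x, ‖x‖⁻¹ • q x'⟫ = ⟪x', q x'⟫ := by
      rw [hx', inner_smul_right, inner_smul_left]
      simp
    rw [h4] at h3
    have h5 := hGeq x' hx'C _ (hqD x' hx'C) (hqx x' hx'C)
    linarith
  have hpq : -gG (q p) = p := by rw [hqx p hp, neg_neg]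
  have hqp := hqD p hp
  have hmin3 : ∀ y ∈ D, -G (q p) - F (T (-gG (q p))) ≤ -G y - F (T (-gG y)) := by
    intro y hy
    rw [hpq, ← hGq y hy]
    exact hmin2 _ (hgm y hy)
  have hsec := P.upper_local Q h.openD T hqp (fun y hy => hTm' _ (hgm y hy)) hmin3
  rw [hpq] at hsec
  have hTp := hTm' p hp
  have h1 := detlem (HG (q p) : Euc (n+1) →ₗ[ℝ] Euc (n+1)) (H (T p) : Euc (n+1) →ₗ[ℝ] Euc (n+1))
    ((T : Euc (n+1) →ₗ[ℝ] Euc (n+1)) ∘ₗ (HG (q p) : Euc (n+1) →ₗ[ℝ] Euc (n+1)))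
    (Q.symm _ hqp) (P.symm _ hTp) (P.pos _ hTp)
    (by
      rw [LinearMap.det_comp, hdet, Q.det _ hqp]
      exact mul_ne_zero (by linarith) (Real.exp_pos _).ne') hsec
  rw [LinearMap.det_comp, P.det _ hTp, Q.det _ hqp, hdet] at h1
  have h2 := exp_log_aux (mul_pos (by linarith) (Real.exp_pos _)) h1
  rw [Real.log_mul (by linarith) (Real.exp_pos _).ne', Real.log_exp] at h2
  have h4 : 0 ≤ Real.log (1 + ⟪e', a⟫) := Real.log_nonneg (by linarith)
  have h5 := hmin2 _ (hgm y hy)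
  rw [hGq y hy, hT, rk1_apply, rk1_apply] at h5
  rw [hT, rk1_apply] at h2
  linarith

lemma Pot.upper (P : Pot n C F g H) (Q : Pot n D G gG HG) (h : DualPair C D)
    {y : Euc (n+1)} (hy : y ∈ D) : F (-gG y) + G y ≤ 0 := by
  have hx : -gG y ∈ C := Q.neg_grad_mem h.symm hy
  have hc : Continuous (fun t : ℝ => -gG y + ⟪y, -gG y⟫ • (t • (-gG y))) := by fun_prop
  have hc2 : ContinuousAt (fun t : ℝ => F (-gG y + ⟪y, -gG y⟫ • (t • (-gG y))) + G y) 0 := by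
    refine ContinuousAt.add ?_ continuousAt_const
    refine ContinuousAt.comp (f := fun t : ℝ => -gG y + ⟪y, -gG y⟫ • (t • (-gG y))) (g := F) ?_
      hc.continuousAt
    simpa using P.cont hx
  have h1 := hc2.tendsto.mono_left (nhdsWithin_le_nhds (s := Set.Ioi 0))
  simp only [zero_smul, smul_zero, add_zero] at h1
  refine le_of_tendsto h1 ?_
  filter_upwards [self_mem_nhdsWithin] with t ht
  exact P.upper_aux Q h (h.smul_mem hx ht) hy hy

/-- Duality of the canonical potentials. -/
lemma Pot.duality (P : Pot n C F g H) (Q : Pot n D G gG HG) (h : DualPair C D)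
    {y : Euc (n+1)} (hy : y ∈ D) : -gG y ∈ C ∧ F (-gG y) + G y = 0 ∧ g (-gG y) = -y := by
  have hx : -gG y ∈ C := Q.neg_grad_mem h.symm hy
  have h1 := P.upper Q h hy
  have h2 := Q.euler hy
  have h3 := P.lower Q h hx hy
  have h4 : ⟪-gG y, y⟫ = n + 1 := by rw [inner_neg_left, h2, neg_neg]
  refine ⟨hx, by linarith, ?_⟩
  apply ext_inner_right ℝ
  intro w
  set x := -gG y with hxd
  have d1 := P.deriv_line x w 0 (by simpa using hx)
  have d2 : HasDerivAt (fun s : ℝ => ⟪x + s • w, y⟫) ⟪w, y⟫ 0 := by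
    have h1 : HasDerivAt (fun s : ℝ => x + s • w) w 0 := by
      simpa using ((hasDerivAt_id (0:ℝ)).smul_const w).const_add x
    have := h1.inner ℝ (hasDerivAt_const (0:ℝ) y)
    simpa using this
  have hm : IsLocalMin ((fun s : ℝ => F (x + s • w)) + fun s : ℝ => ⟪x + s • w, y⟫) 0 := by
    filter_upwards [line_mem_aux h.openC hx w] with t ht
    have h5 := P.lower Q h ht hy
    simp only [Pi.add_apply, zero_smul, add_zero]
    linarith
  have h5 := hm.hasDerivAt_eq_zero (d1.add d2)
  simp only [zero_smul, add_zero] at h5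
  rw [inner_neg_left, real_inner_comm w y]
  linarith

lemma Pot.gradient_u (P : Pot n C F g H) {x : Euc (n+1)} (hx : x ∈ C) :
    gradient (fun x => -((n + 1 : ℝ) / 2) * Real.exp (-2 * F x / (n + 1))) x =
      Real.exp (-2 * F x / (n + 1)) • g x := by
  have hn : (n:ℝ) + 1 ≠ 0 := by positivity
  apply HasGradientAt.gradient
  rw [hasGradientAt_iff_hasFDerivAt]
  have h1 := ((((P.grad x hx).const_mul (-2)).mul_const ((n:ℝ) + 1)⁻¹).exp).const_mul
    (-((n + 1 : ℝ) / 2))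
  refine (h1.congr_fderiv ?_)
  ext w
  simp
  field_simp

lemma Pot.final (P : Pot n C F g H) (Q : Pot n D G gG HG) (h : DualPair C D)
    {x : Euc (n+1)} (hx : x ∈ C) :
    -gradient (fun x => -((n + 1 : ℝ) / 2) * Real.exp (-2 * F x / (n + 1))) x ∈ D ∧
    -gradient (fun x => -((n + 1 : ℝ) / 2) * Real.exp (-2 * G x / (n + 1)))
      (-gradient (fun x => -((n + 1 : ℝ) / 2) * Real.exp (-2 * F x / (n + 1))) x) = x := by
  have hn : (n:ℝ) + 1 ≠ 0 := by positivity
  obtain ⟨hy, hFG, hg⟩ := Q.duality P h.symm hx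
  set c := Real.exp (-2 * F x / (n + 1)) with hc
  have hcp : 0 < c := Real.exp_pos _
  have e1 : -gradient (fun x => -((n + 1 : ℝ) / 2) * Real.exp (-2 * F x / (n + 1))) x =
      c • (-g x) := by
    rw [P.gradient_u hx, smul_neg]
  have hcy := h.symm.smul_mem hy hcp
  rw [e1]
  refine ⟨hcy, ?_⟩
  have e2 : G (c • (-g x)) = F x := by
    rw [Q.hom _ hy c hcp, hc, Real.log_exp]
    field_simp
    linarith
  rw [Q.gradient_u hcy, e2, Q.grad_hom hy hcp h.openD hcy, hg, ← hc, smul_smul,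
    mul_inv_cancel₀ hcp.ne', one_smul, neg_neg]

end Upper

/-- The graphs over `Ω` and over `Ω*` of minus the differentials of
`u_Ω = -((n+1)/2) e^{-2F_Ω/(n+1)}` and `u_{Ω*} = -((n+1)/2) e^{-2F_{Ω*}/(n+1)}` coincide. -/
theorem graphs_of_neg_du_coincide
    (n : ℕ) (Ω : Set (Euc (n + 1))) (hΩ : IsOpenProperConvexCone Ω)
    (F : Euc (n + 1) → ℝ) (hF : IsCanonicalPotential n Ω F)
    (Fd : Euc (n + 1) → ℝ) (hFd : IsCanonicalPotential n (openDualCone Ω) Fd)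
    (u ud : Euc (n + 1) → ℝ)
    (hu : u = fun x => -((n + 1 : ℝ) / 2) * Real.exp (-2 * F x / (n + 1)))
    (hud : ud = fun y => -((n + 1 : ℝ) / 2) * Real.exp (-2 * Fd y / (n + 1))) :
    (∀ x ∈ Ω, -gradient u x ∈ openDualCone Ω ∧ -gradient ud (-gradient u x) = x) ∧
    {p : Euc (n + 1) × Euc (n + 1) | ∃ x ∈ Ω, p = (x, -gradient u x)} =
      {p : Euc (n + 1) × Euc (n + 1) | ∃ y ∈ openDualCone Ω, p = (-gradient ud y, y)} := by
  subst hu hud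
  have h := dualPair_of_cone hΩ
  have P := pot_of_canonical h.openC hF
  have Q := pot_of_canonical h.openD hFd
  refine ⟨fun x hx => P.final Q h hx, ?_⟩
  ext p
  constructor
  · rintro ⟨x, hx, rfl⟩
    obtain ⟨h1, h2⟩ := P.final Q h hx
    exact ⟨_, h1, by rw [h2]⟩
  · rintro ⟨y, hy, rfl⟩
    obtain ⟨h1, h2⟩ := Q.final P h.symm hy
    exact ⟨_, h1, by rw [h2]⟩
end
end

section
/- Let Ω ⊆ ℝ^{n+1} be a nonempty proper open convex cone and let F be a canonical potential of Ω. Then for every x ∈ Ω and every v ∈ ℝ^{n+1}: (a) (D³F(x)[v,v,v])² ≤ 4·(D²F(x)[v,v])³, and (b) (DF(x)[v])² ≤ (n+1)·D²F(x)[v,v]. Consequently F is a 1-self-concordant barrier for Ω satisfying the parameter-(n+1) bound, i.e. F is an (n+1)-normal barrier for Ω in the sense of Nesterov–Nemirovskii. -/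
open scoped RealInnerProductSpace

noncomputable section

open Filter Topology Set

/-- `f` has value `a`, first derivative `b`, second derivative `c` at `0`. -/
def Jet2 {G : Type*} [NormedAddCommGroup G] [NormedSpace ℝ G] (f : ℝ → G) (a b c : G) : Prop :=
  f 0 = a ∧ ∃ f' : ℝ → G, (∀ᶠ s in 𝓝 (0:ℝ), HasDerivAt f (f' s) s) ∧ f' 0 = b ∧ HasDerivAt f' c 0

namespace Jet2

section
variable {G H : Type*} [NormedAddCommGroup G] [NormedSpace ℝ G]
  [NormedAddCommGroup H] [NormedSpace ℝ H]

theorem hasDerivAt {f : ℝ → G} {a b c : G} (h : Jet2 f a b c) : HasDerivAt f b 0 := by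
  obtain ⟨_, f', h1, h2, _⟩ := h
  rw [← h2]; exact h1.self_of_nhds

theorem continuousAt {f : ℝ → G} {a b c : G} (h : Jet2 f a b c) : ContinuousAt f 0 :=
  h.hasDerivAt.continuousAt

theorem congr {f : ℝ → G} {a b c a' b' c' : G} (h : Jet2 f a b c) (ha : a = a') (hb : b = b')
    (hc : c = c') : Jet2 f a' b' c' := by subst ha hb hc; exact h

theorem congr_fun {f g : ℝ → G} {a b c : G} (h : Jet2 f a b c) (hg : f =ᶠ[𝓝 0] g) :
    Jet2 g a b c := by
  obtain ⟨h0, f', h1, h2, h3⟩ := h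
  refine ⟨by rw [← h0]; exact hg.self_of_nhds.symm, f', ?_, h2, h3⟩
  filter_upwards [h1, hg.eventually_nhds] with s hs hgs
  exact hs.congr_of_eventuallyEq (EventuallyEq.symm hgs)

theorem unique {f : ℝ → G} {a b c a' b' c' : G} (h : Jet2 f a b c) (h' : Jet2 f a' b' c') :
    a = a' ∧ b = b' ∧ c = c' := by
  refine ⟨h.1.symm.trans h'.1, h.hasDerivAt.unique h'.hasDerivAt, ?_⟩
  obtain ⟨h0, f', h1, h2, h3⟩ := h
  obtain ⟨k0, g', k1, k2, k3⟩ := h'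
  refine h3.unique (k3.congr_of_eventuallyEq ?_)
  filter_upwards [h1, k1] with s hs ks
  exact hs.unique ks

theorem line (v w : G) : Jet2 (fun s : ℝ => v + s • w) v w 0 := by
  refine ⟨by simp, fun _ => w, Eventually.of_forall fun s => ?_, rfl, hasDerivAt_const _ _⟩
  simpa using ((hasDerivAt_id s).smul_const w).const_add v

theorem const (v : G) : Jet2 (fun _ : ℝ => v) v 0 0 :=
  ⟨rfl, fun _ => 0, Eventually.of_forall fun _ => hasDerivAt_const _ _, rfl, hasDerivAt_const _ _⟩

theorem add {f g : ℝ → G} {a b c a' b' c' : G} (h : Jet2 f a b c) (h' : Jet2 g a' b' c') :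
    Jet2 (fun s => f s + g s) (a + a') (b + b') (c + c') := by
  obtain ⟨h0, f', h1, h2, h3⟩ := h
  obtain ⟨k0, g', k1, k2, k3⟩ := h'
  refine ⟨by simp [h0, k0], fun s => f' s + g' s, ?_, by simp [h2, k2], h3.add k3⟩
  filter_upwards [h1, k1] with s hs ks using hs.add ks

theorem clm (L : G →L[ℝ] H) {f : ℝ → G} {a b c : G} (h : Jet2 f a b c) :
    Jet2 (fun s => L (f s)) (L a) (L b) (L c) := by
  obtain ⟨h0, f', h1, h2, h3⟩ := h
  refine ⟨by simp [h0], fun s => L (f' s), ?_, by simp [h2], L.hasFDerivAt.comp_hasDerivAt _ h3⟩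
  filter_upwards [h1] with s hs using L.hasFDerivAt.comp_hasDerivAt _ hs

theorem apply {A : ℝ → G →L[ℝ] H} {f : ℝ → G} {a b c : G} {a' b' c' : G →L[ℝ] H}
    (h' : Jet2 A a' b' c') (h : Jet2 f a b c) :
    Jet2 (fun s => A s (f s)) (a' a) (b' a + a' b) (c' a + (2:ℝ) • b' b + a' c) := by
  obtain ⟨h0, f', h1, h2, h3⟩ := h
  obtain ⟨k0, A', k1, k2, k3⟩ := h'
  refine ⟨by simp [h0, k0], fun s => A' s (f s) + A s (f' s), ?_, by simp [h0, k0, h2, k2], ?_⟩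
  · filter_upwards [h1, k1] with s hs ks using ks.clm_apply hs
  · have e1 := k3.clm_apply h1.self_of_nhds
    have e2 := k1.self_of_nhds.clm_apply h3
    convert! e1.add e2 using 1
    rw [h0, k0, h2, k2, two_smul]; abel

theorem mul {R : Type*} [NormedRing R] [NormedAlgebra ℝ R] {f g : ℝ → R} {a b c a' b' c' : R}
    (h : Jet2 f a b c) (h' : Jet2 g a' b' c') :
    Jet2 (fun s => f s * g s) (a * a') (b * a' + a * b') (c * a' + (2:ℝ) • (b * b') + a * c') := by
  obtain ⟨h0, f', h1, h2, h3⟩ := h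
  obtain ⟨k0, g', k1, k2, k3⟩ := h'
  refine ⟨by simp [h0, k0], fun s => f' s * g s + f s * g' s, ?_, by simp [h0, k0, h2, k2], ?_⟩
  · filter_upwards [h1, k1] with s hs ks using hs.mul ks
  · have e1 := h3.mul k1.self_of_nhds
    have e2 := h1.self_of_nhds.mul k3
    convert! e1.add e2 using 1
    rw [h0, k0, h2, k2, two_smul]; abel

theorem log {f : ℝ → ℝ} {a b c : ℝ} (h : Jet2 f a b c) (ha : a ≠ 0) :
    Jet2 (fun s => Real.log (f s)) (Real.log a) (b / a) (c / a - (b / a) ^ 2) := by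
  have hc := h.continuousAt
  obtain ⟨h0, f', h1, h2, h3⟩ := h
  have hne : ∀ᶠ s in 𝓝 (0:ℝ), f s ≠ 0 := hc.eventually_ne (by rw [h0]; exact ha)
  refine ⟨by simp [h0], fun s => f' s / f s, ?_, by simp [h0, h2], ?_⟩
  · filter_upwards [h1, hne] with s hs hn using hs.log hn
  · have := h3.div h1.self_of_nhds hne.self_of_nhds
    convert! this using 1
    rw [h0, h2]; field_simp

theorem isLocalMax {f : ℝ → ℝ} {a b c : ℝ} (h : Jet2 f a b c)
    (hm : ∀ᶠ s in 𝓝 (0:ℝ), f s ≤ f 0) : b = 0 ∧ c ≤ 0 := by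
  have hb : b = 0 := IsLocalMax.hasDerivAt_eq_zero (f := f) (a := 0) hm h.hasDerivAt
  refine ⟨hb, ?_⟩
  by_contra hcc
  push Not at hcc
  have hd := h.hasDerivAt
  have hc := h.continuousAt
  have hu := h
  obtain ⟨h0, f', h1, h2, h3⟩ := h
  have e1 : deriv f =ᶠ[𝓝 0] f' := by filter_upwards [h1] with s hs using hs.deriv
  have e2 : deriv (deriv f) 0 = c := by rw [e1.deriv_eq]; exact h3.deriv
  have hmin : IsLocalMin f 0 :=
    isLocalMin_of_deriv_deriv_pos (by rw [e2]; exact hcc) (by rw [hd.deriv, hb]) hc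
  have hconst : (fun _ : ℝ => f 0) =ᶠ[𝓝 0] f := by
    filter_upwards [hm, hmin] with s hs hs' using le_antisymm hs' hs
  have := hu.unique ((Jet2.const (f 0)).congr_fun hconst)
  linarith [this.2.2]

theorem of_fderiv {D : G → H} {D' : G → G →L[ℝ] H} {D'' : G →L[ℝ] G →L[ℝ] H} {x : G} (e : G)
    (h1 : ∀ᶠ z in 𝓝 x, HasFDerivAt D (D' z) z) (h2 : HasFDerivAt D' D'' x) :
    Jet2 (fun s : ℝ => D (x + s • e)) (D x) (D' x e) (D'' e e) := by
  have hl : ∀ s : ℝ, HasDerivAt (fun s : ℝ => x + s • e) e s := fun s => by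
    simpa using ((hasDerivAt_id s).smul_const e).const_add x
  have ht : Tendsto (fun s : ℝ => x + s • e) (𝓝 0) (𝓝 x) := by
    have := (hl 0).continuousAt.tendsto; simpa using this
  refine ⟨by simp, fun s => D' (x + s • e) e, ?_, by simp, ?_⟩
  · filter_upwards [ht.eventually h1] with s hs using hs.comp_hasDerivAt s (hl s)
  · have : HasDerivAt (fun s : ℝ => D' (x + s • e)) (D'' e) 0 := by
      have h2' : HasFDerivAt D' D'' (x + (0:ℝ) • e) := by simpa using h2
      exact h2'.comp_hasDerivAt 0 (hl 0)
    simpa using this.clm_apply (hasDerivAt_const (0:ℝ) e)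

end

end Jet2

theorem Jet2.ringInverse {R : Type*} [NormedRing R] [NormedAlgebra ℝ R] [CompleteSpace R]
    {f : ℝ → R} {b c : R} (h : Jet2 f 1 b c) :
    Jet2 (fun s => Ring.inverse (f s)) 1 (-b) ((2:ℝ) • (b * b) - c) := by
  have hc := h.continuousAt
  obtain ⟨h0, f', h1, h2, h3⟩ := h
  have key : ∀ s, IsUnit (f s) → HasDerivAt f (f' s) s →
      HasDerivAt (fun s => Ring.inverse (f s))
        (-(Ring.inverse (f s) * f' s * Ring.inverse (f s))) s := by
    intro s hu hs
    obtain ⟨u, hu⟩ := hu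
    have e1 := hasFDerivAt_ringInverse (𝕜 := ℝ) u
    rw [hu] at e1
    have e2 := e1.comp_hasDerivAt s hs
    rw [← hu, Ring.inverse_unit]
    convert! e2 using 1
  have hunit : ∀ᶠ s in 𝓝 (0:ℝ), IsUnit (f s) := by
    have : {x : R | IsUnit x} ∈ 𝓝 (f 0) := Units.isOpen.mem_nhds (by rw [h0]; exact isUnit_one)
    exact hc this
  refine ⟨by simp [h0], fun s => -(Ring.inverse (f s) * f' s * Ring.inverse (f s)), ?_, ?_, ?_⟩
  · filter_upwards [h1, hunit] with s hs hu using key s hu hs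
  · simp [h0, h2]
  · have k0 := key 0 hunit.self_of_nhds h1.self_of_nhds
    have := ((k0.mul h3).mul k0).neg
    convert! this using 1
    simp only [Pi.mul_apply, h0, h2, Ring.inverse_one, one_mul, mul_one, two_smul]
    noncomm_ring

theorem hasDerivAt_det {m : ℕ} (A : ℝ → Matrix (Fin m) (Fin m) ℝ) (A' : Matrix (Fin m) (Fin m) ℝ)
    (s : ℝ) (h : ∀ i j, HasDerivAt (fun s => A s i j) (A' i j) s) :
    HasDerivAt (fun s => (A s).det) ((A s).adjugate * A').trace s := by
  let f : ContinuousMultilinearMap ℝ (fun _ : Fin m => (Fin m → ℝ)) ℝ :=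
    ⟨(Matrix.detRowAlternating (R := ℝ) (n := Fin m)).toMultilinearMap, by
      show Continuous fun M : Fin m → Fin m → ℝ => Matrix.det (Matrix.of M)
      exact Continuous.matrix_det continuous_id⟩
  let B : ℝ → (Fin m → Fin m → ℝ) := fun s i j => A s i j
  have hB : HasDerivAt B (fun i j => A' i j) s :=
    hasDerivAt_pi.2 fun i => hasDerivAt_pi.2 fun j => h i j
  have := (f.hasFDerivAt (B s)).comp_hasDerivAt s hB
  convert! this using 1
  rw [ContinuousMultilinearMap.linearDeriv_apply, Matrix.trace_mul_comm, Matrix.trace]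
  refine Finset.sum_congr rfl fun i _ => ?_
  have e : f (Function.update (B s) i (A' i)) = ((A s).updateRow i (A' i)).det := rfl
  rw [show (fun j => A' i j) = A' i from rfl, e, ← Matrix.cramer_transpose_apply,
    Matrix.cramer_eq_adjugate_mulVec, ← Matrix.adjugate_transpose, Matrix.diag_apply,
    Matrix.mul_apply, Matrix.mulVec, dotProduct]
  refine Finset.sum_congr rfl fun j _ => ?_
  rw [Matrix.transpose_apply, mul_comm]

theorem logdet_jet {m : ℕ} (A A' : ℝ → Matrix (Fin m) (Fin m) ℝ) (u u' : ℝ → ℝ)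
    (M B D : Matrix (Fin m) (Fin m) ℝ) (κ p q r : ℝ)
    (hA : ∀ i j, ∀ᶠ s in 𝓝 (0:ℝ), HasDerivAt (fun s => A s i j) (A' s i j) s)
    (hA' : ∀ i j, Jet2 (fun s => A' s i j) (M i j) (B i j) (D i j))
    (hA0 : A 0 = 1)
    (hdet : ∀ᶠ s in 𝓝 (0:ℝ), (A s).det = κ * Real.exp (u s))
    (hu : ∀ᶠ s in 𝓝 (0:ℝ), HasDerivAt u (u' s) s)
    (hu' : Jet2 u' p q r) :
    M.trace = p ∧ B.trace - (M * M).trace = q ∧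
      D.trace - 3 * (M * B).trace + 2 * (M * M * M).trace = r := by
  let _ : NormedRing (Matrix (Fin m) (Fin m) ℝ) := Matrix.linftyOpNormedRing
  let _ : NormedAlgebra ℝ (Matrix (Fin m) (Fin m) ℝ) := Matrix.linftyOpNormedAlgebra
  have hcomp : CompleteSpace (Matrix (Fin m) (Fin m) ℝ) :=
    FiniteDimensional.complete ℝ (Matrix (Fin m) (Fin m) ℝ)
  have build : ∀ (X : ℝ → Matrix (Fin m) (Fin m) ℝ) (X' : Matrix (Fin m) (Fin m) ℝ) (s : ℝ),
      (∀ i j, HasDerivAt (fun s => X s i j) (X' i j) s) → HasDerivAt X X' s := by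
    intro X X' s h
    have e1 : X = fun s => ∑ i, ∑ j, X s i j • Matrix.single i j (1:ℝ) := by
      funext s
      conv_lhs => rw [Matrix.matrix_eq_sum_single (X s)]
      simp [Matrix.smul_single]
    have e2 : X' = ∑ i, ∑ j, X' i j • Matrix.single i j (1:ℝ) := by
      conv_lhs => rw [Matrix.matrix_eq_sum_single X']
      simp [Matrix.smul_single]
    rw [e1, e2]
    exact HasDerivAt.fun_sum fun i _ => HasDerivAt.fun_sum fun j _ => (h i j).smul_const _
  have hA2 : ∀ᶠ s in 𝓝 (0:ℝ), ∀ i j, HasDerivAt (fun s => A s i j) (A' s i j) s := by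
    simpa only [eventually_all] using hA
  -- the jet of the derivative
  have jA' : Jet2 A' M B D := by
    choose h0 f' h1 h2 h3 using hA'
    refine ⟨by ext i j; exact h0 i j, fun s => Matrix.of fun i j => f' i j s, ?_, ?_, ?_⟩
    · have : ∀ᶠ s in 𝓝 (0:ℝ), ∀ i j, HasDerivAt (fun s => A' s i j) (f' i j s) s := by
        simpa only [eventually_all] using h1
      filter_upwards [this] with s hs
      exact build _ _ _ hs
    · ext i j; exact h2 i j
    · exact build _ _ _ fun i j => h3 i j
  have jA : Jet2 A 1 M B := by
    refine ⟨hA0, A', ?_, jA'.1, ?_⟩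
    · filter_upwards [hA2] with s hs using build _ _ _ hs
    · exact jA'.hasDerivAt
  let tr : Matrix (Fin m) (Fin m) ℝ →L[ℝ] ℝ :=
    LinearMap.toContinuousLinearMap (Matrix.traceLinearMap (Fin m) ℝ ℝ)
  have J := (jA.ringInverse.mul jA').clm tr
  have hd0 : ∀ᶠ s in 𝓝 (0:ℝ), (A s).det ≠ 0 := by
    have hdd := hasDerivAt_det A (A' 0) 0 hA2.self_of_nhds
    refine hdd.continuousAt.eventually_ne ?_
    simp [hA0]
  have hfun : (fun s => tr (Ring.inverse (A s) * A' s)) =ᶠ[𝓝 0] u' := by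
    filter_upwards [hA2, hd0, hdet.eventually_nhds, hu] with s hs hn hd hus
    have e1 := hasDerivAt_det A (A' s) s hs
    have e2 : HasDerivAt (fun s => (A s).det) (κ * (Real.exp (u s) * u' s)) s :=
      ((hus.exp).const_mul κ).congr_of_eventuallyEq hd
    have e3 := e1.unique e2
    have e4 : (A s).det = κ * Real.exp (u s) := hd.self_of_nhds
    rw [← mul_assoc, ← e4] at e3
    show Matrix.trace (Ring.inverse (A s) * A' s) = u' s
    rw [← Matrix.nonsing_inv_eq_ringInverse, Matrix.inv_def, Matrix.smul_mul, Matrix.trace_smul, e3,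
      Ring.inverse_eq_inv', smul_eq_mul, inv_mul_cancel_left₀ hn]
  obtain ⟨r1, r2, r3⟩ := (J.congr_fun hfun).unique hu'
  replace r1 : Matrix.trace (1 * M) = p := r1
  replace r2 : Matrix.trace (-M * M + 1 * B) = q := r2
  replace r3 : Matrix.trace (((2:ℝ) • (M * M) - B) * M + (2:ℝ) • (-M * B) + 1 * D) = r := r3
  refine ⟨by simpa using r1, ?_, ?_⟩
  · rw [← r2]; simp [Matrix.trace_add]; ring
  · rw [← r3]
    simp only [Matrix.trace_add, Matrix.trace_smul, sub_mul, Matrix.trace_sub, Matrix.smul_mul, one_mul, neg_mul, Matrix.trace_neg, smul_eq_mul]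
    rw [Matrix.trace_mul_comm B M]
    ring

section diag
open Matrix

theorem exists_orth_diag {m : ℕ} (A : Matrix (Fin m) (Fin m) ℝ) (hA : A.IsHermitian) :
    ∃ U : Matrix (Fin m) (Fin m) ℝ, Uᵀ * U = 1 ∧ Uᵀ * A * U = diagonal hA.eigenvalues := by
  refine ⟨hA.eigenvectorUnitary, ?_, ?_⟩
  · have := Unitary.coe_star_mul_self hA.eigenvectorUnitary
    rwa [star_eq_conjTranspose, conjTranspose_eq_transpose_of_trivial] at this
  · have := hA.conjStarAlgAut_star_eigenvectorUnitary
    rw [Unitary.conjStarAlgAut_apply] at this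
    simpa [star_eq_conjTranspose, conjTranspose_eq_transpose_of_trivial] using this

theorem exists_simul_diag {m : ℕ} (G M : Matrix (Fin m) (Fin m) ℝ) (hG : G.PosDef)
    (hM : Mᵀ = M) :
    ∃ (P : Matrix (Fin m) (Fin m) ℝ) (μ : Fin m → ℝ), Pᵀ * G * P = 1 ∧ Pᵀ * M * P = diagonal μ := by
  obtain ⟨U, hU, hUG⟩ := exists_orth_diag G hG.1
  have hpos : ∀ i, 0 < hG.1.eigenvalues i := hG.eigenvalues_pos
  let d : Fin m → ℝ := fun i => (Real.sqrt (hG.1.eigenvalues i))⁻¹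
  let P0 := U * diagonal d
  have h0 : P0ᵀ * G * P0 = 1 := by
    have : P0ᵀ * G * P0 = diagonal d * (Uᵀ * G * U) * diagonal d := by
      simp only [P0, transpose_mul, diagonal_transpose, Matrix.mul_assoc]
    rw [this, hUG, diagonal_mul_diagonal, diagonal_mul_diagonal, ← diagonal_one]
    congr 1
    funext i
    have h1 := Real.sqrt_pos.2 (hpos i)
    have h2 := Real.mul_self_sqrt (hpos i).le
    simp only [d]
    field_simp
    nlinarith
  have hM' : (P0ᵀ * M * P0).IsHermitian := by
    rw [IsHermitian, conjTranspose_eq_transpose_of_trivial]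
    simp only [transpose_mul, transpose_transpose, hM, Matrix.mul_assoc]
  obtain ⟨V, hV, hVM⟩ := exists_orth_diag _ hM'
  refine ⟨P0 * V, hM'.eigenvalues, ?_, ?_⟩
  · have : (P0 * V)ᵀ * G * (P0 * V) = Vᵀ * (P0ᵀ * G * P0) * V := by
      simp only [transpose_mul, Matrix.mul_assoc]
    rw [this, h0, Matrix.mul_one, hV]
  · rw [← hVM]
    simp only [transpose_mul, Matrix.mul_assoc]

/-- matrix of a bilinear form -/
def bilMat {m : ℕ} (B : Euc m →L[ℝ] Euc m →L[ℝ] ℝ) : Matrix (Fin m) (Fin m) ℝ :=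
  fun i j => B (EuclideanSpace.single i 1) (EuclideanSpace.single j 1)

theorem euc_eq_sum {m : ℕ} (u : Euc m) : u = ∑ i, u i • EuclideanSpace.single i (1:ℝ) := by
  ext j
  simp [Finset.sum_apply, Pi.single_apply]

/-- columns of a matrix as vectors -/
def colVec {m : ℕ} (P : Matrix (Fin m) (Fin m) ℝ) (a : Fin m) : Euc m :=
  ∑ i, P i a • EuclideanSpace.single i (1:ℝ)

theorem bil_colVec {m : ℕ} (B : Euc m →L[ℝ] Euc m →L[ℝ] ℝ) (P : Matrix (Fin m) (Fin m) ℝ)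
    (a b : Fin m) : B (colVec P a) (colVec P b) = (Pᵀ * bilMat B * P) a b := by
  simp only [colVec, map_sum, map_smul, _root_.sum_apply,
    _root_.smul_apply, mul_apply, transpose_apply, smul_eq_mul, Finset.sum_mul,
    Finset.mul_sum, bilMat]
  refine Finset.sum_congr rfl fun i _ => Finset.sum_congr rfl fun j _ => by ring

theorem expand_colVec {m : ℕ} (B : Euc m →L[ℝ] Euc m →L[ℝ] ℝ) (P : Matrix (Fin m) (Fin m) ℝ)
    (h : Pᵀ * bilMat B * P = 1) (hs : ∀ u w, B u w = B w u) (u : Euc m) :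
    u = ∑ a, B u (colVec P a) • colVec P a := by
  have h' : P * (Pᵀ * bilMat B) = 1 := mul_eq_one_comm.1 h
  have e : ∀ a, B u (colVec P a) = ∑ j, (Pᵀ * bilMat B) a j * u j := by
    intro a
    rw [hs]
    conv_lhs => rw [euc_eq_sum u]
    simp only [colVec, map_sum, map_smul, _root_.sum_apply,
      _root_.smul_apply, mul_apply, transpose_apply, smul_eq_mul, Finset.sum_mul,
      Finset.mul_sum, bilMat]
    refine Finset.sum_congr rfl fun i _ => Finset.sum_congr rfl fun j _ => by ring
  have e2 : ∀ i, ∑ a, P i a * ∑ j, (Pᵀ * bilMat B) a j * u j = u i := by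
    intro i
    have := congrFun (congrArg (fun X => X *ᵥ (fun j => u j)) h') i
    rw [one_mulVec, ← mulVec_mulVec] at this
    exact this
  simp only [e]
  conv_lhs => rw [euc_eq_sum u]
  simp only [colVec, Finset.smul_sum, smul_smul]
  rw [Finset.sum_comm]
  refine Finset.sum_congr rfl fun i _ => ?_
  rw [← Finset.sum_smul, ← e2 i]
  congr 1
  refine Finset.sum_congr rfl fun a _ => by ring

end diag
set_option synthInstance.maxHeartbeats 400000
set_option maxHeartbeats 1000000

section tensorTypes
variable (m : ℕ)
abbrev T1 := Euc m →L[ℝ] ℝ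
instance : TopologicalSpace (T1 m) := inferInstance
instance : IsTopologicalAddGroup (T1 m) := inferInstance
instance : ContinuousConstSMul ℝ (T1 m) := inferInstance
instance : NormedAddCommGroup (T1 m) := inferInstance
instance : NormedSpace ℝ (T1 m) := inferInstance
abbrev T2 := Euc m →L[ℝ] T1 m
instance : TopologicalSpace (T2 m) := inferInstance
instance : IsTopologicalAddGroup (T2 m) := inferInstance
instance : ContinuousConstSMul ℝ (T2 m) := inferInstance
instance : NormedAddCommGroup (T2 m) := inferInstance
instance : NormedSpace ℝ (T2 m) := inferInstance
abbrev T3 := Euc m →L[ℝ] T2 m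
instance : TopologicalSpace (T3 m) := inferInstance
instance : IsTopologicalAddGroup (T3 m) := inferInstance
instance : ContinuousConstSMul ℝ (T3 m) := inferInstance
instance : NormedAddCommGroup (T3 m) := inferInstance
instance : NormedSpace ℝ (T3 m) := inferInstance
abbrev T4 := Euc m →L[ℝ] T3 m
instance : TopologicalSpace (T4 m) := inferInstance
instance : IsTopologicalAddGroup (T4 m) := inferInstance
instance : ContinuousConstSMul ℝ (T4 m) := inferInstance
instance : NormedAddCommGroup (T4 m) := inferInstance
instance : NormedSpace ℝ (T4 m) := inferInstance
abbrev T5 := Euc m →L[ℝ] T4 m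
instance : TopologicalSpace (T5 m) := inferInstance
instance : IsTopologicalAddGroup (T5 m) := inferInstance
instance : ContinuousConstSMul ℝ (T5 m) := inferInstance
instance : NormedAddCommGroup (T5 m) := inferInstance
instance : NormedSpace ℝ (T5 m) := inferInstance
end tensorTypes


section derivs
open scoped ContDiff

variable {m : ℕ} {Ω : Set (Euc m)}
variable {G : Type*} [NormedAddCommGroup G] [NormedSpace ℝ G]
variable {H : Type*} [NormedAddCommGroup H] [NormedSpace ℝ H]

def d1 (F : Euc m → ℝ) : Euc m → T1 m := fderiv ℝ F
def d2 (F : Euc m → ℝ) : Euc m → T2 m := fderiv ℝ (d1 F)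
def d3 (F : Euc m → ℝ) : Euc m → T3 m := fderiv ℝ (d2 F)
def d4 (F : Euc m → ℝ) : Euc m → T4 m := fderiv ℝ (d3 F)
def d5 (F : Euc m → ℝ) : Euc m → T5 m := fderiv ℝ (d4 F)

theorem smooth_fderiv {D : Euc m → G} (ho : IsOpen Ω) (h : ContDiffOn ℝ ∞ D Ω) :
    ContDiffOn ℝ ∞ (fderiv ℝ D) Ω :=
  h.fderiv_of_isOpen ho (by simp)

theorem smooth_hasFDerivAt {D : Euc m → G} (ho : IsOpen Ω) (h : ContDiffOn ℝ ∞ D Ω)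
    {x : Euc m} (hx : x ∈ Ω) : HasFDerivAt D (fderiv ℝ D x) x :=
  ((h.contDiffAt (ho.mem_nhds hx)).differentiableAt (by simp)).hasFDerivAt

theorem smooth_symm {D : Euc m → G} (ho : IsOpen Ω) (h : ContDiffOn ℝ ∞ D Ω)
    {x : Euc m} (hx : x ∈ Ω) (u w : Euc m) :
    fderiv ℝ (fderiv ℝ D) x u w = fderiv ℝ (fderiv ℝ D) x w u :=
  ((h.contDiffAt (ho.mem_nhds hx)).isSymmSndFDerivAt (by simp only [minSmoothness_of_isRCLikeNormedField]; exact WithTop.coe_le_coe.2 (le_top : (2 : ℕ∞) ≤ ⊤))) u w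

theorem tail_eq {D : Euc m → G} (ho : IsOpen Ω) (h : ContDiffOn ℝ ∞ D Ω)
    {x : Euc m} (hx : x ∈ Ω) (L₁ L₂ : G →L[ℝ] H) (hL : ∀ z ∈ Ω, L₁ (D z) = L₂ (D z)) (a : Euc m) :
    L₁ (fderiv ℝ D x a) = L₂ (fderiv ℝ D x a) := by
  have hd := smooth_hasFDerivAt ho h hx
  have h1 := L₁.hasFDerivAt.comp x hd
  have h2 := L₂.hasFDerivAt.comp x hd
  have he : (L₁ ∘ D) =ᶠ[𝓝 x] (L₂ ∘ D) := by
    filter_upwards [ho.mem_nhds hx] with z hz using hL z hz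
  have := h1.unique (h2.congr_of_eventuallyEq he)
  exact congrArg (fun T : Euc m →L[ℝ] H => T a) this

theorem jet_line {D : Euc m → G} (ho : IsOpen Ω) (h : ContDiffOn ℝ ∞ D Ω)
    {x : Euc m} (hx : x ∈ Ω) (e : Euc m) :
    Jet2 (fun s : ℝ => D (x + s • e)) (D x) (fderiv ℝ D x e) (fderiv ℝ (fderiv ℝ D) x e e) := by
  refine Jet2.of_fderiv e ?_ (smooth_hasFDerivAt ho (smooth_fderiv ho h) hx)
  filter_upwards [ho.mem_nhds hx] with z hz using smooth_hasFDerivAt ho h hz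

theorem scale_fderiv {D : Euc m → G} (ho : IsOpen Ω) (h : ContDiffOn ℝ ∞ D Ω)
    {r κ : ℝ} {k : G} (hr : 0 < r)
    (hD : ∀ z ∈ Ω, D (r • z) = κ • D z + k) {x : Euc m} (hx : x ∈ Ω) :
    fderiv ℝ D (r • x) = (r⁻¹ * κ) • fderiv ℝ D x := by
  have e1 : fderiv ℝ (fun z => D (r • z)) x = r • fderiv ℝ D (r • x) := fderiv_comp_smul r
  have hd := smooth_hasFDerivAt ho h hx
  have he : (fun z => D (r • z)) =ᶠ[𝓝 x] fun z => κ • D z + k := by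
    filter_upwards [ho.mem_nhds hx] with z hz using hD z hz
  have e2 : fderiv ℝ (fun z => D (r • z)) x = κ • fderiv ℝ D x := by
    rw [he.fderiv_eq]
    exact ((hd.const_smul κ).add_const k).fderiv
  rw [mul_smul, ← e2, e1, smul_smul, inv_mul_cancel₀ hr.ne', one_smul]


theorem smooth_d1 {F : Euc m → ℝ} (ho : IsOpen Ω) (hs : ContDiffOn ℝ ∞ F Ω) : ContDiffOn ℝ ∞ (d1 F) Ω := smooth_fderiv ho hs
theorem smooth_d2 {F : Euc m → ℝ} (ho : IsOpen Ω) (hs : ContDiffOn ℝ ∞ F Ω) : ContDiffOn ℝ ∞ (d2 F) Ω := smooth_fderiv ho (smooth_d1 ho hs)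
theorem smooth_d3 {F : Euc m → ℝ} (ho : IsOpen Ω) (hs : ContDiffOn ℝ ∞ F Ω) : ContDiffOn ℝ ∞ (d3 F) Ω := smooth_fderiv ho (smooth_d2 ho hs)
theorem smooth_d4 {F : Euc m → ℝ} (ho : IsOpen Ω) (hs : ContDiffOn ℝ ∞ F Ω) : ContDiffOn ℝ ∞ (d4 F) Ω := smooth_fderiv ho (smooth_d3 ho hs)


theorem d2_symm {F : Euc m → ℝ} (ho : IsOpen Ω) (hs : ContDiffOn ℝ ∞ F Ω)
    {x : Euc m} (hx : x ∈ Ω) (u w : Euc m) : d2 F x u w = d2 F x w u := smooth_symm ho hs hx u w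

theorem d3_12 {F : Euc m → ℝ} (ho : IsOpen Ω) (hs : ContDiffOn ℝ ∞ F Ω)
    {x : Euc m} (hx : x ∈ Ω) (u v w : Euc m) : d3 F x u v w = d3 F x v u w :=
  congrArg (fun T => T w) (smooth_symm ho (smooth_d1 ho hs) hx u v)

theorem d3_23 {F : Euc m → ℝ} (ho : IsOpen Ω) (hs : ContDiffOn ℝ ∞ F Ω)
    {x : Euc m} (hx : x ∈ Ω) (u v w : Euc m) : d3 F x u v w = d3 F x u w v :=
  tail_eq ho (smooth_d2 ho hs) hx
    ((ContinuousLinearMap.apply ℝ ℝ w).comp (ContinuousLinearMap.apply ℝ (T1 m) v))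
    ((ContinuousLinearMap.apply ℝ ℝ v).comp (ContinuousLinearMap.apply ℝ (T1 m) w))
    (fun _ hz => d2_symm ho hs hz v w) u

theorem d4_12 {F : Euc m → ℝ} (ho : IsOpen Ω) (hs : ContDiffOn ℝ ∞ F Ω)
    {x : Euc m} (hx : x ∈ Ω) (u v w t : Euc m) : d4 F x u v w t = d4 F x v u w t :=
  congrArg (fun T => T w t) (smooth_symm ho (smooth_d2 ho hs) hx u v)

theorem d4_23 {F : Euc m → ℝ} (ho : IsOpen Ω) (hs : ContDiffOn ℝ ∞ F Ω)
    {x : Euc m} (hx : x ∈ Ω) (u v w t : Euc m) : d4 F x u v w t = d4 F x u w v t :=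
  tail_eq ho (smooth_d3 ho hs) hx
    ((ContinuousLinearMap.apply ℝ ℝ t).comp ((ContinuousLinearMap.apply ℝ (T1 m) w).comp
      (ContinuousLinearMap.apply ℝ (T2 m) v)))
    ((ContinuousLinearMap.apply ℝ ℝ t).comp ((ContinuousLinearMap.apply ℝ (T1 m) v).comp
      (ContinuousLinearMap.apply ℝ (T2 m) w)))
    (fun _ hz => d3_12 ho hs hz v w t) u

theorem d4_34 {F : Euc m → ℝ} (ho : IsOpen Ω) (hs : ContDiffOn ℝ ∞ F Ω)
    {x : Euc m} (hx : x ∈ Ω) (u v w t : Euc m) : d4 F x u v w t = d4 F x u v t w :=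
  tail_eq ho (smooth_d3 ho hs) hx
    ((ContinuousLinearMap.apply ℝ ℝ t).comp ((ContinuousLinearMap.apply ℝ (T1 m) w).comp
      (ContinuousLinearMap.apply ℝ (T2 m) v)))
    ((ContinuousLinearMap.apply ℝ ℝ w).comp ((ContinuousLinearMap.apply ℝ (T1 m) t).comp
      (ContinuousLinearMap.apply ℝ (T2 m) v)))
    (fun _ hz => d3_23 ho hs hz v w t) u

/-- evaluation of a 4-linear form -/
def ev4 (a b c d : Euc m) : T4 m →L[ℝ] ℝ :=
  (ContinuousLinearMap.apply ℝ ℝ d).comp ((ContinuousLinearMap.apply ℝ (T1 m) c).comp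
    ((ContinuousLinearMap.apply ℝ (T2 m) b).comp
      (ContinuousLinearMap.apply ℝ (T3 m) a)))

theorem d5_12 {F : Euc m → ℝ} (ho : IsOpen Ω) (hs : ContDiffOn ℝ ∞ F Ω)
    {x : Euc m} (hx : x ∈ Ω) (a b c d e : Euc m) : d5 F x a b c d e = d5 F x b a c d e :=
  congrArg (fun T => T c d e) (smooth_symm ho (smooth_d3 ho hs) hx a b)

theorem d5_23 {F : Euc m → ℝ} (ho : IsOpen Ω) (hs : ContDiffOn ℝ ∞ F Ω)
    {x : Euc m} (hx : x ∈ Ω) (a b c d e : Euc m) : d5 F x a b c d e = d5 F x a c b d e :=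
  tail_eq ho (smooth_d4 ho hs) hx (ev4 b c d e) (ev4 c b d e)
    (fun _ hz => d4_12 ho hs hz b c d e) a

theorem d5_34 {F : Euc m → ℝ} (ho : IsOpen Ω) (hs : ContDiffOn ℝ ∞ F Ω)
    {x : Euc m} (hx : x ∈ Ω) (a b c d e : Euc m) : d5 F x a b c d e = d5 F x a b d c e :=
  tail_eq ho (smooth_d4 ho hs) hx (ev4 b c d e) (ev4 b d c e)
    (fun _ hz => d4_23 ho hs hz b c d e) a

theorem d5_45 {F : Euc m → ℝ} (ho : IsOpen Ω) (hs : ContDiffOn ℝ ∞ F Ω)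
    {x : Euc m} (hx : x ∈ Ω) (a b c d e : Euc m) : d5 F x a b c d e = d5 F x a b c e d :=
  tail_eq ho (smooth_d4 ho hs) hx (ev4 b c d e) (ev4 b c e d)
    (fun _ hz => d4_34 ho hs hz b c d e) a

theorem d4_aavv {F : Euc m → ℝ} (ho : IsOpen Ω) (hs : ContDiffOn ℝ ∞ F Ω)
    {x : Euc m} (hx : x ∈ Ω) (a v : Euc m) : d4 F x a a v v = d4 F x v v a a := by
  rw [d4_23 ho hs hx a a v v, d4_12 ho hs hx a v a v, d4_34 ho hs hx v a a v, d4_23 ho hs hx v a v a]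

theorem d5_aavvv {F : Euc m → ℝ} (ho : IsOpen Ω) (hs : ContDiffOn ℝ ∞ F Ω)
    {x : Euc m} (hx : x ∈ Ω) (a v : Euc m) : d5 F x a a v v v = d5 F x v v v a a := by
  rw [d5_23 ho hs hx a a v v v, d5_34 ho hs hx a v a v v, d5_45 ho hs hx a v v a v,
    d5_12 ho hs hx a v v v a, d5_23 ho hs hx v a v v a, d5_34 ho hs hx v v a v a]

end derivs
section setup
open scoped ContDiff Matrix
open Matrix

/-- Working package for canonical potentials. -/
structure CP {m : ℕ} (Ω : Set (Euc m)) (F : Euc m → ℝ) : Prop where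
  ho : IsOpen Ω
  hs : ContDiffOn ℝ ∞ F Ω
  pdm : ∀ x ∈ Ω, (bilMat (d2 F x)).PosDef
  det : ∀ x ∈ Ω, (bilMat (d2 F x)).det = Real.exp (2 * F x)
  cone : ∀ r : ℝ, 0 < r → ∀ x ∈ Ω, r • x ∈ Ω
  hom : ∀ r : ℝ, 0 < r → ∀ x ∈ Ω, F (r • x) = F x - m * Real.log r

theorem hess_eq {m : ℕ} (F : Euc m → ℝ) (x : Euc m) : hessMatrix F x = bilMat (d2 F x) := by
  ext i j
  simp only [hessMatrix, bilMat, iteratedFDeriv_two_apply]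
  rfl

theorem CP.mk' {n : ℕ} {Ω : Set (Euc (n+1))} {F : Euc (n+1) → ℝ} (hΩ : IsOpenProperConvexCone Ω)
    (hF : IsCanonicalPotential n Ω F) : CP Ω F := by
  obtain ⟨-, ho, -, hc, -⟩ := hΩ
  obtain ⟨h1, h2, h3, h4, -⟩ := hF
  refine ⟨ho, h1, ?_, ?_, ?_, ?_⟩
  · intro x hx; rw [← hess_eq]; exact h2 x hx
  · intro x hx; rw [← hess_eq]; exact h3 x hx
  · intro r hr x hx
    have := hc x hx (Real.log r)
    rwa [Real.exp_log hr] at this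
  · intro r hr x hx
    have := h4 x hx (Real.log r)
    rw [Real.exp_log hr] at this
    rw [this]; push_cast; ring

namespace CP
variable {m : ℕ} {Ω : Set (Euc m)} {F : Euc m → ℝ}

theorem symm2 (h : CP Ω F) {x : Euc m} (hx : x ∈ Ω) (u w : Euc m) : d2 F x u w = d2 F x w u :=
  d2_symm h.ho h.hs hx u w

theorem pd (h : CP Ω F) {x : Euc m} (hx : x ∈ Ω) {v : Euc m} (hv : v ≠ 0) :
    0 < d2 F x v v := by
  have h1 := (h.pdm x hx).dotProduct_mulVec_pos (x := fun i => v i) (by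
    intro h0; apply hv; ext i; exact congrFun h0 i)
  have e : d2 F x v v = star (fun i => v i) ⬝ᵥ (bilMat (d2 F x) *ᵥ (fun i => v i)) := by
    conv_lhs => rw [euc_eq_sum v]
    simp only [map_sum, map_smul, _root_.sum_apply, _root_.smul_apply, smul_eq_mul,
      Finset.mul_sum, bilMat, dotProduct, mulVec, Pi.star_apply, star_trivial]
    rw [Finset.sum_comm]
    refine Finset.sum_congr rfl fun i _ => Finset.sum_congr rfl fun j _ => ?_
    rw [h.symm2 hx]; ring
  rw [e]; exact h1

theorem nonneg (h : CP Ω F) {x : Euc m} (hx : x ∈ Ω) (v : Euc m) : 0 ≤ d2 F x v v := by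
  by_cases hv : v = 0
  · simp [hv]
  · exact (h.pd hx hv).le

/-- Cauchy-Schwarz -/
theorem cs (h : CP Ω F) {x : Euc m} (hx : x ∈ Ω) (u w : Euc m) :
    (d2 F x u w) ^ 2 ≤ d2 F x u u * d2 F x w w := by
  by_cases hw : w = 0
  · simp [hw]
  have hp := h.pd hx hw
  have := h.nonneg hx (d2 F x w w • u - d2 F x u w • w)
  simp only [map_sub, map_smul, _root_.sub_apply, _root_.smul_apply, smul_eq_mul, h.symm2 hx w u] at this
  have h2 : 0 ≤ d2 F x w w * (d2 F x u u * d2 F x w w - (d2 F x u w) ^ 2) := by nlinarith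
  have := nonneg_of_mul_nonneg_right h2 hp
  linarith

theorem hd0 (h : CP Ω F) {x : Euc m} (hx : x ∈ Ω) : HasFDerivAt F (d1 F x) x :=
  smooth_hasFDerivAt h.ho h.hs hx
theorem hd1 (h : CP Ω F) {x : Euc m} (hx : x ∈ Ω) : HasFDerivAt (d1 F) (d2 F x) x :=
  smooth_hasFDerivAt h.ho (smooth_d1 h.ho h.hs) hx
theorem hd2 (h : CP Ω F) {x : Euc m} (hx : x ∈ Ω) : HasFDerivAt (d2 F) (d3 F x) x :=
  smooth_hasFDerivAt h.ho (smooth_d2 h.ho h.hs) hx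
theorem hd3 (h : CP Ω F) {x : Euc m} (hx : x ∈ Ω) : HasFDerivAt (d3 F) (d4 F x) x :=
  smooth_hasFDerivAt h.ho (smooth_d3 h.ho h.hs) hx

theorem euler1 (h : CP Ω F) {x : Euc m} (hx : x ∈ Ω) : d1 F x x = -m := by
  have e1 : HasDerivAt (fun s : ℝ => F (s • x)) (d1 F x x) 1 := by
    have hh : HasFDerivAt F (d1 F x) ((1:ℝ) • x) := by rw [one_smul]; exact h.hd0 hx
    have := hh.comp_hasDerivAt (1:ℝ) ((hasDerivAt_id (1:ℝ)).smul_const x)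
    exact this.congr_deriv (by simp)
  have e2 : HasDerivAt (fun s : ℝ => F x - m * Real.log s) (-m) 1 := by
    have := ((Real.hasDerivAt_log one_ne_zero).const_mul (m:ℝ)).const_sub (F x)
    simpa using this
  refine e1.unique (e2.congr_of_eventuallyEq ?_)
  filter_upwards [lt_mem_nhds (zero_lt_one' ℝ)] with s hs using h.hom s hs x hx

theorem euler2 (h : CP Ω F) {x : Euc m} (hx : x ∈ Ω) (u : Euc m) : d2 F x u x = - d1 F x u := by
  have e1 : HasFDerivAt (fun z => d1 F z z) _ x := (h.hd1 hx).clm_apply (hasFDerivAt_id x)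
  have e2 : HasFDerivAt (fun z => d1 F z z) (0 : Euc m →L[ℝ] ℝ) x := by
    refine (hasFDerivAt_const (-(m:ℝ)) x).congr_of_eventuallyEq ?_
    filter_upwards [h.ho.mem_nhds hx] with z hz using h.euler1 hz
  have := congrArg (fun T : Euc m →L[ℝ] ℝ => T u) (e1.unique e2)
  simp at this
  linarith

theorem scale1 (h : CP Ω F) {r : ℝ} (hr : 0 < r) {x : Euc m} (hx : x ∈ Ω) :
    d1 F (r • x) = r⁻¹ • d1 F x := by
  have := scale_fderiv h.ho h.hs (κ := 1) (k := -(m * Real.log r)) hr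
    (fun z hz => by rw [h.hom r hr z hz]; simp; ring) hx
  rw [mul_one] at this
  exact this

theorem scale2 (h : CP Ω F) {r : ℝ} (hr : 0 < r) {x : Euc m} (hx : x ∈ Ω) :
    d2 F (r • x) = (r⁻¹ * r⁻¹) • d2 F x :=
  scale_fderiv h.ho (smooth_d1 h.ho h.hs) (κ := r⁻¹) (k := 0) hr
    (fun z hz => by rw [h.scale1 hr hz, add_zero]) hx

theorem scale3 (h : CP Ω F) {r : ℝ} (hr : 0 < r) {x : Euc m} (hx : x ∈ Ω) :
    d3 F (r • x) = (r⁻¹ * (r⁻¹ * r⁻¹)) • d3 F x :=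
  scale_fderiv h.ho (smooth_d2 h.ho h.hs) (κ := r⁻¹ * r⁻¹) (k := 0) hr
    (fun z hz => by rw [h.scale2 hr hz, add_zero]) hx

theorem line_mem (h : CP Ω F) {x : Euc m} (hx : x ∈ Ω) (v : Euc m) :
    ∀ᶠ s in 𝓝 (0:ℝ), x + s • v ∈ Ω := by
  have hc : ContinuousAt (fun s : ℝ => x + s • v) 0 := by fun_prop
  apply hc
  simpa using h.ho.mem_nhds hx

theorem frame (h : CP Ω F) {x : Euc m} (hx : x ∈ Ω) (v : Euc m) :
    ∃ (e : Fin m → Euc m) (μ : Fin m → ℝ),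
      (∀ a b, d2 F x (e a) (e b) = if a = b then 1 else 0) ∧
      (∀ a b, d3 F x v (e a) (e b) = if a = b then μ a else 0) ∧
      (∀ u, u = ∑ a, d2 F x u (e a) • e a) ∧
      (∑ a, μ a = 2 * d1 F x v) ∧
      (∑ a, d4 F x v v (e a) (e a) - ∑ a, μ a ^ 2 = 2 * d2 F x v v) ∧
      (∑ a, d5 F x v v v (e a) (e a) - 3 * ∑ a, μ a * d4 F x v v (e a) (e a)
        + 2 * ∑ a, μ a ^ 3 = 2 * d3 F x v v v) := by
  have hM : (bilMat (d3 F x v))ᵀ = bilMat (d3 F x v) := by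
    ext i j; exact d3_23 h.ho h.hs hx _ _ _
  obtain ⟨P, μ, hP, hPM⟩ := exists_simul_diag _ _ (h.pdm x hx) hM
  have mem := h.line_mem hx v
  have lin : ∀ s : ℝ, HasDerivAt (fun s : ℝ => x + s • v) v s := fun s => by
    simpa using ((hasDerivAt_id s).smul_const v).const_add x
  have key := logdet_jet (fun s => Pᵀ * bilMat (d2 F (x + s • v)) * P)
    (fun s => Pᵀ * bilMat (d3 F (x + s • v) v) * P)
    (fun s => 2 * F (x + s • v)) (fun s => 2 * d1 F (x + s • v) v)
    (Pᵀ * bilMat (d3 F x v) * P) (Pᵀ * bilMat (d4 F x v v) * P) (Pᵀ * bilMat (d5 F x v v v) * P)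
    (P.det * P.det) (2 * d1 F x v) (2 * d2 F x v v) (2 * d3 F x v v v)
    ?_ ?_ ?_ ?_ ?_ ?_
  · obtain ⟨k1, k2, k3⟩ := key
    rw [hPM] at k1 k2 k3
    refine ⟨colVec P, μ, ?_, ?_, ?_, ?_, ?_, ?_⟩
    · intro a b; rw [bil_colVec, hP, one_apply]
    · intro a b; rw [bil_colVec, hPM, diagonal_apply]
    · exact expand_colVec _ P hP (h.symm2 hx)
    · simpa [trace] using k1
    · simp only [bil_colVec]
      simpa [trace, diagonal_mul_diagonal, sq] using k2
    · simp only [bil_colVec]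
      simpa [trace, diagonal_mul_diagonal, diagonal_mul, pow_succ] using k3
  · intro i j
    filter_upwards [mem] with s hs
    simp only [← bil_colVec]
    have := (h.hd2 hs).comp_hasDerivAt s (lin s)
    exact (this.clm_apply (hasDerivAt_const s (colVec P i))).clm_apply
      (hasDerivAt_const s (colVec P j)) |>.congr_deriv (by simp)
  · intro i j
    simp only [← bil_colVec]
    have J := jet_line h.ho (smooth_d3 h.ho h.hs) hx v
    exact (((J.apply (Jet2.const v)).apply (Jet2.const (colVec P i))).apply
      (Jet2.const (colVec P j))).congr rfl (by simp; rfl) (by simp; rfl)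
  · simpa using hP
  · filter_upwards [mem] with s hs
    rw [det_mul, det_mul, det_transpose, h.det _ hs]; ring
  · filter_upwards [mem] with s hs
    exact ((h.hd0 hs).comp_hasDerivAt s (lin s)).const_mul 2
  · have J := jet_line h.ho (smooth_d1 h.ho h.hs) hx v
    exact ((J.apply (Jet2.const v)).clm ((2:ℝ) • ContinuousLinearMap.id ℝ ℝ)).congr
      (by simp) (by simp; rfl) (by simp; rfl)

end CP
end setup
section geometry
open scoped ContDiff

theorem closure_cone {m : ℕ} {Ω : Set (Euc m)} (hc : ∀ r : ℝ, 0 < r → ∀ x ∈ Ω, r • x ∈ Ω)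
    {r : ℝ} (hr : 0 < r) {x : Euc m} (hx : x ∈ closure Ω) : r • x ∈ closure Ω :=
  map_mem_closure (continuous_const_smul r) hx (fun z hz => hc r hr z hz)

theorem exists_functional {m : ℕ} {Ω : Set (Euc m)} (hne : Ω.Nonempty)
    (hconv : Convex ℝ Ω) (hc : ∀ r : ℝ, 0 < r → ∀ x ∈ Ω, r • x ∈ Ω)
    (hl : ¬ ∃ p v : Euc m, v ≠ 0 ∧ ∀ t : ℝ, p + t • v ∈ closure Ω) :
    ∃ L : Euc m →L[ℝ] ℝ, ∀ x ∈ closure Ω, x ≠ 0 → 0 < L x := by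
  have h0 : (0 : Euc m) ∈ closure Ω := by
    obtain ⟨y, hy⟩ := hne
    have ht : Tendsto (fun k : ℕ => (1 / ((k:ℝ) + 1)) • y) atTop (𝓝 0) := by
      simpa using (tendsto_one_div_add_atTop_nhds_zero_nat (𝕜 := ℝ)).smul_const y
    refine mem_closure_of_tendsto ht (Eventually.of_forall fun k => hc _ (by positivity) y hy)
  have pt : ∀ x ∈ closure Ω, x ≠ 0 →
      ∃ l : Euc m →L[ℝ] ℝ, (∀ b ∈ closure Ω, 0 ≤ l b) ∧ 0 < l x := by
    intro x hx hx0
    have hn : -x ∉ closure Ω := by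
      intro hn
      apply hl
      refine ⟨0, x, hx0, fun t => ?_⟩
      rw [zero_add]
      rcases lt_trichotomy t 0 with ht | ht | ht
      · have := closure_cone hc (neg_pos.2 ht) hn
        simpa using this
      · simpa [ht] using h0
      · exact closure_cone hc ht hx
    obtain ⟨l, u, hu1, hu2⟩ := geometric_hahn_banach_point_closed hconv.closure isClosed_closure hn
    have hu0 : u < 0 := by simpa using hu2 0 h0
    refine ⟨l, ?_, ?_⟩
    · intro b hb
      by_contra! hneg
      have hr : 0 < u / l b := div_pos_of_neg_of_neg hu0 hneg
      have := hu2 _ (closure_cone hc hr hb)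
      rw [map_smul, smul_eq_mul, div_mul_cancel₀ _ hneg.ne] at this
      exact lt_irrefl _ this
    · rw [map_neg] at hu1; linarith
  have hK : IsCompact (closure Ω ∩ Metric.sphere (0 : Euc m) 1) :=
    (isCompact_sphere _ _).inter_left isClosed_closure
  obtain ⟨L, -, hL⟩ : ∃ l : Euc m →L[ℝ] ℝ, (∀ b ∈ closure Ω, 0 ≤ l b) ∧
      ∀ x ∈ closure Ω ∩ Metric.sphere (0 : Euc m) 1, 0 < l x := by
    refine hK.induction_on (p := fun s => ∃ l : Euc m →L[ℝ] ℝ, (∀ b ∈ closure Ω, 0 ≤ l b) ∧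
      ∀ x ∈ s ∩ closure Ω, 0 < l x) ?_ ?_ ?_ ?_ |>.imp ?_
    · exact ⟨0, by simp, by simp⟩
    · rintro s t hst ⟨l, h1, h2⟩
      exact ⟨l, h1, fun x hx => h2 x ⟨hst hx.1, hx.2⟩⟩
    · rintro s t ⟨l, h1, h2⟩ ⟨l', h1', h2'⟩
      refine ⟨l + l', fun b hb => add_nonneg (h1 b hb) (h1' b hb), ?_⟩
      rintro x ⟨hx | hx, hx'⟩
      · exact add_pos_of_pos_of_nonneg (h2 x ⟨hx, hx'⟩) (h1' x hx')
      · exact add_pos_of_nonneg_of_pos (h1 x hx') (h2' x ⟨hx, hx'⟩)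
    · rintro x ⟨hx, hxs⟩
      obtain ⟨l, h1, h2⟩ := pt x hx (by rintro rfl; simp at hxs)
      refine ⟨{y | 0 < l y}, ?_, l, h1, fun y hy => hy.1⟩
      exact mem_nhdsWithin_of_mem_nhds ((isOpen_lt continuous_const l.continuous).mem_nhds h2)
    · rintro l ⟨h1, h2⟩
      exact ⟨h1, fun x hx => h2 x ⟨hx, hx.1⟩⟩
  refine ⟨L, fun x hx hx0 => ?_⟩
  have hp : 0 < ‖x‖ := norm_pos_iff.2 hx0
  have := hL (‖x‖⁻¹ • x) ⟨closure_cone hc (inv_pos.2 hp) hx, by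
    simp [norm_smul, hp.ne']⟩
  rw [map_smul, smul_eq_mul] at this
  exact (mul_pos_iff_of_pos_left (inv_pos.2 hp)).1 this

/-- normalised degree zero potential -/
def ff {m : ℕ} (F : Euc m → ℝ) (L : T1 m) (x : Euc m) : ℝ := F x + m * Real.log (L x)

structure CPL {m : ℕ} (Ω : Set (Euc m)) (F : Euc m → ℝ) (L : T1 m) : Prop extends CP Ω F where
  Lpos : ∀ x ∈ Ω, 0 < L x
  comp : ∀ c, IsCompact {x | x ∈ Ω ∧ ‖x‖ = 1 ∧ ff F L x ≤ c}

theorem exists_CPL {n : ℕ} {Ω : Set (Euc (n+1))} {F : Euc (n+1) → ℝ}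
    (hΩ : IsOpenProperConvexCone Ω) (hF : IsCanonicalPotential n Ω F) :
    ∃ L : T1 (n+1), CPL Ω F L := by
  have h := CP.mk' hΩ hF
  obtain ⟨hne, ho, hconv, -, hl⟩ := hΩ
  obtain ⟨L, hL⟩ := exists_functional hne hconv h.cone hl
  have h0 : (0 : Euc (n+1)) ∉ Ω := by
    intro h0
    have h1 := h.hom (Real.exp 1) (Real.exp_pos 1) 0 h0
    simp at h1
    linarith [(Nat.cast_nonneg n : (0:ℝ) ≤ n)]
  have hLp : ∀ x ∈ Ω, 0 < L x := fun x hx => hL x (subset_closure hx) (by rintro rfl; exact h0 hx)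
  refine ⟨L, h, hLp, fun c => ?_⟩
  apply IsSeqCompact.isCompact
  intro x hx
  obtain ⟨z, hz, φ, hφ, hlim⟩ := (isCompact_sphere (0 : Euc (n+1)) 1).isSeqCompact
    (x := x) (fun k => by simpa using (hx k).2.1)
  have hz1 : ‖z‖ = 1 := by simpa using hz
  have hz0 : z ≠ 0 := by rintro rfl; simp at hz1
  have hzc : z ∈ closure Ω := mem_closure_of_tendsto hlim (Eventually.of_forall fun k => (hx _).1)
  have hLz := hL z hzc hz0
  have hlog : Tendsto (fun k => ((n+1 : ℕ) : ℝ) * Real.log (L (x (φ k)))) atTop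
      (𝓝 (((n+1 : ℕ) : ℝ) * Real.log (L z))) :=
    (((L.continuous.tendsto z).comp hlim).log hLz.ne').const_mul _
  have hle : ∀ k, ff F L (x (φ k)) ≤ c := fun k => (hx (φ k)).2.2
  by_cases hzΩ : z ∈ Ω
  · refine ⟨z, ⟨hzΩ, hz1, ?_⟩, φ, hφ, hlim⟩
    have hFz : Tendsto (fun k => F (x (φ k))) atTop (𝓝 (F z)) :=
      ((h.hd0 hzΩ).continuousAt.tendsto).comp hlim
    exact le_of_tendsto (hFz.add hlog) (Eventually.of_forall hle)
  · exfalso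
    have hfr : z ∈ frontier Ω := by
      rw [frontier, ho.interior_eq]; exact ⟨hzc, hzΩ⟩
    have hb := hF.2.2.2.2 z hfr (x ∘ φ) (fun k => (hx _).1) hlim
    have := hb.atTop_add hlog
    obtain ⟨k, hk⟩ := (this.eventually_gt_atTop c).exists
    exact absurd (hle k) (not_le.2 hk)

namespace CPL
variable {m : ℕ} {Ω : Set (Euc m)} {F : Euc m → ℝ} {L : T1 m}

theorem ne_zero (h : CPL Ω F L) {x : Euc m} (hx : x ∈ Ω) : x ≠ 0 := by
  rintro rfl
  have := h.Lpos 0 hx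
  simp at this

theorem ff_smul (h : CPL Ω F L) {r : ℝ} (hr : 0 < r) {x : Euc m} (hx : x ∈ Ω) :
    ff F L (r • x) = ff F L x := by
  unfold ff
  rw [h.hom r hr x hx, map_smul, smul_eq_mul, Real.log_mul hr.ne' (h.Lpos x hx).ne']
  ring

theorem ff_cont (h : CPL Ω F L) : ContinuousOn (ff F L) Ω := by
  unfold ff
  refine h.hs.continuousOn.add (continuousOn_const.mul ?_)
  exact L.continuous.continuousOn.log fun x hx => (h.Lpos x hx).ne'

theorem ff_lower (h : CPL Ω F L) : ∃ b, ∀ x ∈ Ω, b ≤ ff F L x := by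
  by_cases hne : Ω.Nonempty
  swap
  · exact ⟨0, fun x hx => (hne ⟨x, hx⟩).elim⟩
  have nrm : ∀ x ∈ Ω, ‖x‖⁻¹ • x ∈ Ω ∧ ‖‖x‖⁻¹ • x‖ = 1 ∧ ff F L (‖x‖⁻¹ • x) = ff F L x := by
    intro x hx
    have hp : 0 < ‖x‖ := norm_pos_iff.2 (h.ne_zero hx)
    exact ⟨h.cone _ (inv_pos.2 hp) x hx, by simp [norm_smul, hp.ne'], h.ff_smul (inv_pos.2 hp) hx⟩
  obtain ⟨x0, hx0⟩ := hne
  obtain ⟨a1, a2, a3⟩ := nrm x0 hx0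
  obtain ⟨z, hz, hmin⟩ := (h.comp (ff F L x0)).exists_isMinOn ⟨_, a1, a2, a3.le⟩
    (h.ff_cont.mono fun x hx => hx.1)
  refine ⟨ff F L z, fun x hx => ?_⟩
  obtain ⟨b1, b2, b3⟩ := nrm x hx
  by_cases hle : ff F L x ≤ ff F L x0
  · rw [← b3]
    exact hmin ⟨b1, b2, b3.le.trans hle⟩
  · exact hz.2.2.trans (not_le.1 hle).le

theorem maxpt (h : CPL Ω F L) (R : Euc m → Euc m → ℝ)
    (hRc : ContinuousOn (fun p : Euc m × Euc m => R p.1 p.2) {p | p.1 ∈ Ω ∧ p.2 ≠ 0})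
    (hR0 : ∀ r : ℝ, 0 < r → ∀ x ∈ Ω, ∀ v, R (r • x) v = R x v)
    (hR1 : ∀ r : ℝ, r ≠ 0 → ∀ x ∈ Ω, ∀ v, R x (r • v) = R x v)
    {k : ℕ} (hk : k ≠ 0) {c : ℝ} {x0 v0 : Euc m} (hx0 : x0 ∈ Ω) (hv0 : v0 ≠ 0)
    (hc : ff F L x0 < c) (hpos : 0 < R x0 v0) :
    ∃ x ∈ Ω, ∃ v, v ≠ 0 ∧ d2 F x v v = 1 ∧ ff F L x < c ∧ 0 < R x v ∧
      R x0 v0 * (c - ff F L x0) ^ k ≤ R x v * (c - ff F L x) ^ k ∧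
      ∀ e w : Euc m, ∀ᶠ s in 𝓝 (0:ℝ), x + s • e ∈ Ω ∧ v + s • w ≠ 0 ∧ ff F L (x + s • e) < c ∧
        R (x + s • e) (v + s • w) * (c - ff F L (x + s • e)) ^ k ≤ R x v * (c - ff F L x) ^ k := by
  have nrm : ∀ x ∈ Ω, ‖x‖⁻¹ • x ∈ Ω ∧ ‖‖x‖⁻¹ • x‖ = 1 ∧ ff F L (‖x‖⁻¹ • x) = ff F L x := by
    intro x hx
    have hp : 0 < ‖x‖ := norm_pos_iff.2 (h.ne_zero hx)
    exact ⟨h.cone _ (inv_pos.2 hp) x hx, by simp [norm_smul, hp.ne'], h.ff_smul (inv_pos.2 hp) hx⟩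
  have nrmv : ∀ v : Euc m, v ≠ 0 → ‖‖v‖⁻¹ • v‖ = 1 := by
    intro v hv
    simp [norm_smul, hv]
  set K := {x | x ∈ Ω ∧ ‖x‖ = 1 ∧ ff F L x ≤ c} ×ˢ Metric.sphere (0 : Euc m) 1 with hKdef
  have hK : IsCompact K := (h.comp c).prod (isCompact_sphere _ _)
  have inK : ∀ x ∈ Ω, ∀ v : Euc m, v ≠ 0 → ff F L x < c → (‖x‖⁻¹ • x, ‖v‖⁻¹ • v) ∈ K := by
    intro x hx v hv hf
    obtain ⟨b1, b2, b3⟩ := nrm x hx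
    exact ⟨⟨b1, b2, b3.le.trans hf.le⟩, by simpa using nrmv v hv⟩
  have hsub : K ⊆ {p | p.1 ∈ Ω ∧ p.2 ≠ 0} := by
    rintro ⟨x, v⟩ ⟨hx, hv⟩
    refine ⟨hx.1, ?_⟩
    rintro h0
    simp only at h0 hv
    simp [h0] at hv
  have hcont : ContinuousOn (fun p : Euc m × Euc m => R p.1 p.2 * (c - ff F L p.1) ^ k) K := by
    refine (hRc.mono hsub).mul (ContinuousOn.pow (continuousOn_const.sub ?_) k)
    exact h.ff_cont.comp continuousOn_fst fun p hp => hp.1.1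
  obtain ⟨⟨x, v1⟩, hmem, hmax⟩ := hK.exists_isMaxOn ⟨_, inK x0 hx0 v0 hv0 hc⟩ hcont
  have hx : x ∈ Ω := hmem.1.1
  have hv1 : v1 ≠ 0 := (hsub hmem).2
  have all : ∀ x' ∈ Ω, ∀ v' : Euc m, v' ≠ 0 → ff F L x' < c →
      R x' v' * (c - ff F L x') ^ k ≤ R x v1 * (c - ff F L x) ^ k := by
    intro x' hx' v' hv' hf'
    have := hmax (inK x' hx' v' hv' hf')
    simp only [mem_ofPred_eq] at this
    rwa [(nrm x' hx').2.2, hR0 _ (inv_pos.2 (norm_pos_iff.2 (h.ne_zero hx'))) x' hx',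
      hR1 _ (inv_ne_zero (norm_ne_zero_iff.2 hv')) x' hx'] at this
  have hval := all x0 hx0 v0 hv0 hc
  have hvp : 0 < R x v1 * (c - ff F L x) ^ k :=
    lt_of_lt_of_le (mul_pos hpos (pow_pos (sub_pos.2 hc) k)) hval
  have hle : ff F L x ≤ c := hmem.1.2.2
  have hlt : ff F L x < c := by
    refine lt_of_le_of_ne hle fun he => ?_
    rw [he] at hvp
    simp [hk] at hvp
  have hRp : 0 < R x v1 := (mul_pos_iff_of_pos_right (pow_pos (sub_pos.2 hlt) k)).1 hvp
  have hg := h.toCP.pd hx hv1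
  set q := (Real.sqrt (d2 F x v1 v1))⁻¹ with hq
  have hqp : 0 < q := inv_pos.2 (Real.sqrt_pos.2 hg)
  have hqv : q • v1 ≠ 0 := smul_ne_zero hqp.ne' hv1
  refine ⟨x, hx, q • v1, hqv, ?_, hlt, ?_, ?_, ?_⟩
  · simp only [map_smul, _root_.smul_apply, smul_eq_mul]
    have hsq := Real.mul_self_sqrt hg.le
    rw [hq]
    have := (Real.sqrt_pos.2 hg).ne'
    field_simp
    rw [sq, hsq]
  · rwa [hR1 q hqp.ne' x hx]
  · rwa [hR1 q hqp.ne' x hx]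
  · intro e w
    rw [hR1 q hqp.ne' x hx]
    have m1 := h.toCP.line_mem hx e
    have m2 : ∀ᶠ s in 𝓝 (0:ℝ), q • v1 + s • w ≠ 0 := by
      have hc : ContinuousAt (fun s : ℝ => q • v1 + s • w) 0 := by fun_prop
      exact hc.eventually_ne (by simpa using hqv)
    have m3 : ∀ᶠ s in 𝓝 (0:ℝ), ff F L (x + s • e) < c := by
      have hc1 : ContinuousAt (ff F L) x := h.ff_cont.continuousAt (h.ho.mem_nhds hx)
      have hc : ContinuousAt (fun s : ℝ => x + s • e) 0 := by fun_prop
      have hc2 : ContinuousAt (fun s : ℝ => ff F L (x + s • e)) 0 := by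
        apply ContinuousAt.comp (f := fun s : ℝ => x + s • e) (g := ff F L) _ hc
        simpa using hc1
      exact hc2.eventually_lt_const (by simpa using hlt)
    filter_upwards [m1, m2, m3] with s h1 h2 h3
    exact ⟨h1, h2, h3, all _ h1 _ h2 h3⟩

end CPL

theorem limit_lemma {A B a b : ℝ} (k : ℕ) {c0 : ℝ}
    (h : ∀ c > c0, A * (c - a) ^ k ≤ B * (c + b) ^ k) : A ≤ B := by
  have t1 : ∀ d : ℝ, Tendsto (fun c : ℝ => ((c + d) / c) ^ k) atTop (𝓝 1) := by
    intro d
    have : Tendsto (fun c : ℝ => 1 + d * c⁻¹) atTop (𝓝 1) := by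
      simpa using (tendsto_inv_atTop_zero.const_mul d).const_add (1:ℝ)
    have h2 : Tendsto (fun c : ℝ => ((c + d) / c)) atTop (𝓝 1) := by
      refine this.congr' ?_
      filter_upwards [eventually_gt_atTop 0] with c hc
      field_simp
    simpa using h2.pow k
  refine le_of_tendsto_of_tendsto (by simpa using (t1 (-a)).const_mul A)
    (by simpa using (t1 b).const_mul B) ?_
  filter_upwards [eventually_gt_atTop 0, eventually_gt_atTop c0] with c hc hc0
  have := h c hc0
  rw [div_pow, div_pow, ← mul_div_assoc, ← mul_div_assoc]
  rw [sub_eq_add_neg] at this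
  gcongr

end geometry
section jets
open scoped ContDiff

namespace CP
variable {m : ℕ} {Ω : Set (Euc m)} {F : Euc m → ℝ}

theorem jet_h (h : CP Ω F) {x : Euc m} (hx : x ∈ Ω) (v e w : Euc m) :
    Jet2 (fun s : ℝ => d2 F (x + s • e) (v + s • w) (v + s • w)) (d2 F x v v)
      (d3 F x e v v + 2 * d2 F x v w)
      (d4 F x e e v v + 4 * d3 F x e v w + 2 * d2 F x w w) := by
  have J := jet_line h.ho (smooth_d2 h.ho h.hs) hx e
  have K := (J.apply (Jet2.line v w)).apply (Jet2.line v w)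
  refine K.congr rfl ?_ ?_
  · have e1 := h.symm2 hx w v
    change (d3 F x e v + d2 F x w) v + d2 F x v w = _
    simp only [_root_.add_apply]
    rw [e1]; ring
  · have e1 := d3_23 h.ho h.hs hx e w v
    change (d4 F x e e v + (2:ℝ) • d3 F x e w + d2 F x 0) v + (2:ℝ) • (d3 F x e v + d2 F x w) w
      + d2 F x v 0 = _
    simp only [_root_.add_apply, _root_.smul_apply, map_zero, _root_.zero_apply, smul_eq_mul]
    rw [e1]; ring

theorem jet_c (h : CP Ω F) {x : Euc m} (hx : x ∈ Ω) (v e w : Euc m) :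
    Jet2 (fun s : ℝ => d3 F (x + s • e) (v + s • w) (v + s • w) (v + s • w)) (d3 F x v v v)
      (d4 F x e v v v + 3 * d3 F x v v w)
      (d5 F x e e v v v + 6 * d4 F x e v v w + 6 * d3 F x v w w) := by
  have J := jet_line h.ho (smooth_d3 h.ho h.hs) hx e
  have K := ((J.apply (Jet2.line v w)).apply (Jet2.line v w)).apply (Jet2.line v w)
  have s23 := d3_23 h.ho h.hs hx
  have s12 := d3_12 h.ho h.hs hx
  refine K.congr rfl ?_ ?_
  · change ((d4 F x e v + d3 F x w) v + d3 F x v w) v + d3 F x v v w = _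
    simp only [_root_.add_apply]
    rw [s12 w v v, s23 v w v]; ring
  · change ((d5 F x e e v + (2:ℝ) • d4 F x e w + d3 F x 0) v + (2:ℝ) • (d4 F x e v + d3 F x w) w
      + d3 F x v 0) v + (2:ℝ) • ((d4 F x e v + d3 F x w) v + d3 F x v w) w + d3 F x v v 0 = _
    simp only [_root_.add_apply, _root_.smul_apply, map_zero, _root_.zero_apply, smul_eq_mul]
    rw [d4_23 h.ho h.hs hx e w v v, d4_34 h.ho h.hs hx e v w v, s12 w v w, s23 w w v, s12 w v w]
    ring

theorem frame2 (h : CP Ω F) {x : Euc m} (hx : x ∈ Ω) {v : Euc m} (hv : d2 F x v v = 1) :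
    ∃ (e : Fin m → Euc m) (μ H C' C'' : Fin m → ℝ),
      (∀ a b, d2 F x (e a) (e b) = if a = b then 1 else 0) ∧
      (∀ u, u = ∑ a, d2 F x u (e a) • e a) ∧
      (∀ a, d3 F x v (e a) (e a) = μ a) ∧
      (∀ a, d3 F x v v (e a) = μ a * d2 F x v (e a)) ∧
      (∑ a, μ a = 2 * d1 F x v) ∧
      (∀ a, Jet2 (fun s : ℝ => d2 F (x + s • e a) (v + s • (-(1/2) * μ a) • e a)
        (v + s • (-(1/2) * μ a) • e a)) 1 0 (H a)) ∧
      (∑ a, H a = 2 - (1/2) * ∑ a, μ a ^ 2) ∧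
      (∀ a, Jet2 (fun s : ℝ => d3 F (x + s • e a) (v + s • (-(1/2) * μ a) • e a)
        (v + s • (-(1/2) * μ a) • e a) (v + s • (-(1/2) * μ a) • e a))
        (d3 F x v v v) (C' a) (C'' a)) ∧
      (∑ a, C'' a = 2 * d3 F x v v v - (1/2) * ∑ a, μ a ^ 3) := by
  obtain ⟨e, μ, h1, h2, h3, h4, h5, h6⟩ := h.frame hx v
  have s23 := d3_23 h.ho h.hs hx
  have s12 := d3_12 h.ho h.hs hx
  have hμv : ∀ a, d3 F x v v (e a) = μ a * d2 F x v (e a) := by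
    intro a
    rw [s23]
    refine (congrArg (d3 F x v (e a)) (h3 v)).trans ?_
    simp only [map_sum, map_smul, smul_eq_mul, h2]
    simp [mul_comm]
  refine ⟨e, μ, fun a => d4 F x v v (e a) (e a) - (3/2) * μ a ^ 2,
    fun a => d4 F x (e a) v v v + 3 * d3 F x v v ((-(1/2) * μ a) • e a),
    fun a => d5 F x v v v (e a) (e a) - 3 * (μ a * d4 F x v v (e a) (e a)) + (3/2) * μ a ^ 3,
    h1, h3, fun a => by simp [h2], hμv, h4, ?_, ?_, ?_, ?_⟩
  · intro a
    refine (h.jet_h hx v (e a) ((-(1/2) * μ a) • e a)).congr hv ?_ ?_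
    · rw [s12, s23, hμv, map_smul, smul_eq_mul]; ring
    · rw [d4_aavv h.ho h.hs hx, s12]
      simp only [map_smul, smul_eq_mul, _root_.smul_apply, h1, h2, if_true]
      ring
  · rw [Finset.sum_sub_distrib, ← Finset.mul_sum]
    rw [hv] at h5
    linarith
  · intro a
    refine (h.jet_c hx v (e a) ((-(1/2) * μ a) • e a)).congr rfl rfl ?_
    rw [d5_aavvv h.ho h.hs hx]
    have : d4 F x (e a) v v (e a) = d4 F x v v (e a) (e a) := by
      rw [d4_12 h.ho h.hs hx, d4_23 h.ho h.hs hx]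
    simp only [map_smul, smul_eq_mul, _root_.smul_apply, h2, if_true, this]
    ring
  · rw [Finset.sum_add_distrib, Finset.sum_sub_distrib, ← Finset.mul_sum, ← Finset.mul_sum]
    linarith

end CP

theorem jet_f {m : ℕ} {Ω : Set (Euc m)} {F : Euc m → ℝ} {L : T1 m} (h : CPL Ω F L) {x : Euc m}
    (hx : x ∈ Ω) (e : Euc m) :
    Jet2 (fun s : ℝ => ff F L (x + s • e)) (ff F L x) (d1 F x e + m * (L e / L x))
      (d2 F x e e - m * (L e / L x) ^ 2) := by
  have J := jet_line h.ho h.hs hx e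
  have K := (((Jet2.line x e).clm L).log (h.Lpos x hx).ne').clm ((m:ℝ) • ContinuousLinearMap.id ℝ ℝ)
  refine (J.add K).congr ?_ ?_ ?_
  · simp [ff]
  · simp [d1]
  · change fderiv ℝ (fderiv ℝ F) x e e + (m:ℝ) • (L 0 / L x - (L e / L x) ^ 2) = d2 F x e e - m * (L e / L x) ^ 2
    simp only [map_zero, zero_div, smul_eq_mul]
    change d2 F x e e + _ = _
    ring

theorem jet_t {f : ℝ → ℝ} {a b d c : ℝ} (h : Jet2 f a b d) (hc : a < c) :
    Jet2 (fun s => Real.log (c - f s)) (Real.log (c - a)) (-b / (c - a))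
      (-d / (c - a) - (b / (c - a)) ^ 2) := by
  have K := (Jet2.const c).add (h.clm ((-1:ℝ) • ContinuousLinearMap.id ℝ ℝ))
  have K2 : Jet2 (fun s => c - f s) (c - a) (-b) (-d) := by
    refine (K.congr (by simp; ring) (by simp) (by simp)).congr_fun ?_
    exact Eventually.of_forall fun s => by simp; ring
  refine (K2.log (sub_pos.2 hc).ne').congr rfl rfl ?_
  ring

/-- linear combination helper -/
theorem Jet2.smulR {f : ℝ → ℝ} {a b c : ℝ} (k : ℝ) (h : Jet2 f a b c) :
    Jet2 (fun s => k * f s) (k * a) (k * b) (k * c) := by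
  refine ((h.clm (k • ContinuousLinearMap.id ℝ ℝ)).congr (by simp) (by simp) (by simp)).congr_fun ?_
  exact Eventually.of_forall fun s => by simp

end jets

section algebra

theorem alg1 {N : ℕ} (hN : 1 ≤ N) (μ v x : Fin N → ℝ) (r φ : ℝ) (hr : r ≠ 0) (hφ : 0 < φ)
    (hv : ∑ a, v a ^ 2 = 1) (hx : ∑ a, x a ^ 2 = N) (hvx : ∑ a, v a * x a = r⁻¹)
    (hμ : ∑ a, μ a = -2 * r⁻¹)
    (h1 : ∀ a, -μ a * v a - 2 * r * v a = φ * (-x a + N * r * v a))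
    (h2 : (1/2) * ∑ a, μ a ^ 2 * (1 - v a ^ 2) - 2 + 2 * r ^ 2 + φ * N * (r ^ 2 - 1)
      - φ ^ 2 / (4 * N) * (N ^ 2 * r ^ 2 - N) ≤ 0) : r ^ 2 ≤ 1 := by
  have hr2 : 0 < r ^ 2 := by positivity
  rcases Nat.lt_or_ge 1 N with hN2 | hN1
  swap
  · obtain rfl : N = 1 := le_antisymm hN1 hN
    simp only [Fin.sum_univ_one, Nat.cast_one] at hv hx hvx
    have : (v 0 * x 0) ^ 2 = 1 := by rw [mul_pow, hv, hx, one_mul]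
    rw [hvx, inv_pow, inv_eq_one] at this
    exact this.le
  by_contra! hs
  have hNr : (2:ℝ) ≤ N := by exact_mod_cast hN2
  have hv1 : ∀ a, 0 ≤ 1 - v a ^ 2 := by
    intro a
    have := Finset.single_le_sum (f := fun a => v a ^ 2) (fun i _ => sq_nonneg _) (Finset.mem_univ a)
    simp only [hv] at this
    linarith
  have cs := Finset.sum_sq_le_sum_mul_sum_of_sq_le_mul Finset.univ
    (r := fun a => μ a * (1 - v a ^ 2)) (f := fun a => μ a ^ 2 * (1 - v a ^ 2))
    (g := fun a => 1 - v a ^ 2) (fun a _ => mul_nonneg (sq_nonneg _) (hv1 a)) (fun a _ => hv1 a)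
    (fun a _ => le_of_eq (by ring))
  have hsum : ∑ a, (1 - v a ^ 2) = (N:ℝ) - 1 := by
    rw [Finset.sum_sub_distrib, hv]; simp
  set A := ∑ a, μ a * v a ^ 2 with hA
  have hA1 : ∑ a, μ a * (1 - v a ^ 2) = -2 * r⁻¹ - A := by
    rw [← hμ, hA, ← Finset.sum_sub_distrib]
    exact Finset.sum_congr rfl fun a _ => by ring
  have hA2 : -A - 2 * r = φ * (-r⁻¹ + N * r) := by
    have : ∑ a, (-μ a * v a - 2 * r * v a) * v a = ∑ a, φ * (-x a + N * r * v a) * v a :=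
      Finset.sum_congr rfl fun a _ => by rw [h1]
    have e1 : ∑ a, (-μ a * v a - 2 * r * v a) * v a = -A - 2 * r * ∑ a, v a ^ 2 := by
      rw [hA, Finset.mul_sum, ← Finset.sum_neg_distrib, ← Finset.sum_sub_distrib]
      exact Finset.sum_congr rfl fun a _ => by ring
    have e2 : ∑ a, φ * (-x a + N * r * v a) * v a
        = φ * (-∑ a, v a * x a + N * r * ∑ a, v a ^ 2) := by
      rw [Finset.mul_sum, ← Finset.sum_neg_distrib, ← Finset.sum_add_distrib, Finset.mul_sum]
      exact Finset.sum_congr rfl fun a _ => by ring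
    rw [e1, e2, hv, hvx] at this
    linarith
  rw [hA1, hsum] at cs
  set S := ∑ a, μ a ^ 2 * (1 - v a ^ 2) with hS
  have e3 : r * (-2 * r⁻¹ - A) = 2 * (r ^ 2 - 1) + φ * (N * r ^ 2 - 1) := by
    have : r * (-A - 2 * r) = φ * (-(r * r⁻¹) + N * r ^ 2) := by rw [hA2]; ring
    rw [mul_inv_cancel₀ hr] at this
    have h3 : r * (-2 * r⁻¹ - A) = -2 * (r * r⁻¹) - r * A := by ring
    rw [h3, mul_inv_cancel₀ hr]
    linarith
  have e4 : φ * (N - 1) * r ^ 2 ≤ r * (-2 * r⁻¹ - A) := by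
    rw [e3]
    nlinarith
  have e5 : (φ * (N - 1) * r ^ 2) ^ 2 ≤ (r * (-2 * r⁻¹ - A)) ^ 2 :=
    pow_le_pow_left₀ (by have : 0 ≤ (N:ℝ) - 1 := by linarith
                         positivity) e4 2
  have e6 : r ^ 2 * (φ ^ 2 * (N - 1) ^ 2 * r ^ 2) ≤ r ^ 2 * (S * (N - 1)) := by
    calc r ^ 2 * (φ ^ 2 * (N - 1) ^ 2 * r ^ 2) = (φ * (N - 1) * r ^ 2) ^ 2 := by ring
      _ ≤ (r * (-2 * r⁻¹ - A)) ^ 2 := e5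
      _ = r ^ 2 * (-2 * r⁻¹ - A) ^ 2 := by ring
      _ ≤ _ := by gcongr
  have e7 := le_of_mul_le_mul_left e6 hr2
  have e8 : φ ^ 2 * (N - 1) * r ^ 2 ≤ S := by
    have hp : 0 < (N:ℝ) - 1 := by linarith
    refine le_of_mul_le_mul_right ?_ hp
    linarith
  have e9 : φ ^ 2 / (4 * N) * (N ^ 2 * r ^ 2 - N) = φ ^ 2 * N * r ^ 2 / 4 - φ ^ 2 / 4 := by
    field_simp
  rw [e9] at h2
  have e10 : 0 ≤ φ ^ 2 * r ^ 2 * (N - 2) := mul_nonneg (by positivity) (by linarith)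
  have e11 : 0 < φ * N * (r ^ 2 - 1) := mul_pos (by positivity) (by linarith)
  nlinarith [sq_nonneg φ]

theorem alg2 {N : ℕ} (μ v : Fin N → ℝ) (l : ℝ) (hv : ∑ a, v a ^ 2 = 1)
    (h1 : ∀ a, μ a * v a = l * v a) (h2 : ∀ a, 12 * (μ a / l) - 6 - 6 * v a ^ 2 ≤ 0) :
    l ^ 2 / 2 ≤ (3/2) * ∑ a, μ a ^ 2 - (∑ a, μ a ^ 3) / l := by
  have hv1 : ∀ a, v a ^ 2 ≤ 1 := by
    intro a
    have := Finset.single_le_sum (f := fun a => v a ^ 2) (fun i _ => sq_nonneg _) (Finset.mem_univ a)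
    simp only [hv] at this
    linarith
  have e : (3/2) * ∑ a, μ a ^ 2 - (∑ a, μ a ^ 3) / l = ∑ a, μ a ^ 2 * (3/2 - μ a / l) := by
    rw [Finset.mul_sum, Finset.sum_div, ← Finset.sum_sub_distrib]
    exact Finset.sum_congr rfl fun a _ => by ring
  have e' : l ^ 2 / 2 = ∑ a, (l * v a) ^ 2 / 2 := by
    rw [← Finset.sum_div]
    simp only [mul_pow]
    rw [← Finset.mul_sum, hv, mul_one]
  rw [e, e']
  refine Finset.sum_le_sum fun a _ => ?_
  rw [← h1 a]
  have k1 : μ a / l ≤ 1 := by linarith [h2 a, hv1 a]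
  have k2 : 0 ≤ μ a ^ 2 * (1 - μ a / l) := mul_nonneg (sq_nonneg _) (by linarith)
  have k3 : 0 ≤ μ a ^ 2 * (1 - v a ^ 2) := mul_nonneg (sq_nonneg _) (by linarith [hv1 a])
  nlinarith

end algebra
section lemma_one
open scoped ContDiff

namespace CP
variable {m : ℕ} {Ω : Set (Euc m)} {F : Euc m → ℝ}

theorem frame_inner {x : Euc m} {e : Fin m → Euc m}
    (h3 : ∀ u, u = ∑ a, d2 F x u (e a) • e a) (l : T1 m) (u : Euc m) :
    ∑ a, d2 F x u (e a) * l (e a) = l u := by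
  conv_rhs => rw [h3 u]
  simp

theorem cont2 (h : CP Ω F) :
    ContinuousOn (fun p : Euc m × Euc m => d2 F p.1 p.2 p.2) {p | p.1 ∈ Ω ∧ p.2 ≠ 0} :=
  (((smooth_d2 h.ho h.hs).continuousOn.comp continuousOn_fst fun _ hp => hp.1).clm_apply
    continuousOn_snd).clm_apply continuousOn_snd

theorem cont3 (h : CP Ω F) :
    ContinuousOn (fun p : Euc m × Euc m => d3 F p.1 p.2 p.2 p.2) {p | p.1 ∈ Ω ∧ p.2 ≠ 0} :=
  ((((smooth_d3 h.ho h.hs).continuousOn.comp continuousOn_fst fun _ hp => hp.1).clm_apply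
    continuousOn_snd).clm_apply continuousOn_snd).clm_apply continuousOn_snd

end CP

theorem logR1 {p h l t : ℝ} (k : ℕ) (hp : p ≠ 0) (hh : 0 < h) (hl : 0 < l) (ht : 0 < t) :
    Real.log (p ^ 2 / (h * l ^ 2) * t ^ k)
      = 2 * Real.log p + (-1) * Real.log h + (-2) * Real.log l + k * Real.log t := by
  rw [Real.log_mul (by positivity) (by positivity), Real.log_div (by positivity) (by positivity),
    Real.log_mul (by positivity) (by positivity), Real.log_pow, Real.log_pow, Real.log_pow]
  push_cast; ring

namespace CPL
variable {m : ℕ} {Ω : Set (Euc m)} {F : Euc m → ℝ} {L : T1 m}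

def R1 (F : Euc m → ℝ) (L : T1 m) (x v : Euc m) : ℝ := (L v) ^ 2 / (d2 F x v v * (L x) ^ 2)

theorem max1 (h : CPL Ω F L) (hm : 1 ≤ m) {x v : Euc m} {c : ℝ} (hx : x ∈ Ω)
    (hv1 : d2 F x v v = 1) (hc : ff F L x < c) (hR : 0 < R1 F L x v)
    (hmax : ∀ e w : Euc m, ∀ᶠ s in 𝓝 (0:ℝ), x + s • e ∈ Ω ∧ v + s • w ≠ 0 ∧
      ff F L (x + s • e) < c ∧
        R1 F L (x + s • e) (v + s • w) * (c - ff F L (x + s • e)) ^ (4 * m)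
          ≤ R1 F L x v * (c - ff F L x) ^ (4 * m)) :
    R1 F L x v ≤ 1 := by
  have hl := h.Lpos x hx
  have hp : L v ≠ 0 := by
    intro h0; simp [R1, h0] at hR
  set t := c - ff F L x with ht
  have htp : 0 < t := sub_pos.2 hc
  set k : ℕ := 4 * m with hk
  have loc : ∀ e w : Euc m, ∀ {a1 a2 b1 b2 : ℝ},
      Jet2 (fun s : ℝ => d2 F (x + s • e) (v + s • w) (v + s • w)) 1 a1 a2 →
      Jet2 (fun s : ℝ => ff F L (x + s • e)) (ff F L x) b1 b2 →
      2 * (L w / L v) + (-1) * a1 + (-2) * (L e / L x) + k * (-b1 / t) = 0 ∧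
      2 * (-(L w / L v) ^ 2) + (-1) * (a2 - a1 ^ 2) + (-2) * (-(L e / L x) ^ 2)
        + k * (-b2 / t - (b1 / t) ^ 2) ≤ 0 := by
    intro e w a1 a2 b1 b2 Jh Jf
    have j1 := ((Jet2.line v w).clm L).log hp
    have j2 := Jh.log one_ne_zero
    have j3 := ((Jet2.line x e).clm L).log hl.ne'
    have j4 := jet_t Jf hc
    have J := (((j1.smulR 2).add (j2.smulR (-1))).add (j3.smulR (-2))).add (j4.smulR (k:ℝ))
    have M := J.isLocalMax (by
      have c1 := ((Jet2.line v w).clm L).continuousAt.eventually_ne (by simpa using hp)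
      filter_upwards [hmax e w, c1] with s ⟨m1, m2, m3, m4⟩ m5
      have q1 := logR1 k m5 (h.toCP.pd m1 m2) (h.Lpos _ m1) (sub_pos.2 m3)
      have q0 := logR1 k hp (hv1 ▸ one_pos : 0 < d2 F x v v) hl htp
      have hlt : 0 < R1 F L (x + s • e) (v + s • w) * (c - ff F L (x + s • e)) ^ (4 * m) := by
        have := h.toCP.pd m1 m2
        have := h.Lpos _ m1
        have := sub_pos.2 m3
        unfold R1
        positivity
      have q2 := Real.log_le_log hlt m4
      simp only [R1] at q2
      rw [← hk, q1, q0] at q2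
      simpa using q2)
    simpa using M
  -- pure `v` variation
  have lin : ∀ u, L u = L v * d2 F x v u := by
    intro u
    have Jh := (h.toCP.jet_h hx v 0 u).congr hv1 rfl rfl
    have Jf := jet_f h hx 0
    have := (loc 0 u Jh Jf).1
    simp at this
    field_simp at this
    linarith
  obtain ⟨e, μ, H, C', C'', f1, f2, f3, f4, f5, f6, f7, -, -⟩ := h.toCP.frame2 hx hv1
  set r := L v / L x with hr
  have hr0 : r ≠ 0 := div_ne_zero hp hl.ne'
  set y : Fin m → ℝ := fun a => d2 F x v (e a) with hy
  set X : Fin m → ℝ := fun a => d2 F x x (e a) with hX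
  have hd1 : ∀ a, d1 F x (e a) = - X a := by
    intro a
    have := h.toCP.euler2 hx (e a)
    rw [hX]; simp only
    rw [h.toCP.symm2 hx x (e a)]; linarith
  have hxx : d2 F x x x = m := by
    rw [h.toCP.euler2 hx, h.toCP.euler1 hx]; ring
  have hvx : d2 F x v x = r⁻¹ := by
    have := lin x
    rw [hr, inv_div, this]; field_simp
  have sy : ∑ a, y a ^ 2 = 1 := by
    have := CP.frame_inner f2 (d2 F x v) v
    rw [hv1] at this
    rw [← this]; exact Finset.sum_congr rfl fun a _ => sq _
  have sX : ∑ a, X a ^ 2 = m := by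
    have := CP.frame_inner f2 (d2 F x x) x
    rw [hxx] at this
    rw [← this]; exact Finset.sum_congr rfl fun a _ => sq _
  have syX : ∑ a, y a * X a = r⁻¹ := by
    have := CP.frame_inner f2 (d2 F x x) v
    rw [h.toCP.symm2 hx x v, hvx] at this
    exact this
  have sμ : ∑ a, μ a = -2 * r⁻¹ := by
    have := h.toCP.euler2 hx v
    rw [hvx] at this
    rw [f5, this]; ring
  have hLe : ∀ a, L (e a) / L x = r * y a := by
    intro a; rw [lin (e a), hr]; simp only [hy]; ring
  have hw : ∀ a, L ((-(1/2) * μ a) • e a) / L v = -(1/2) * μ a * y a := by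
    intro a; rw [map_smul, smul_eq_mul, lin (e a)]; simp only [hy]; field_simp
  have main : ∀ a, _ := fun a => loc (e a) ((-(1/2) * μ a) • e a) (f6 a)
    ((jet_f h hx (e a)).congr rfl (b' := -X a + m * (r * y a)) (c' := 1 - m * (r * y a) ^ 2)
      (by rw [hLe, hd1]) (by rw [hLe, f1, if_pos rfl]))
  simp only [hLe, hw] at main
  have hmpos : (0:ℝ) < m := by exact_mod_cast hm
  have hφ : (0:ℝ) < k / t := by rw [hk]; push_cast; positivity
  have res : r ^ 2 ≤ 1 := by
    refine alg1 hm μ y X r (k / t) hr0 hφ sy sX syX sμ ?_ ?_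
    · intro a
      have := (main a).1
      linear_combination this
    · have S := Finset.sum_nonpos (s := Finset.univ) fun a _ => (main a).2
      refine le_trans (le_of_eq ?_) S
      have kk : ((k:ℝ) / t) ^ 2 / (4 * m) = k / t ^ 2 := by
        rw [hk]; push_cast; field_simp
      rw [kk]
      have split : ∀ a, 2 * (-(-(1/2) * μ a * y a) ^ 2) + (-1) * (H a - 0 ^ 2)
          + (-2) * (-(r * y a) ^ 2)
          + k * (-(1 - m * (r * y a) ^ 2) / t - ((-X a + m * (r * y a)) / t) ^ 2)
          = (1/2) * (μ a ^ 2 * (1 - y a ^ 2)) - (1/2) * μ a ^ 2 - H a + 2 * r ^ 2 * y a ^ 2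
            - k / t + k / t * m * r ^ 2 * y a ^ 2 - k / t ^ 2 * X a ^ 2
            + 2 * (k / t ^ 2) * m * r * (y a * X a) - k / t ^ 2 * m ^ 2 * r ^ 2 * y a ^ 2 := by
        intro a; field_simp; ring
      simp only [split, Finset.sum_add_distrib, Finset.sum_sub_distrib, ← Finset.mul_sum, sy, sX, syX, f7]
      simp only [Finset.sum_const, Finset.card_univ, Fintype.card_fin, nsmul_eq_mul]
      field_simp
      ring
  have : R1 F L x v = r ^ 2 := by
    rw [R1, hv1, hr, one_mul, div_pow]
  rwa [this]

theorem lemma1 (h : CPL Ω F L) (hm : 1 ≤ m) {x0 : Euc m} (hx0 : x0 ∈ Ω) (v0 : Euc m) :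
    (L v0) ^ 2 ≤ (L x0) ^ 2 * d2 F x0 v0 v0 := by
  by_cases hLv : L v0 = 0
  · rw [hLv]
    have := h.toCP.nonneg hx0 v0
    have : 0 ≤ (L x0) ^ 2 * d2 F x0 v0 v0 := by positivity
    simpa using this
  have hv0 : v0 ≠ 0 := by rintro rfl; simp at hLv
  have hg := h.toCP.pd hx0 hv0
  have hl := h.Lpos x0 hx0
  have hpos : 0 < R1 F L x0 v0 := by unfold R1; positivity
  obtain ⟨b, hb⟩ := h.ff_lower
  have g1 : ContinuousOn (fun p : Euc m × Euc m => R1 F L p.1 p.2) {p | p.1 ∈ Ω ∧ p.2 ≠ 0} := by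
    unfold R1
    refine ContinuousOn.div ?_ (h.toCP.cont2.mul ?_) ?_
    · fun_prop
    · fun_prop
    · rintro ⟨x, v⟩ ⟨hx, hv⟩
      have := h.toCP.pd hx hv
      have := h.Lpos x hx
      positivity
  have g2 : ∀ r : ℝ, 0 < r → ∀ x ∈ Ω, ∀ v, R1 F L (r • x) v = R1 F L x v := by
    intro r hr x hx v
    unfold R1
    rw [h.toCP.scale2 hr hx]
    simp only [map_smul, _root_.smul_apply, smul_eq_mul]
    congr 1
    field_simp
  have g3 : ∀ r : ℝ, r ≠ 0 → ∀ x ∈ Ω, ∀ v, R1 F L x (r • v) = R1 F L x v := by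
    intro r hr x hx v
    unfold R1
    simp only [map_smul, _root_.smul_apply, smul_eq_mul]
    rw [mul_pow, ← mul_assoc, ← sq, mul_assoc (r ^ 2)]
    exact mul_div_mul_left _ _ (pow_ne_zero 2 hr)
  have key : R1 F L x0 v0 ≤ 1 := by
    refine limit_lemma (a := ff F L x0) (b := -b) (4 * m) (c0 := ff F L x0) fun c hc => ?_
    obtain ⟨x, hx, v, hv, hv1, hfc, hRp, hle, hmax⟩ := h.maxpt (R1 F L) g1 g2 g3
      (k := 4 * m) (by omega) hx0 hv0 hc hpos
    have r1 := h.max1 hm hx hv1 hfc hRp hmax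
    refine hle.trans ?_
    have h1 := hb x hx
    have h2 : 0 ≤ c - ff F L x := (sub_pos.2 hfc).le
    gcongr
    linarith
  rw [R1, div_le_one (by positivity)] at key
  linarith

end CPL
end lemma_one
section lemma_two
open scoped ContDiff

theorem logR2 {p h t : ℝ} (hp : p ≠ 0) (hh : 0 < h) (ht : 0 < t) :
    Real.log (p ^ 2 / h ^ 3 * t ^ 4)
      = 2 * Real.log p + (-3) * Real.log h + 4 * Real.log t := by
  rw [Real.log_mul (by positivity) (by positivity), Real.log_div (by positivity) (by positivity),
    Real.log_pow, Real.log_pow, Real.log_pow]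
  push_cast; ring

namespace CPL
variable {m : ℕ} {Ω : Set (Euc m)} {F : Euc m → ℝ} {L : T1 m}

def R2 (F : Euc m → ℝ) (x v : Euc m) : ℝ := (d3 F x v v v) ^ 2 / (d2 F x v v) ^ 3

theorem max2 (h : CPL Ω F L) (hm : 1 ≤ m) {x v : Euc m} {c : ℝ} (hx : x ∈ Ω)
    (hv1 : d2 F x v v = 1) (hc : ff F L x < c) (hR : 0 < R2 F x v)
    (hmax : ∀ e w : Euc m, ∀ᶠ s in 𝓝 (0:ℝ), x + s • e ∈ Ω ∧ v + s • w ≠ 0 ∧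
      ff F L (x + s • e) < c ∧
        R2 F (x + s • e) (v + s • w) * (c - ff F L (x + s • e)) ^ 4
          ≤ R2 F x v * (c - ff F L x) ^ 4) :
    R2 F x v * (c - ff F L x) ^ 4 ≤ 4 * (c - ff F L x + 3 * m) ^ 4 := by
  have hl := h.Lpos x hx
  set l := d3 F x v v v with hldef
  have hp : l ≠ 0 := by
    intro h0; simp [R2, ← hldef, h0] at hR
  set t := c - ff F L x with ht
  have htp : 0 < t := sub_pos.2 hc
  have loc : ∀ e w : Euc m, ∀ {a1 a2 b1 b2 c1 c2 : ℝ},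
      Jet2 (fun s : ℝ => d2 F (x + s • e) (v + s • w) (v + s • w)) 1 a1 a2 →
      Jet2 (fun s : ℝ => ff F L (x + s • e)) (ff F L x) b1 b2 →
      Jet2 (fun s : ℝ => d3 F (x + s • e) (v + s • w) (v + s • w) (v + s • w)) l c1 c2 →
      2 * (c1 / l) + (-3) * a1 + 4 * (-b1 / t) = 0 ∧
      2 * (c2 / l - (c1 / l) ^ 2) + (-3) * (a2 - a1 ^ 2) + 4 * (-b2 / t - (b1 / t) ^ 2) ≤ 0 := by
    intro e w a1 a2 b1 b2 c1 c2 Jh Jf Jc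
    have j1 := Jc.log hp
    have j2 := Jh.log one_ne_zero
    have j4 := jet_t Jf hc
    have J := ((j1.smulR 2).add (j2.smulR (-3))).add (j4.smulR 4)
    have M := J.isLocalMax (by
      have n1 := Jc.continuousAt.eventually_ne (by simpa using hp)
      filter_upwards [hmax e w, n1] with s ⟨m1, m2, m3, m4⟩ m5
      have q1 := logR2 m5 (h.toCP.pd m1 m2) (sub_pos.2 m3)
      have q0 := logR2 hp (hv1 ▸ one_pos : 0 < d2 F x v v) htp
      have hlt : 0 < R2 F (x + s • e) (v + s • w) * (c - ff F L (x + s • e)) ^ 4 := by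
        have := h.toCP.pd m1 m2
        have := sub_pos.2 m3
        unfold R2
        positivity
      have q2 := Real.log_le_log hlt m4
      simp only [R2] at q2
      rw [← hldef, q1, q0] at q2
      simpa using q2)
    simpa using M
  obtain ⟨e, μ, H, C', C'', f1, f2, f3, f4, -, f6, f7, f8, f9⟩ := h.toCP.frame2 hx hv1
  rw [← hldef] at f8 f9
  set y : Fin m → ℝ := fun a => d2 F x v (e a) with hy
  set X : Fin m → ℝ := fun a => d2 F x x (e a) with hX
  set z : Fin m → ℝ := fun a => L (e a) / L x with hz
  -- pure `v` variation
  have var : ∀ a, μ a * y a = l * y a ∧ 12 * (μ a / l) - 6 - 6 * y a ^ 2 ≤ 0 := by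
    intro a
    have Jh := (h.toCP.jet_h hx v 0 (e a)).congr hv1 (b' := 2 * y a) (c' := 2)
      (by simp [hy]) (by simp [f1])
    have Jf := (jet_f h hx 0).congr rfl (b' := 0) (c' := 0) (by simp) (by simp)
    have Jc := (h.toCP.jet_c hx v 0 (e a)).congr rfl (b' := 3 * (μ a * y a)) (c' := 6 * μ a)
      (by simp [hy, f4]) (by simp [f3])
    obtain ⟨r1, r2⟩ := loc 0 (e a) Jh Jf Jc
    have e1 : μ a * y a = l * y a := by
      have h0 : μ a * y a / l = y a := by
        have : 3 * (μ a * y a) / l = 3 * (μ a * y a / l) := by ring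
        rw [this] at r1
        simp at r1
        linarith
      field_simp at h0
      linarith
    refine ⟨e1, ?_⟩
    have e2 : 3 * (μ a * y a) / l = 3 * y a := by rw [e1]; field_simp
    rw [e2] at r2
    simp at r2
    have e3 : 6 * μ a / l = 6 * (μ a / l) := by ring
    rw [e3] at r2
    nlinarith
  have hd1 : ∀ a, d1 F x (e a) = - X a := by
    intro a
    have := h.toCP.euler2 hx (e a)
    rw [hX]; simp only
    rw [h.toCP.symm2 hx x (e a)]; linarith
  have hxx : d2 F x x x = m := by
    rw [h.toCP.euler2 hx, h.toCP.euler1 hx]; ring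
  have sy : ∑ a, y a ^ 2 = 1 := by
    have := CP.frame_inner f2 (d2 F x v) v
    rw [hv1] at this
    rw [← this]; exact Finset.sum_congr rfl fun a _ => sq _
  have sX : ∑ a, X a ^ 2 = m := by
    have := CP.frame_inner f2 (d2 F x x) x
    rw [hxx] at this
    rw [← this]; exact Finset.sum_congr rfl fun a _ => sq _
  have sXz : ∑ a, X a * z a = 1 := by
    have := CP.frame_inner f2 L x
    have e1 : ∑ a, X a * z a = (∑ a, X a * L (e a)) / L x := by
      rw [Finset.sum_div]; exact Finset.sum_congr rfl fun a _ => by simp only [hz]; ring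
    rw [e1, this, div_self hl.ne']
  set q := ∑ a, z a ^ 2 with hq
  have hq0 : 0 ≤ q := Finset.sum_nonneg fun a _ => sq_nonneg _
  have hq1 : q ≤ 1 := by
    have l1 := h.lemma1 hm hx (∑ a, z a • e a)
    have e1 : L (∑ a, z a • e a) = q * L x := by
      rw [map_sum, hq, Finset.sum_mul]
      refine Finset.sum_congr rfl fun a _ => ?_
      rw [map_smul, smul_eq_mul]; simp only [hz]; field_simp
    have e2 : d2 F x (∑ a, z a • e a) (∑ a, z a • e a) = q := by
      simp only [map_sum, map_smul, _root_.sum_apply, _root_.smul_apply, smul_eq_mul, f1]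
      simp [hq, sq]
    rw [e1, e2] at l1
    have l2 : (L x) ^ 2 * (q * q) ≤ (L x) ^ 2 * q := by nlinarith
    have l3 := le_of_mul_le_mul_left l2 (by positivity)
    by_contra! hgt
    nlinarith
  have main : ∀ a, _ := fun a => loc (e a) ((-(1/2) * μ a) • e a) (f6 a)
    ((jet_f h hx (e a)).congr rfl (b' := -X a + m * z a) (c' := 1 - m * z a ^ 2)
      (by rw [hd1]) (by rw [f1, if_pos rfl])) (f8 a)
  have a2 := alg2 μ y l sy (fun a => (var a).1) (fun a => (var a).2)
  have S := Finset.sum_nonpos (s := Finset.univ) fun a _ => (main a).2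
  have split : ∀ a, 2 * (C'' a / l - (C' a / l) ^ 2) + (-3) * (H a - 0 ^ 2)
      + 4 * (-(1 - m * z a ^ 2) / t - ((-X a + m * z a) / t) ^ 2)
      = 2 / l * C'' a - 3 * H a - 4 / t + 4 / t * m * z a ^ 2
        - 12 / t ^ 2 * X a ^ 2 + 24 / t ^ 2 * m * (X a * z a) - 12 / t ^ 2 * m ^ 2 * z a ^ 2 := by
    intro a
    have e1 : C' a / l = 2 * ((-X a + m * z a) / t) := by
      have := (main a).1
      have h4 : 4 * (-(-X a + m * z a) / t) = -4 * ((-X a + m * z a) / t) := by ring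
      rw [h4] at this
      linarith
    rw [e1]; ring
  simp only [split, Finset.sum_add_distrib, Finset.sum_sub_distrib, ← Finset.mul_sum, sX, sXz,
    f7, f9, ← hq] at S
  simp only [Finset.sum_const, Finset.card_univ, Fintype.card_fin, nsmul_eq_mul] at S
  have e5 : 2 / l * (2 * l - 1 / 2 * ∑ a, μ a ^ 3) = 4 - (∑ a, μ a ^ 3) / l := by
    field_simp; ring
  rw [e5] at S
  have hmpos : (0:ℝ) ≤ m := Nat.cast_nonneg m
  have b1 : l ^ 2 / 2 ≤ 2 + 4 / t * m + 12 / t ^ 2 * m ^ 2 := by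
    have k1 : 0 ≤ 4 / t * m * q := by positivity
    have k2 : 0 ≤ 12 / t ^ 2 * m := by positivity
    have k3 : 0 ≤ 12 / t ^ 2 * m ^ 2 * (1 - q) := mul_nonneg (by positivity) (by linarith)
    generalize (∑ a, μ a ^ 3) / l = A at S a2
    generalize ∑ a, μ a ^ 2 = B at S a2
    have e0 : (m:ℝ) * (4 / t) = 4 / t * m := mul_comm _ _
    have e1 : 24 / t ^ 2 * (m:ℝ) * 1 = 2 * (12 / t ^ 2 * m) := by ring
    rw [e0, e1] at S
    rw [mul_sub, mul_one] at k3
    generalize 4 / t * (m:ℝ) * q = p1 at *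
    generalize 12 / t ^ 2 * (m:ℝ) ^ 2 * q = p2 at *
    generalize 12 / t ^ 2 * (m:ℝ) ^ 2 = p3 at *
    generalize 12 / t ^ 2 * (m:ℝ) = p4 at *
    generalize 4 / t * (m:ℝ) = p5 at *
    linarith
  have b2 : l ^ 2 * t ^ 4 ≤ 4 * t ^ 4 + 8 * m * t ^ 3 + 24 * m ^ 2 * t ^ 2 := by
    have := mul_le_mul_of_nonneg_right b1 (by positivity : 0 ≤ 2 * t ^ 4)
    have e6 : (2 + 4 / t * m + 12 / t ^ 2 * m ^ 2) * (2 * t ^ 4)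
        = 4 * t ^ 4 + 8 * m * t ^ 3 + 24 * m ^ 2 * t ^ 2 := by
      field_simp; ring
    rw [e6] at this
    linarith
  have e7 : R2 F x v = l ^ 2 := by rw [R2, hv1, ← hldef]; ring
  rw [e7]
  have e8 : 4 * (t + 3 * m) ^ 4 = 4 * t ^ 4 + 8 * m * t ^ 3 + 24 * m ^ 2 * t ^ 2
      + (40 * m * t ^ 3 + 192 * m ^ 2 * t ^ 2 + 432 * m ^ 3 * t + 324 * m ^ 4) := by ring
  have e9 : 0 ≤ 40 * m * t ^ 3 + 192 * m ^ 2 * t ^ 2 + 432 * m ^ 3 * t + 324 * (m:ℝ) ^ 4 := by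
    positivity
  linarith

theorem lemma2 (h : CPL Ω F L) (hm : 1 ≤ m) {x0 : Euc m} (hx0 : x0 ∈ Ω) (v0 : Euc m) :
    (d3 F x0 v0 v0 v0) ^ 2 ≤ 4 * (d2 F x0 v0 v0) ^ 3 := by
  by_cases hLv : d3 F x0 v0 v0 v0 = 0
  · rw [hLv]
    have := h.toCP.nonneg hx0 v0
    have : 0 ≤ 4 * (d2 F x0 v0 v0) ^ 3 := by positivity
    simpa using this
  have hv0 : v0 ≠ 0 := by rintro rfl; simp at hLv
  have hg := h.toCP.pd hx0 hv0
  have hpos : 0 < R2 F x0 v0 := by unfold R2; positivity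
  obtain ⟨b, hb⟩ := h.ff_lower
  have g1 : ContinuousOn (fun p : Euc m × Euc m => R2 F p.1 p.2) {p | p.1 ∈ Ω ∧ p.2 ≠ 0} := by
    unfold R2
    refine ContinuousOn.div (h.toCP.cont3.pow 2) (h.toCP.cont2.pow 3) ?_
    rintro ⟨x, v⟩ ⟨hx, hv⟩
    have := h.toCP.pd hx hv
    positivity
  have g2 : ∀ r : ℝ, 0 < r → ∀ x ∈ Ω, ∀ v, R2 F (r • x) v = R2 F x v := by
    intro r hr x hx v
    unfold R2
    rw [h.toCP.scale2 hr hx, h.toCP.scale3 hr hx]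
    simp only [_root_.smul_apply, smul_eq_mul]
    rw [mul_pow _ (d3 F x v v v), mul_pow _ (d2 F x v v), show (r⁻¹ * (r⁻¹ * r⁻¹)) ^ 2 = (r⁻¹ * r⁻¹) ^ 3 by ring]
    exact mul_div_mul_left _ _ (by positivity)
  have g3 : ∀ r : ℝ, r ≠ 0 → ∀ x ∈ Ω, ∀ v, R2 F x (r • v) = R2 F x v := by
    intro r hr x hx v
    unfold R2
    simp only [map_smul, _root_.smul_apply, smul_eq_mul]
    rw [show (r * (r * (r * d3 F x v v v))) ^ 2 = r ^ 6 * (d3 F x v v v) ^ 2 by ring,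
      show (r * (r * d2 F x v v)) ^ 3 = r ^ 6 * (d2 F x v v) ^ 3 by ring]
    exact mul_div_mul_left _ _ (pow_ne_zero 6 hr)
  have key : R2 F x0 v0 ≤ 4 := by
    refine limit_lemma (a := ff F L x0) (b := 3 * m - b) 4 (c0 := ff F L x0) fun c hc => ?_
    obtain ⟨x, hx, v, hv, hv1, hfc, hRp, hle, hmax⟩ := h.maxpt (R2 F) g1 g2 g3
      (k := 4) (by omega) hx0 hv0 hc hpos
    have r1 := h.max2 hm hx hv1 hfc hRp hmax
    refine hle.trans (r1.trans ?_)
    have h1 := hb x hx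
    have h2 : 0 ≤ c - ff F L x := (sub_pos.2 hfc).le
    have h3 : (0:ℝ) ≤ m := Nat.cast_nonneg m
    have h4 : c - ff F L x + 3 * m ≤ c + (3 * m - b) := by linarith
    exact mul_le_mul_of_nonneg_left (pow_le_pow_left₀ (by positivity) h4 4) (by norm_num)
  rwa [R2, div_le_iff₀ (by positivity)] at key

end CPL

theorem iter3_eq {m : ℕ} (F : Euc m → ℝ) (x v : Euc m) :
    iteratedFDeriv ℝ 3 F x ![v, v, v] = d3 F x v v v := by
  rw [iteratedFDeriv_succ_apply_right, iteratedFDeriv_two_apply]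
  rfl

theorem iter2_eq {m : ℕ} (F : Euc m → ℝ) (x v : Euc m) :
    iteratedFDeriv ℝ 2 F x ![v, v] = d2 F x v v := by
  rw [iteratedFDeriv_two_apply]
  rfl

end lemma_two

/-- The canonical potential of a proper open convex cone in `ℝ^{n+1}` is a
`1`-self-concordant `(n+1)`-normal barrier for the cone. -/
theorem canonical_potential_is_normal_barrier
    (n : ℕ) (Ω : Set (Euc (n + 1))) (hΩ : IsOpenProperConvexCone Ω)
    (F : Euc (n + 1) → ℝ) (hF : IsCanonicalPotential n Ω F) :
    ∀ x ∈ Ω, ∀ v : Euc (n + 1),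
      (iteratedFDeriv ℝ 3 F x ![v, v, v]) ^ 2 ≤
        4 * (iteratedFDeriv ℝ 2 F x ![v, v]) ^ 3 ∧
      (fderiv ℝ F x v) ^ 2 ≤ (n + 1 : ℝ) * iteratedFDeriv ℝ 2 F x ![v, v] := by
  intro x hx v
  obtain ⟨L, h⟩ := exists_CPL hΩ hF
  rw [iter3_eq, iter2_eq]
  refine ⟨h.lemma2 (by omega) hx v, ?_⟩
  have h1 := h.toCP.cs hx v x
  have h2 := h.toCP.euler2 hx v
  have h3 := h.toCP.euler2 hx x
  rw [h.toCP.euler1 hx] at h3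
  rw [h2, h3] at h1
  push_cast at h1
  change (d1 F x v) ^ 2 ≤ _
  linarith [neg_sq (d1 F x v)]
end
end
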